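/- arXiv:2501.11125 — 2 statements merged into one kernel-verified Lean document; each statement's English description precedes it below -/
import Mathlib

section
/- Let K be an algebraically closed field of characteristic 0, let G be a group, and let ρ: G → GL(V) be a finite-dimensional representation of G over K. Then d(G, V) = dim V if and only if the determinant map takes only finitely many distinct values on ρ(G). -/
open CategoryTheory MonoidalCategory Limits

noncomputable section

universe u

/-- The `n`-th tensor power of a representation, in the category `Rep k G`. -/
def tpow {k G : Type u} [Field k] [Monoid G] (V : Rep k G) : ℕ → Rep k G
  | 0 => 𝟙_ (Rep k G)
  | n + 1 => tpow V n ⊗ V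

/-- `TS V` : the number of trivial direct summands of `V`, counted with multiplicity, i.e.
the largest `n` such that the trivial representation on `k^n` is a direct summand of `V`. -/
def TS {k G : Type u} [Field k] [Monoid G] (V : Rep k G) : ℕ :=
  sSup {n : ℕ | ∃ W : Rep k G, Nonempty (V ≅ Rep.trivial k G (Fin n → k) ⊞ W)}

/-- `dG V = limsup_{n → ∞} TS(V^{⊗n})^(1/n)`. -/
def dG {k G : Type u} [Field k] [Monoid G] (V : Rep k G) : ℝ :=
  Filter.limsup (fun n : ℕ => (TS (tpow V n) : ℝ) ^ ((n : ℝ)⁻¹)) Filter.atTop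

section Rep

variable {k G : Type u} [Field k]

open scoped Matrix

open Module

variable [Monoid G]

/-- The basis of `M ⊗ N` indexed by words of length `n + 1`, obtained from a basis of `M` indexed by
words of length `n` and a basis of `N` indexed by letters. -/
def snocBasis {M N : Type u} [AddCommGroup M] [Module k M] [AddCommGroup N] [Module k N]
    {ι : Type} {n : ℕ} (B : Basis (Fin n → ι) k M) (b : Basis ι k N) :
    Basis (Fin (n + 1) → ι) k (TensorProduct k M N) :=
  (B.tensorProduct b).reindex ((Equiv.prodComm _ _).trans (Fin.snocEquiv fun _ => ι))

lemma snocBasis_apply {M N : Type u} [AddCommGroup M] [Module k M] [AddCommGroup N] [Module k N]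
    {ι : Type} {n : ℕ} (B : Basis (Fin n → ι) k M) (b : Basis ι k N) (w : Fin (n + 1) → ι) :
    snocBasis B b w = B (Fin.init w) ⊗ₜ[k] b (w (Fin.last n)) := by
  simp [snocBasis, Fin.snocEquiv]

lemma snocBasis_repr_tmul {M N : Type u} [AddCommGroup M] [Module k M] [AddCommGroup N]
    [Module k N] {ι : Type} {n : ℕ} (B : Basis (Fin n → ι) k M) (b : Basis ι k N)
    (x : M) (y : N) (w : Fin (n + 1) → ι) :
    (snocBasis B b).repr (x ⊗ₜ[k] y) w =
      B.repr x (Fin.init w) * b.repr y (w (Fin.last n)) := by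
  rw [snocBasis, Basis.repr_reindex_apply]
  simp [Fin.snocEquiv, mul_comm]

/-- A basis of the `n`-th tensor power indexed by words, obtained from a basis of `V`. -/
def tpowBasis {V : Rep k G} {ι : Type} (b : Basis ι k V) :
    ∀ n : ℕ, Basis (Fin n → ι) k (tpow V n)
  | 0 => Basis.singleton (Fin 0 → ι) k
  | n + 1 => snocBasis (tpowBasis b n) b

lemma tpowBasis_repr {V : Rep k G} {ι : Type} (b : Basis ι k V) (g : G) (n : ℕ)
    (w w' : Fin n → ι) :
    (tpowBasis b n).repr ((tpow V n).ρ g (tpowBasis b n w')) w =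
      ∏ p, b.repr (V.ρ g (b (w' p))) (w p) := by
  induction n with
  | zero =>
    have h : (tpow V 0).ρ g (tpowBasis b 0 w') = tpowBasis b 0 w' := rfl
    rw [h, Basis.repr_self, Subsingleton.elim w w']
    simp
  | succ n ih =>
    have h1 : tpowBasis b (n + 1) w' =
        (tpowBasis b n (Fin.init w')) ⊗ₜ[k] (b (w' (Fin.last n))) := snocBasis_apply _ _ _
    have h2 : (tpow V (n + 1)).ρ g (tpowBasis b (n + 1) w') =
        ((tpow V n).ρ g (tpowBasis b n (Fin.init w'))) ⊗ₜ[k] (V.ρ g (b (w' (Fin.last n)))) := by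
      rw [h1]; rfl
    rw [h2, Fin.prod_univ_castSucc]
    exact (snocBasis_repr_tmul _ _ _ _ _).trans (congrArg₂ _ (ih _ _) rfl)

lemma card_mem_of_isUnit_det {U : Rep k G} {W : Type} [Fintype W] [DecidableEq W] (B : Basis W k U)
    {S : Type} [Fintype S] [DecidableEq S] (X Y : S → W → k)
    (hX : ∀ g s, LinearMap.toMatrix B B (U.ρ g) *ᵥ X s = X s)
    (hY : ∀ g s, Y s ᵥ* LinearMap.toMatrix B B (U.ρ g) = Y s)
    (h : IsUnit (Matrix.of fun s t => Y s ⬝ᵥ X t).det) :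
    Fintype.card S ∈ {n : ℕ | ∃ W : Rep k G, Nonempty (U ≅ Rep.trivial k G (Fin n → k) ⊞ W)} := by
  set M := Matrix.of fun s t => Y s ⬝ᵥ X t with hM
  let e := Fintype.equivFin S
  let i₀ : (Fin (Fintype.card S) → k) →ₗ[k] U :=
    B.equivFun.symm.toLinearMap ∘ₗ (Matrix.of X)ᵀ.mulVecLin ∘ₗ LinearMap.funLeft k k e
  let p₀ : U →ₗ[k] (Fin (Fintype.card S) → k) :=
    LinearMap.funLeft k k e.symm ∘ₗ M⁻¹.mulVecLin ∘ₗ (Matrix.of Y).mulVecLin ∘ₗ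
      B.equivFun.toLinearMap
  have hact : ∀ g u, B.equivFun (U.ρ g u) = LinearMap.toMatrix B B (U.ρ g) *ᵥ B.equivFun u := by
    intro g u
    exact (LinearMap.toMatrix_mulVec_repr B B (U.ρ g) u).symm
  have hi : ∀ (g : G) (c), i₀ c = U.ρ g (i₀ c) := by
    intro g c
    apply B.equivFun.injective
    rw [hact]
    simp only [i₀, LinearMap.comp_apply, LinearEquiv.coe_coe, LinearEquiv.apply_symm_apply,
      Matrix.mulVecLin_apply]
    rw [Matrix.mulVec_mulVec]
    have : (Matrix.of X)ᵀ = LinearMap.toMatrix B B (U.ρ g) * (Matrix.of X)ᵀ := by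
      ext w s
      exact (congrFun (hX g s) w).symm
    rw [← this]
  have hp : ∀ (g : G) (u), p₀ (U.ρ g u) = p₀ u := by
    intro g u
    simp only [p₀, LinearMap.comp_apply, LinearEquiv.coe_coe, Matrix.mulVecLin_apply]
    rw [hact, Matrix.mulVec_mulVec _ (Matrix.of Y)]
    have : Matrix.of Y * LinearMap.toMatrix B B (U.ρ g) = Matrix.of Y := by
      ext s w
      exact congrFun (hY g s) w
    rw [this]
  have hpi : ∀ c, p₀ (i₀ c) = c := by
    intro c
    simp only [p₀, i₀, LinearMap.comp_apply, LinearEquiv.coe_coe, LinearEquiv.apply_symm_apply,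
      Matrix.mulVecLin_apply, Matrix.mulVec_mulVec]
    have : M⁻¹ * (Matrix.of Y * (Matrix.of X)ᵀ) = 1 := by
      have h2 : Matrix.of Y * (Matrix.of X)ᵀ = M := by
        ext s t; rfl
      rw [h2, Matrix.nonsing_inv_mul _ h]
    rw [this, Matrix.one_mulVec]
    ext x
    simp [LinearMap.funLeft]
  let i : Rep.trivial k G (Fin (Fintype.card S) → k) ⟶ U :=
    Rep.ofHom (LinearMap.intertwiningMap_of_isIntertwiningMap _ _ i₀ hi)
  let p : U ⟶ Rep.trivial k G (Fin (Fintype.card S) → k) :=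
    Rep.ofHom (LinearMap.intertwiningMap_of_isIntertwiningMap _ _ p₀ hp)
  have hip : i ≫ p = 𝟙 _ := by
    apply Rep.hom_ext
    apply Representation.IntertwiningMap.ext
    exact LinearMap.ext hpi
  have : IsSplitMono i := IsSplitMono.mk' ⟨p, hip⟩
  exact ⟨_, ⟨biprod.uniqueUpToIso _ _ (isBilimitBinaryBiconeOfIsSplitMonoOfCokernel
    (cokernelIsCokernel i))⟩⟩

lemma le_finrank_ker_of_iso {U : Rep k G} [FiniteDimensional k U] {n : ℕ} {W : Rep k G}
    (e : U ≅ Rep.trivial k G (Fin n → k) ⊞ W) (g : G) :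
    n ≤ finrank k (LinearMap.ker (U.ρ g - 1)) := by
  let i : Rep.trivial k G (Fin n → k) ⟶ U := biprod.inl ≫ e.inv
  let p : U ⟶ Rep.trivial k G (Fin n → k) := e.hom ≫ biprod.fst
  have hip : i ≫ p = 𝟙 _ := by simp [i, p]
  have hinj : Function.Injective i.hom.toLinearMap := by
    apply Function.LeftInverse.injective (g := p.hom.toLinearMap)
    intro c
    exact congrArg (fun f : Rep.trivial k G (Fin n → k) ⟶ Rep.trivial k G (Fin n → k) =>
      f.hom.toLinearMap c) hip
  have hmem : ∀ c, i.hom.toLinearMap c ∈ LinearMap.ker (U.ρ g - 1) := by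
    intro c
    rw [LinearMap.mem_ker, LinearMap.sub_apply, sub_eq_zero]
    exact (Rep.hom_comm_apply i g c).symm
  have := LinearMap.finrank_le_finrank_of_injective
    (f := LinearMap.codRestrict (LinearMap.ker (U.ρ g - 1)) i.hom.toLinearMap hmem)
    (fun a b hab => hinj (congrArg Subtype.val hab))
  simpa using this

end Rep

section Triangular

open Module

variable {k : Type*} [Field k]

lemma exists_basis_upperTriangular [IsAlgClosed k] (d : ℕ) : ∀ {V : Type u} [AddCommGroup V]
    [Module k V] [FiniteDimensional k V] (f : V →ₗ[k] V), finrank k V = d →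
    ∃ b : Basis (Fin d) k V, ∀ i j, j < i → b.repr (f (b j)) i = 0 := by
  induction d with
  | zero =>
    intro V _ _ _ f hd
    exact ⟨finBasisOfFinrankEq k V hd, fun i => i.elim0⟩
  | succ d ih =>
    intro V _ _ _ f hd
    have : Nontrivial V := nontrivial_of_finrank_pos (R := k) (by omega)
    obtain ⟨μ, hμ⟩ := Module.End.exists_eigenvalue (K := k) (V := Dual k V) (Dual.transpose f)
    obtain ⟨φ, hφ⟩ := hμ.exists_hasEigenvector
    have hφf : ∀ x, φ (f x) = μ * φ x := fun x =>
      congrArg (fun ψ : Dual k V => ψ x) hφ.apply_eq_smul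
    obtain ⟨y, hy⟩ : ∃ y, φ y ≠ 0 := by
      by_contra! h
      exact hφ.2 (LinearMap.ext h)
    have hmem : ∀ x ∈ LinearMap.ker φ, f x ∈ LinearMap.ker φ := by
      intro x hx
      rw [LinearMap.mem_ker] at *
      rw [hφf, hx, mul_zero]
    have hfin : finrank k (LinearMap.ker φ) = d := by
      have h1 := Dual.finrank_ker_add_one_of_ne_zero hφ.2
      omega
    obtain ⟨b, hb⟩ := ih (f.restrict hmem) hfin
    have hli : ∀ (c : k), ∀ x ∈ LinearMap.ker φ, c • y + x = 0 → c = 0 := by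
      intro c x hx h
      have := congrArg φ h
      rw [LinearMap.mem_ker] at hx
      simpa [hx, hy] using this
    have hsp : ∀ z : V, ∃ c : k, z + c • y ∈ LinearMap.ker φ := by
      intro z
      refine ⟨-(φ z / φ y), ?_⟩
      rw [LinearMap.mem_ker]
      simp [hy]
    let B := Basis.mkFinSnoc b y hli hsp
    have hBc : ∀ j : Fin d, B j.castSucc = b j := by
      intro j
      simp [B, Basis.coe_mkFinSnoc]
    have hrepr : ∀ x : LinearMap.ker φ,
        (∀ i : Fin d, B.repr x i.castSucc = b.repr x i) ∧ B.repr x (Fin.last d) = 0 := by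
      intro x
      have hx : (x : V) = ∑ i, b.repr x i • B i.castSucc := by
        have h := congrArg (LinearMap.ker φ).subtype (b.sum_repr x).symm
        simp only [map_sum, map_smul, Submodule.subtype_apply] at h
        simp only [hBc]
        exact h
      rw [hx]
      simp [Finsupp.single_apply]
    refine ⟨B, fun i j hij => ?_⟩
    obtain ⟨j, rfl⟩ : ∃ j', j = Fin.castSucc j' :=
      ⟨j.castPred (ne_of_lt (lt_of_lt_of_le hij (Fin.le_last i))), by simp⟩
    rw [hBc]
    have h1 := hrepr (f.restrict hmem (b j))
    rw [LinearMap.coe_restrict_apply] at h1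
    induction i using Fin.lastCases with
    | last => exact h1.2
    | cast i => rw [h1.1]; exact hb i j (by simpa using hij)

lemma finrank_ker_le_card_diag_eq_zero {U W : Type*} [AddCommGroup U] [Module k U] [Fintype W]
    [LinearOrder W] (B : Basis W k U) (f : U →ₗ[k] U)
    (h : ∀ i j, j < i → B.repr (f (B j)) i = 0) :
    finrank k (LinearMap.ker f) ≤ Nat.card {w // B.repr (f (B w)) w = 0} := by
  classical
  have : FiniteDimensional k U := B.finiteDimensional_of_finite
  let M := LinearMap.toMatrix B B f
  let p : W → Prop := fun w => ¬ B.repr (f (B w)) w = 0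
  let N : Matrix {w // p w} {w // p w} k := M.submatrix Subtype.val Subtype.val
  have hM : ∀ i j, M i j = B.repr (f (B j)) i := fun i j => LinearMap.toMatrix_apply _ _ _ _ _
  have hN : IsUnit N.det := by
    rw [Matrix.det_of_isUpperTriangular, isUnit_iff_ne_zero, Finset.prod_ne_zero_iff]
    · intro w _
      exact fun h0 => w.2 ((hM _ _).symm.trans h0)
    · intro i j hij
      exact (hM _ _).trans (h _ _ hij)
  have h1 : Fintype.card {w // p w} ≤ finrank k (LinearMap.range f) := by
    have h2 := Matrix.rank_of_isUnit N ((Matrix.isUnit_iff_isUnit_det _).2 hN)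
    have h3 : M.rank = finrank k (LinearMap.range f) := by
      rw [Matrix.rank_eq_finrank_range_toLin M B B, Matrix.toLin_toMatrix]
    rw [← h2, ← h3]
    exact Matrix.rank_submatrix_le _ _ _
  have h4 := f.finrank_range_add_finrank_ker
  rw [finrank_eq_card_basis B] at h4
  have h5 := Fintype.card_subtype_compl (fun w => B.repr (f (B w)) w = 0)
  have h6 := Fintype.card_subtype_le (fun w => B.repr (f (B w)) w = 0)
  rw [Nat.card_eq_fintype_card]
  simp only [p] at h1
  omega

end Triangular

section Rep

open Module

variable {k G : Type u} [Field k] [Monoid G]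

lemma finrank_ker_tpow_le (V : Rep k G) {d : ℕ} (b : Basis (Fin d) k V) (g : G)
    (h : ∀ i j, j < i → b.repr (V.ρ g (b j)) i = 0) (n : ℕ) :
    finrank k (LinearMap.ker ((tpow V n).ρ g - 1)) ≤
      Nat.card {w : Fin n → Fin d // ∏ p, b.repr (V.ρ g (b (w p))) (w p) = 1} := by
  let B := (tpowBasis b n).reindex toLex
  have hB : ∀ i j : Lex (Fin n → Fin d), B.repr (((tpow V n).ρ g - 1) (B j)) i =
      (∏ p, b.repr (V.ρ g (b (ofLex j p))) (ofLex i p)) - if j = i then 1 else 0 := by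
    intro i j
    rw [LinearMap.sub_apply, map_sub, Finsupp.sub_apply, Module.End.one_apply, Basis.repr_self,
      Finsupp.single_apply]
    congr 1
    rw [Basis.repr_reindex_apply, Basis.reindex_apply]
    exact tpowBasis_repr b g n _ _
  have h1 := finrank_ker_le_card_diag_eq_zero B ((tpow V n).ρ g - 1) (by
    intro i j hij
    rw [hB, if_neg hij.ne, sub_zero, Finset.prod_eq_zero_iff]
    obtain ⟨p, -, hp⟩ := hij
    exact ⟨p, Finset.mem_univ _, h _ _ hp⟩)
  refine h1.trans (Nat.card_congr (Equiv.subtypeEquiv ofLex fun w => ?_)).le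
  rw [hB, if_pos rfl, sub_eq_zero]

instance {V : Rep k G} [FiniteDimensional k V] (n : ℕ) : FiniteDimensional k (tpow V n) :=
  (tpowBasis (finBasis k V) n).finiteDimensional_of_finite

lemma TS_tpow_le_card (V : Rep k G) {d : ℕ} (b : Basis (Fin d) k V) (g : G)
    (h : ∀ i j, j < i → b.repr (V.ρ g (b j)) i = 0) (n : ℕ) :
    TS (tpow V n) ≤
      Nat.card {w : Fin n → Fin d // ∏ p, b.repr (V.ρ g (b (w p))) (w p) = 1} := by
  have : FiniteDimensional k V := b.finiteDimensional_of_finite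
  refine csSup_le' ?_
  rintro m ⟨W, ⟨e⟩⟩
  exact (le_finrank_ker_of_iso e g).trans (finrank_ker_tpow_le V b g h n)

lemma le_TS_of_mem {U : Rep k G} [FiniteDimensional k U] {m : ℕ}
    (h : m ∈ {n : ℕ | ∃ W : Rep k G, Nonempty (U ≅ Rep.trivial k G (Fin n → k) ⊞ W)}) :
    m ≤ TS U := by
  refine le_csSup ⟨finrank k U, ?_⟩ h
  rintro m ⟨W, ⟨e⟩⟩
  exact (le_finrank_ker_of_iso e 1).trans (Submodule.finrank_le _)

lemma TS_tpow_le_pow (V : Rep k G) [FiniteDimensional k V] (n : ℕ) :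
    TS (tpow V n) ≤ finrank k V ^ n := by
  refine csSup_le' ?_
  rintro m ⟨W, ⟨e⟩⟩
  refine ((le_finrank_ker_of_iso e 1).trans (Submodule.finrank_le _)).trans ?_
  rw [finrank_eq_card_basis (tpowBasis (finBasis k V) n)]
  simp

end Rep

section UpperBound

open Module

lemma exists_lt_card_zero_sum_le_pow {d : ℕ} (a : Fin d → ℝ) (ha : ∑ i, a i ≠ 0) :
    ∃ C : ℝ, 0 ≤ C ∧ C < d ∧
      ∀ n : ℕ, (Nat.card {w : Fin n → Fin d // ∑ p, a (w p) = 0} : ℝ) ≤ C ^ n := by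
  let F : ℝ → ℝ := fun t => ∑ i, Real.exp (t * a i)
  have hF : HasDerivAt F (∑ i, a i) 0 := by
    have : HasDerivAt F (∑ i, Real.exp (0 * a i) * (1 * a i)) 0 :=
      HasDerivAt.fun_sum fun i _ => ((hasDerivAt_id (0 : ℝ)).mul_const (a i)).exp
    simpa using this
  obtain ⟨t, ht⟩ : ∃ t, F t < d := by
    by_contra! h
    refine ha (IsLocalMin.hasDerivAt_eq_zero (f := F) (a := 0) ?_ hF)
    exact Filter.Eventually.of_forall fun t => by simpa [F] using h t
  refine ⟨F t, Finset.sum_nonneg fun i _ => (Real.exp_pos _).le, ht, fun n => ?_⟩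
  classical
  have h1 : F t ^ n = ∑ w : Fin n → Fin d, ∏ p, Real.exp (t * a (w p)) := by
    exact Fintype.sum_pow _ n
  rw [h1, Nat.card_eq_fintype_card, Fintype.card_subtype, Finset.cast_card]
  refine (Finset.sum_le_sum fun w hw => ?_).trans (Finset.sum_le_sum_of_subset_of_nonneg
    (Finset.filter_subset _ _) fun w _ _ => Finset.prod_nonneg fun p _ => (Real.exp_pos _).le)
  rw [← Real.exp_sum, ← Finset.mul_sum, (Finset.mem_filter.1 hw).2]
  simp

lemma exists_weights_of_nsmul_one_notMem {d : ℕ} (Λ : AddSubgroup (Fin d → ℤ))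
    (h : ∀ j : ℕ, 0 < j → (fun _ => (j : ℤ)) ∉ Λ) :
    ∃ a : Fin d → ℚ, (∀ c ∈ Λ, ∑ i, (c i : ℚ) * a i = 0) ∧ ∑ i, a i ≠ 0 := by
  let P : Submodule ℚ (Fin d → ℚ) :=
    { carrier := {x | ∃ j : ℕ, 0 < j ∧ ∃ c ∈ Λ, ∀ i, (j : ℚ) * x i = c i}
      zero_mem' := ⟨1, one_pos, 0, Λ.zero_mem, by simp⟩
      add_mem' := by
        rintro x y ⟨j, hj, c, hc, hx⟩ ⟨l, hl, e, he, hy⟩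
        refine ⟨j * l, Nat.mul_pos hj hl, l • c + j • e,
          Λ.add_mem (Λ.nsmul_mem hc _) (Λ.nsmul_mem he _), fun i => ?_⟩
        rw [Pi.add_apply, Pi.add_apply, Pi.smul_apply, Pi.smul_apply, nsmul_eq_mul, nsmul_eq_mul]
        push_cast
        rw [← hx, ← hy]
        ring
      smul_mem' := by
        rintro r x ⟨j, hj, c, hc, hx⟩
        refine ⟨r.den * j, Nat.mul_pos r.den_pos hj, r.num • c, Λ.zsmul_mem hc _, fun i => ?_⟩
        simp only [Pi.smul_apply, smul_eq_mul]
        push_cast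
        rw [← hx]
        have h3 := Rat.den_mul_eq_num r
        linear_combination (j * x i) * h3 }
  have hP : (fun _ => (1 : ℚ)) ∉ P := by
    rintro ⟨j, hj, c, hc, hx⟩
    refine h j hj ?_
    convert hc using 1
    ext i
    have := hx i
    rw [mul_one] at this
    exact_mod_cast this
  obtain ⟨φ, hφ1, hφ2⟩ := Submodule.exists_le_ker_of_notMem hP
  have key : ∀ x : Fin d → ℚ, φ x = ∑ i, x i * φ (Pi.single i 1) := by
    intro x
    conv_lhs => rw [← Finset.univ_sum_single x]
    rw [map_sum]
    refine Finset.sum_congr rfl fun i _ => ?_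
    rw [← smul_eq_mul, ← map_smul, ← Pi.single_smul, smul_eq_mul, mul_one]
  refine ⟨fun i => φ (Pi.single i 1), fun c hc => ?_, ?_⟩
  · rw [← key fun i => (c i : ℚ)]
    exact hφ2 ⟨1, one_pos, c, hc, by simp⟩
  · rw [key] at hφ1
    simpa using hφ1

lemma exists_lt_prod_eq_one_le_pow {k : Type*} [Field k] {d : ℕ} (l : ℕ → Fin d → k)
    (h0 : ∀ N i, l N i ≠ 0) (h : ∀ N j : ℕ, 0 < j → j ≤ N → (∏ i, l N i) ^ j ≠ 1) :
    ∃ C : ℝ, 0 ≤ C ∧ C < d ∧ ∀ n : ℕ, ∃ N,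
      (Nat.card {w : Fin n → Fin d // ∏ p, l N (w p) = 1} : ℝ) ≤ C ^ n := by
  let F : Ultrafilter ℕ := Filter.hyperfilter ℕ
  let Λ : AddSubgroup (Fin d → ℤ) :=
    { carrier := {c | ∀ᶠ N in (F : Filter ℕ), ∏ i, l N i ^ c i = 1}
      zero_mem' := by simp
      add_mem' := by
        intro x y hx hy
        filter_upwards [hx, hy] with N h1 h2
        simp only [Pi.add_apply, zpow_add₀ (h0 N _), Finset.prod_mul_distrib, h1, h2, mul_one]
      neg_mem' := by
        intro x hx
        filter_upwards [hx] with N h1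
        simp only [Pi.neg_apply, zpow_neg, Finset.prod_inv_distrib, h1, inv_one] }
  obtain ⟨a, ha, ha1⟩ := exists_weights_of_nsmul_one_notMem Λ (by
    intro j hj hmem
    have h1 : ∀ᶠ N in (F : Filter ℕ), j ≤ N :=
      (Filter.eventually_ge_atTop j).filter_mono (by
        rw [← Nat.cofinite_eq_atTop]; exact Filter.hyperfilter_le_cofinite)
    obtain ⟨N, h2, h3⟩ := (h1.and hmem).exists
    refine h N j hj h2 ?_
    simpa [Finset.prod_pow] using h3)
  obtain ⟨C, hC0, hC1, hC⟩ := exists_lt_card_zero_sum_le_pow (fun i => (a i : ℝ))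
    (by exact_mod_cast ha1)
  refine ⟨C, hC0, hC1, fun n => ?_⟩
  have hcontent : ∀ (w : Fin n → Fin d) N,
      ∏ i, l N i ^ ((∑ p, (Pi.single (w p) (1 : ℤ) : Fin d → ℤ)) i) = ∏ p, l N (w p) := by
    intro w N
    simp only [Finset.sum_apply]
    have : ∀ i, l N i ^ (∑ p, (Pi.single (w p) (1 : ℤ) : Fin d → ℤ) i) =
        ∏ p, l N i ^ ((Pi.single (w p) (1 : ℤ) : Fin d → ℤ) i) := by
      intro i
      induction (Finset.univ : Finset (Fin n)) using Finset.cons_induction with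
      | empty => simp
      | cons p s hp ih => rw [Finset.sum_cons, Finset.prod_cons, zpow_add₀ (h0 N i), ih]
    simp only [this]
    rw [Finset.prod_comm]
    refine Finset.prod_congr rfl fun p _ => ?_
    rw [Finset.prod_eq_single (w p)]
    · simp
    · intro i _ hi
      simp [hi]
    · simp
  have hev : ∀ᶠ N in (F : Filter ℕ), ∀ w : Fin n → Fin d,
      ∏ p, l N (w p) = 1 → (∑ p, (Pi.single (w p) (1 : ℤ) : Fin d → ℤ)) ∈ Λ := by
    rw [Filter.eventually_all]
    intro w
    by_cases hw : (∑ p, (Pi.single (w p) (1 : ℤ) : Fin d → ℤ)) ∈ Λ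
    · exact Filter.Eventually.of_forall fun _ _ => hw
    · have : ∀ᶠ N in (F : Filter ℕ),
          ¬ ∏ i, l N i ^ ((∑ p, (Pi.single (w p) (1 : ℤ) : Fin d → ℤ)) i) = 1 :=
        Ultrafilter.eventually_not.2 hw
      filter_upwards [this] with N hN h1
      exact absurd ((hcontent w N).trans h1) hN
  obtain ⟨N, hN⟩ := hev.exists
  refine ⟨N, le_trans ?_ (hC n)⟩
  rw [Nat.cast_le]
  refine Nat.card_le_card_of_injective
    (Subtype.map id fun w hw => ?_) (Subtype.map_injective _ Function.injective_id)
  have h1 := ha _ (hN w hw)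
  have h2 : ∑ p, a (w p) = 0 := by
    rw [← h1]
    simp only [Finset.sum_apply, Int.cast_sum, Finset.sum_mul]
    rw [Finset.sum_comm]
    refine Finset.sum_congr rfl fun p _ => ?_
    rw [Finset.sum_eq_single (w p)]
    · simp
    · intro i _ hi
      simp [hi]
    · simp
  exact_mod_cast h2

lemma exists_pow_ne_one_of_infinite {k : Type*} [Field k] {s : Set k} (hs : s.Infinite) (N : ℕ) :
    ∃ x ∈ s, ∀ j : ℕ, 0 < j → j ≤ N → x ^ j ≠ 1 := by
  by_contra! h
  refine hs ((Polynomial.finite_setOfPred_isRoot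
    (p := (Polynomial.X ^ N.factorial - 1 : Polynomial k)) ?_).subset ?_)
  · exact Polynomial.X_pow_sub_C_ne_zero N.factorial_pos 1
  · intro x hx
    obtain ⟨j, hj, hjN, hxj⟩ := h x hx
    obtain ⟨c, hc⟩ := Nat.dvd_factorial hj hjN
    simp [hc, pow_mul, hxj]

lemma exists_lt_TS_tpow_le_pow {k G V : Type u} [Field k] [IsAlgClosed k]
    [Group G] [AddCommGroup V] [Module k V] [FiniteDimensional k V]
    (ρ : Representation k G V) (h : ¬ (Set.range fun g : G => LinearMap.det (ρ g)).Finite) :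
    ∃ C : ℝ, 0 ≤ C ∧ C < finrank k V ∧ ∀ n, (TS (tpow (Rep.of ρ) n) : ℝ) ≤ C ^ n := by
  have h1 : ∀ N : ℕ, ∃ g : G, ∀ j : ℕ, 0 < j → j ≤ N → LinearMap.det (ρ g) ^ j ≠ 1 := by
    intro N
    obtain ⟨_, ⟨g, rfl⟩, hg⟩ := exists_pow_ne_one_of_infinite h N
    exact ⟨g, hg⟩
  choose g hg using h1
  have h2 := fun N => exists_basis_upperTriangular (finrank k V) (ρ (g N)) rfl
  choose b hb using h2
  have hdet : ∀ N, ∏ i, (b N).repr (ρ (g N) (b N i)) i = LinearMap.det (ρ (g N)) := by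
    intro N
    rw [← LinearMap.det_toMatrix (b N), Matrix.det_of_isUpperTriangular]
    · simp [LinearMap.toMatrix_apply]
    · intro i j hij
      rw [LinearMap.toMatrix_apply]
      exact hb N _ _ hij
  obtain ⟨C, hC0, hC1, hC⟩ := exists_lt_prod_eq_one_le_pow
    (fun N i => (b N).repr (ρ (g N) (b N i)) i) (by
      intro N i hi
      have h3 : LinearMap.det (ρ (g N)) = 0 := by
        rw [← hdet]
        exact Finset.prod_eq_zero (Finset.mem_univ i) hi
      have h4 : LinearMap.det (ρ (g N)) * LinearMap.det (ρ (g N)⁻¹) = 1 := by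
        rw [← map_mul, ← map_mul, mul_inv_cancel, map_one, map_one]
      simp [h3] at h4)
    (by
      intro N
      rw [hdet]
      exact hg N)
  refine ⟨C, hC0, hC1, fun n => ?_⟩
  obtain ⟨N, hN⟩ := hC n
  exact le_trans (Nat.cast_le.2 (TS_tpow_le_card (Rep.of ρ) (b N) (g N) (hb N) n)) hN

end UpperBound

section DetVec

open Module

open scoped Matrix

variable {R : Type*} [CommRing R] {d : ℕ}

/-- The sign of a permutation, extended by zero to all self-maps of `Fin d`. -/
def mapSign (R : Type*) [CommRing R] {d : ℕ} (h : Fin d → Fin d) : R :=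
  ((1 : Matrix (Fin d) (Fin d) R).submatrix h id).det

lemma mapSign_id : mapSign R (id : Fin d → Fin d) = 1 := by
  simp [mapSign]

lemma injective_of_mapSign_ne_zero {h : Fin d → Fin d} (hh : mapSign R h ≠ 0) :
    Function.Injective h := by
  intro i j hij
  by_contra hne
  exact hh (Matrix.det_zero_of_row_eq hne (by
    ext j'
    exact congrArg (fun x => (1 : Matrix (Fin d) (Fin d) R) x j') hij))

lemma map_mapSign {R' : Type*} [CommRing R'] (f : R →+* R') (h : Fin d → Fin d) :
    f (mapSign R h) = mapSign R' h := by
  rw [mapSign, RingHom.map_det, mapSign]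
  congr 1
  ext i j
  simp [Matrix.one_apply, apply_ite f]

lemma sum_prod_mul_mapSign (A : Matrix (Fin d) (Fin d) R) (w : Fin d → Fin d) :
    ∑ h : Fin d → Fin d, (∏ i, A (w i) (h i)) * mapSign R h = A.det * mapSign R w := by
  have h1 : A.det * mapSign R w = (A.submatrix w id).det := by
    rw [mul_comm, mapSign, ← Matrix.det_mul]
    congr 1
    ext i j
    simp [Matrix.mul_apply, Matrix.one_apply]
  have h2 : A.submatrix w id =
      fun i => ∑ j, A (w i) j • (1 : Matrix (Fin d) (Fin d) R) j := by
    ext i j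
    simp [Finset.sum_apply, Matrix.one_apply]
  rw [h1, h2]
  have h3 := (Matrix.detRowAlternating (n := Fin d) (R := R)).toMultilinearMap.map_sum
    (fun i j => A (w i) j • (1 : Matrix (Fin d) (Fin d) R) j)
  refine Eq.trans ?_ h3.symm
  refine Finset.sum_congr rfl fun h _ => ?_
  exact ((Matrix.detRowAlternating (n := Fin d) (R := R)).toMultilinearMap.map_smul_univ
    (fun i => A (w i) (h i)) (fun i => (1 : Matrix (Fin d) (Fin d) R) (h i))).symm

variable {P Q : Type} [Fintype Q]

/-- The coordinates, indexed by words `w : P → Fin d`, of the product of determinants attached to a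
partition `σ` of the set of positions `P` into columns of height `d`. -/
def detVec (R : Type*) [CommRing R] {d : ℕ} {P Q : Type} [Fintype Q] (σ : P ≃ Q × Fin d)
    (w : P → Fin d) : R :=
  ∏ q, mapSign R fun i => w (σ.symm (q, i))

lemma map_detVec {R' : Type*} [CommRing R'] (f : R →+* R') (σ : P ≃ Q × Fin d) (w : P → Fin d) :
    f (detVec R σ w) = detVec R' σ w := by
  simp [detVec, map_mapSign]

lemma sum_prod_mul_detVec [Fintype P] [DecidableEq P] (A : Matrix (Fin d) (Fin d) R)
    (σ : P ≃ Q × Fin d) (w : P → Fin d) :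
    ∑ w' : P → Fin d, (∏ p, A (w p) (w' p)) * detVec R σ w' =
      A.det ^ Fintype.card Q * detVec R σ w := by
  classical
  have h1 : A.det ^ Fintype.card Q * detVec R σ w =
      ∏ q : Q, ∑ h : Fin d → Fin d, (∏ i, A (w (σ.symm (q, i))) (h i)) * mapSign R h := by
    simp only [sum_prod_mul_mapSign, Finset.prod_mul_distrib, detVec, Finset.prod_const,
      Finset.card_univ]
  rw [h1, Fintype.prod_sum]
  let e : (P → Fin d) ≃ (Q → Fin d → Fin d) :=
    (Equiv.arrowCongr σ (Equiv.refl _)).trans (Equiv.curry _ _ _)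
  refine Fintype.sum_equiv e _ _ fun w' => ?_
  rw [Finset.prod_mul_distrib]
  congr 1
  rw [← Fintype.prod_prod_type' fun q i => A (w (σ.symm (q, i))) (e w' q i)]
  refine Fintype.prod_equiv σ _ _ fun p => ?_
  simp [e]

lemma toLex_le_of_detVec_ne_zero [Fintype P] [LinearOrder P] (σ : P ≃ Q × Fin d)
    (hσ : ∀ q, StrictMono fun i => σ.symm (q, i)) {w : P → Fin d} (hw : detVec R σ w ≠ 0) :
    toLex (fun p => (σ p).2) ≤ toLex w := by
  by_cases hne : w = fun p => (σ p).2
  · rw [hne]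
  obtain ⟨p₀, hp₀⟩ := Function.ne_iff.1 hne
  let T := Finset.univ.filter fun p => w p ≠ (σ p).2
  have hT : T.Nonempty := ⟨p₀, by simpa [T] using hp₀⟩
  have hmin : ∀ p, p < T.min' hT → w p = (σ p).2 := by
    intro p hp
    by_contra h
    exact absurd (T.min'_le p (by simpa [T] using h)) (not_le.2 hp)
  have hmem : w (T.min' hT) ≠ (σ (T.min' hT)).2 := by
    have := T.min'_mem hT
    simpa [T] using this
  refine le_of_lt ⟨T.min' hT, fun p hp => (hmin p hp).symm, ?_⟩
  generalize T.min' hT = p at hmin hmem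
  obtain ⟨⟨q, i⟩, rfl⟩ := σ.symm.surjective p
  have hinj : Function.Injective fun i => w (σ.symm (q, i)) := by
    apply injective_of_mapSign_ne_zero (R := R)
    intro h0
    exact hw (Finset.prod_eq_zero (Finset.mem_univ q) h0)
  simp only [Equiv.apply_symm_apply] at hmem hmin ⊢
  by_contra hlt
  have hlt' : w (σ.symm (q, i)) < i := by
    refine lt_of_le_of_ne (not_lt.1 fun h => hlt ?_) hmem
    simpa using h
  have h2 := hmin _ (hσ q hlt')
  simp only [Equiv.apply_symm_apply] at h2
  exact hmem (hinj h2)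

lemma detVec_self (σ : P ≃ Q × Fin d) : detVec R σ (fun p => (σ p).2) = 1 := by
  simp only [detVec, Equiv.apply_symm_apply]
  exact Finset.prod_eq_one fun q _ => mapSign_id

variable {S : Type} [Fintype S] [Fintype P] [LinearOrder P]

lemma eq_zero_of_sum_mul_detVec_eq_zero (σ : S → (P ≃ Q × Fin d))
    (hσ : ∀ s q, StrictMono fun i => (σ s).symm (q, i))
    (hinj : Function.Injective fun s p => (σ s p).2) (y : S → R)
    (hy : ∀ w, ∑ s, y s * detVec R (σ s) w = 0) : y = 0 := by
  classical
  by_contra hne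
  obtain ⟨s₀, hs₀⟩ := Function.ne_iff.1 hne
  obtain ⟨s, hs, hmin⟩ := Finset.exists_min_image (Finset.univ.filter fun s => y s ≠ 0)
    (fun s => toLex fun p => (σ s p).2) ⟨s₀, by simpa using hs₀⟩
  have h1 := hy fun p => (σ s p).2
  rw [Finset.sum_eq_single s, detVec_self, mul_one] at h1
  · exact (Finset.mem_filter.1 hs).2 h1
  · intro t _ hts
    by_contra h0
    have hyt : y t ≠ 0 := left_ne_zero_of_mul h0
    have h2 := toLex_le_of_detVec_ne_zero (σ t) (hσ t) (right_ne_zero_of_mul h0)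
    have h3 := hmin t (by simpa using hyt)
    exact hts (hinj (toLex.injective (le_antisymm h2 h3)))
  · simp

lemma det_gram_detVec_ne_zero [DecidableEq S] (k : Type*) [Field k] [CharZero k]
    (σ : S → (P ≃ Q × Fin d))
    (hσ : ∀ s q, StrictMono fun i => (σ s).symm (q, i))
    (hinj : Function.Injective fun s p => (σ s p).2) :
    (Matrix.of fun s t => detVec k (σ s) ⬝ᵥ detVec k (σ t)).det ≠ 0 := by
  let X : Matrix S (P → Fin d) ℤ := Matrix.of fun s => detVec ℤ (σ s)
  have h1 : (Matrix.of fun s t => detVec k (σ s) ⬝ᵥ detVec k (σ t)) =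
      (Int.castRingHom k).mapMatrix (X * Xᵀ) := by
    ext s t
    simp only [Matrix.of_apply, RingHom.mapMatrix_apply, Matrix.map_apply, Matrix.mul_apply,
      Matrix.transpose_apply, map_sum, map_mul, X, map_detVec]
    rfl
  rw [h1, ← RingHom.map_det, eq_intCast, Int.cast_ne_zero]
  intro h0
  obtain ⟨y, hy, hXy⟩ := Matrix.exists_vecMul_eq_zero_iff.2 h0
  refine hy (eq_zero_of_sum_mul_detVec_eq_zero σ hσ hinj y fun w => ?_)
  have h2 : y ᵥ* X = 0 := by
    rw [← dotProduct_self_eq_zero]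
    have h3 : (y ᵥ* X) ⬝ᵥ (y ᵥ* X) = (y ᵥ* (X * Xᵀ)) ⬝ᵥ y := by
      rw [← Matrix.vecMul_vecMul, Matrix.vecMul_transpose, dotProduct_comm,
        ← Matrix.dotProduct_mulVec, dotProduct_comm]
    rw [h3, hXy, zero_dotProduct]
  exact congrFun h2 w

lemma card_le_TS_tpow {k G : Type u} [Field k] [CharZero k] [Monoid G] (V : Rep k G)
    (b : Basis (Fin d) k V) (hdet : ∀ g, LinearMap.det (V.ρ g) ^ Fintype.card Q = 1)
    (σ : S → (P ≃ Q × Fin d)) (hσ : ∀ s q, StrictMono fun i => (σ s).symm (q, i))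
    (hinj : Function.Injective fun s p => (σ s p).2) :
    Fintype.card S ≤ TS (tpow V (Fintype.card P)) := by
  classical
  have : FiniteDimensional k V := b.finiteDimensional_of_finite
  let e : Fin (Fintype.card P) ≃o P := Fintype.orderIsoFinOfCardEq P rfl
  let τ : S → (Fin (Fintype.card P) ≃ Q × Fin d) := fun s => e.toEquiv.trans (σ s)
  have hτ : ∀ s q, StrictMono fun i => (τ s).symm (q, i) := fun s q =>
    e.symm.strictMono.comp (hσ s q)
  have hτinj : Function.Injective fun s p => (τ s p).2 := by
    intro s t hst
    apply hinj
    ext p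
    have := congrFun hst (e.symm p)
    simpa [τ] using congrArg Fin.val this
  have hA : ∀ g w w', LinearMap.toMatrix (tpowBasis b (Fintype.card P))
      (tpowBasis b (Fintype.card P)) ((tpow V (Fintype.card P)).ρ g) w w' =
      ∏ p, LinearMap.toMatrix b b (V.ρ g) (w p) (w' p) := by
    intro g w w'
    simp only [LinearMap.toMatrix_apply]
    exact tpowBasis_repr b g _ w w'
  refine le_TS_of_mem (card_mem_of_isUnit_det (tpowBasis b (Fintype.card P))
    (fun s => detVec k (τ s)) (fun s => detVec k (τ s)) ?_ ?_
    (isUnit_iff_ne_zero.2 (det_gram_detVec_ne_zero k τ hτ hτinj)))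
  · intro g s
    ext w
    simp only [Matrix.mulVec, dotProduct, hA]
    rw [sum_prod_mul_detVec, LinearMap.det_toMatrix, hdet, one_mul]
  · intro g s
    ext w
    simp only [Matrix.vecMul, dotProduct, hA]
    have := sum_prod_mul_detVec (LinearMap.toMatrix b b (V.ρ g))ᵀ (τ s) w
    rw [Matrix.det_transpose, LinearMap.det_toMatrix, hdet, one_mul] at this
    rw [← this]
    exact Finset.sum_congr rfl fun w' _ => mul_comm _ _

end DetVec

section Fillings

open Module

lemma exists_card_le_card_fiber (d ℓ : ℕ) :
    ∃ c : Fin d → ℕ, d ^ ℓ ≤ Fintype.card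
      {w : Fin ℓ → Fin d // ∀ i, Fintype.card {l // w l = i} = c i} * (ℓ + 1) ^ d := by
  classical
  let content : (Fin ℓ → Fin d) → (Fin d → Fin (ℓ + 1)) := fun w i =>
    ⟨Fintype.card {l // w l = i}, Nat.lt_succ_of_le
      ((Fintype.card_subtype_le _).trans_eq (Fintype.card_fin ℓ))⟩
  by_contra! h
  have h1 : ∀ c ∈ (Finset.univ : Finset (Fin d → Fin (ℓ + 1))),
      (Finset.univ.filter fun w => content w = c).card * (ℓ + 1) ^ d < d ^ ℓ := by
    intro c _
    refine lt_of_eq_of_lt ?_ (h fun i => c i)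
    rw [Fintype.card_subtype]
    congr 2
    ext w
    simp [content, funext_iff, Fin.ext_iff]
  have h2 := Finset.card_eq_sum_card_fiberwise (f := content) (s := Finset.univ)
    (t := Finset.univ) (fun _ _ => Finset.mem_coe.2 (Finset.mem_univ _))
  have h3 := Finset.sum_lt_sum_of_nonempty Finset.univ_nonempty h1
  rw [← Finset.sum_mul, ← h2] at h3
  simp only [Finset.card_univ, Fintype.card_pi, Fintype.card_fin, Finset.prod_const,
    Finset.sum_const, smul_eq_mul] at h3
  rw [mul_comm] at h3
  exact lt_irrefl _ h3

/-- An enumeration of the positions in a word in which every letter occurs `ℓ` times. -/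
lemma exists_equiv_of_card_fiber {Λ : Type} [Fintype Λ] {d ℓ : ℕ} (β : Λ → Fin d)
    (hβ : ∀ i, Fintype.card {x // β x = i} = ℓ) :
    ∃ e : Λ ≃ Fin d × Fin ℓ, ∀ x, (e x).1 = β x := by
  refine ⟨(Equiv.sigmaFiberEquiv β).symm.trans ((Equiv.sigmaCongrRight fun i =>
    Fintype.equivFinOfCardEq (hβ i)).trans (Equiv.sigmaEquivProd _ _)), fun x => rfl⟩

lemma exists_balanced (d ℓ : ℕ) [NeZero d] :
    ∃ (I : Type) (_ : Fintype I) (π : I → (Fin d × Fin ℓ ≃ Fin d × Fin ℓ)),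
      Function.Injective (fun s x => (π s x).1) ∧
      (d ^ ℓ) ^ d ≤ Fintype.card I * ((ℓ + 1) ^ d) ^ d := by
  classical
  obtain ⟨c, hc⟩ := exists_card_le_card_fiber d ℓ
  let W := {w : Fin ℓ → Fin d // ∀ i, Fintype.card {l // w l = i} = c i}
  let β : (Fin d → W) → Fin d × Fin ℓ → Fin d := fun s x => (s x.1).1 x.2 + x.1
  have hβ : ∀ s i, Fintype.card {x // β s x = i} = ∑ j, c (i - j) := by
    intro s i
    rw [Finset.sum_congr rfl fun j _ => ((s j).2 (i - j)).symm, ← Fintype.card_sigma]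
    refine Fintype.card_congr
      { toFun := fun x => ⟨x.1.1, x.1.2, eq_sub_of_add_eq x.2⟩
        invFun := fun y => ⟨(y.1, y.2.1), add_eq_of_eq_sub y.2.2⟩
        left_inv := fun x => rfl
        right_inv := fun y => rfl }
  have hsum : ∀ s : Fin d → W, ∑ i, c i = ℓ := by
    intro s
    rw [Finset.sum_congr rfl fun i _ => ((s 0).2 i).symm, ← Fintype.card_sigma,
      Fintype.card_congr (Equiv.sigmaFiberEquiv _), Fintype.card_fin]
  have hβ' : ∀ s i, Fintype.card {x // β s x = i} = ℓ := by
    intro s i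
    rw [hβ, ← hsum s]
    exact (Equiv.subLeft i).sum_comp c
  choose π hπ using fun s => exists_equiv_of_card_fiber (β s) (hβ' s)
  refine ⟨Fin d → W, inferInstance, π, ?_, ?_⟩
  · intro s t hst
    ext j l
    have h := congrFun hst (j, l)
    simp only [hπ] at h
    exact congrArg Fin.val (add_right_cancel h)
  · rw [Fintype.card_fun, Fintype.card_fin, ← mul_pow]
    exact Nat.pow_le_pow_left hc d

section Staggered

variable {Λ I : Type} {d ℓ : ℕ} (π : I → (Λ ≃ Fin d × Fin ℓ)) (s₀ : I) (C : ℕ)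

/-- The enumeration used at time `t` in a staggered filling: it is prescribed by `f` at the times
`d ≤ t < C` and equal to the default one otherwise. -/
def stage (f : Fin (C - d) → I) (t : ℕ) : I :=
  if h : d ≤ t ∧ t < C then f ⟨t - d, by omega⟩ else s₀

/-- The positions of a staggered filling. A letter `i` is used at the times `i ≤ t < i + C`. -/
abbrev Staggered : Type :=
  {p : ℕ ×ₗ Λ // ((π s₀ (ofLex p).2).1 : ℕ) ≤ (ofLex p).1 ∧
    (ofLex p).1 < ((π s₀ (ofLex p).2).1 : ℕ) + C}

variable {π s₀ C}

lemma stage_mem_iff (f : Fin (C - d) → I) (t : ℕ) (x : Λ) :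
    (((π (stage s₀ C f t) x).1 : ℕ) ≤ t ∧ t < ((π (stage s₀ C f t) x).1 : ℕ) + C) ↔
      (((π s₀ x).1 : ℕ) ≤ t ∧ t < ((π s₀ x).1 : ℕ) + C) := by
  unfold stage
  split_ifs with h
  · have h1 := (π s₀ x).1.2
    have h2 := (π (f ⟨t - d, by omega⟩) x).1.2
    constructor <;> intro _ <;> constructor <;> omega
  · rfl

variable (π s₀ C)

/-- The partition of the positions of a staggered filling into columns of height `d`; the letter `i`
of the column `(c, r)` sits at the `r`-th occurrence of the letter `i` at time `c + i`. -/
def columns (f : Fin (C - d) → I) : Staggered π s₀ C ≃ (Fin C × Fin ℓ) × Fin d where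
  toFun p :=
    let y := π (stage s₀ C f (ofLex p.1).1) (ofLex p.1).2
    ((⟨(ofLex p.1).1 - y.1, by
      have : (y.1 : ℕ) ≤ (ofLex p.1).1 ∧ (ofLex p.1).1 < (y.1 : ℕ) + C :=
        (stage_mem_iff f _ _).2 p.2
      omega⟩, y.2), y.1)
  invFun z := ⟨toLex (z.1.1 + z.2, (π (stage s₀ C f (z.1.1 + z.2))).symm (z.2, z.1.2)), by
    refine (stage_mem_iff f _ _).1 ?_
    have := z.1.1.2
    simp only [ofLex_toLex, Equiv.apply_symm_apply]
    omega⟩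
  left_inv p := by
    have h := ((stage_mem_iff f _ _).2 p.2).1
    apply Subtype.ext
    apply ofLex.injective
    simp only [ofLex_toLex, Nat.sub_add_cancel h, Prod.mk.eta, Equiv.symm_apply_apply]
  right_inv z := by
    simp only [ofLex_toLex, Equiv.apply_symm_apply, Nat.add_sub_cancel]

lemma columns_symm_strictMono [LinearOrder Λ] (f : Fin (C - d) → I) (q : Fin C × Fin ℓ) :
    StrictMono fun i => (columns π s₀ C f).symm (q, i) := by
  intro i j hij
  refine Subtype.mk_lt_mk.2 (Prod.Lex.toLex_lt_toLex.2 (Or.inl ?_))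
  simpa using hij

lemma columns_injective (hπ : Function.Injective fun s x => (π s x).1) :
    Function.Injective fun f p => (columns π s₀ C f p).2 := by
  intro f g hfg
  ext n
  apply hπ
  ext x
  have hn := n.2
  have hstage : ∀ f : Fin (C - d) → I, stage s₀ C f (n + d) = f n := by
    intro f
    rw [stage, dif_pos (by omega)]
    congr
    simp
  have hx := (π s₀ x).1.2
  have h := congrFun hfg ⟨toLex (n + d, x), by simp only [ofLex_toLex]; omega⟩
  simp only [columns, Equiv.coe_fn_mk, ofLex_toLex, hstage] at h
  exact congrArg Fin.val h

end Staggered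

lemma pow_le_TS_tpow {k G : Type u} [Field k] [CharZero k] [Monoid G] (V : Rep k G) {d ℓ : ℕ}
    (b : Basis (Fin d) k V) {I : Type} [Fintype I] (π : I → (Fin d × Fin ℓ ≃ Fin d × Fin ℓ))
    (hπ : Function.Injective fun s x => (π s x).1) (s₀ : I) (C : ℕ)
    (hdet : ∀ g, LinearMap.det (V.ρ g) ^ C = 1) :
    Fintype.card I ^ (C - d) ≤ TS (tpow V (C * ℓ * d)) := by
  classical
  let π' : I → (Fin d ×ₗ Fin ℓ ≃ Fin d × Fin ℓ) := fun s => ofLex.trans (π s)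
  have hπ' : Function.Injective fun s x => (π' s x).1 := fun s t hst =>
    hπ (funext fun x => congrFun hst (toLex x))
  let : Fintype (Staggered π' s₀ C) := Fintype.ofEquiv _ (columns π' s₀ C fun _ => s₀).symm
  have hcard : Fintype.card (Staggered π' s₀ C) = C * ℓ * d := by
    rw [Fintype.card_congr (columns π' s₀ C fun _ => s₀)]
    simp
  have h := card_le_TS_tpow V b (Q := Fin C × Fin ℓ) (by simp [pow_mul, hdet])
    (columns π' s₀ C) (columns_symm_strictMono π' s₀ C) (columns_injective π' s₀ C hπ')
  simpa [hcard] using h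

end Fillings

section Growth

open Module Filter Topology

lemma exists_pow_lt_of_lt {c : ℝ} {d : ℕ} (hc : 0 < c) (hcd : c < d) :
    ∃ ℓ : ℕ, 0 < ℓ ∧ ∀ M : ℕ, (d ^ ℓ) ^ d ≤ M * ((ℓ + 1) ^ d) ^ d → (c ^ ℓ) ^ d < M := by
  have hd : (0 : ℝ) < d := hc.trans hcd
  have hd0 : d ≠ 0 := by
    rintro rfl
    simp at hd
  have h1 : |c / d| < 1 := by
    rw [abs_of_pos (by positivity), div_lt_one hd]
    exact hcd
  have h2 := (tendsto_add_atTop_iff_nat 1).2 (tendsto_pow_const_mul_const_pow_of_abs_lt_one d h1)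
  have hr : 0 < c / d := by positivity
  obtain ⟨ℓ, hℓ, hpos⟩ := ((h2.eventually_lt_const hr).and (eventually_gt_atTop 0)).exists
  refine ⟨ℓ, hpos, fun M hM => ?_⟩
  have h3 : ((ℓ : ℝ) + 1) ^ d * c ^ ℓ < d ^ ℓ := by
    push_cast at hℓ
    rw [pow_succ, ← mul_assoc] at hℓ
    have := lt_of_mul_lt_mul_right (hℓ.trans_eq (one_mul _).symm) hr.le
    rwa [div_pow, mul_div_assoc', div_lt_one (by positivity)] at this
  have h4 : (((ℓ : ℝ) + 1) ^ d * c ^ ℓ) ^ d < (d ^ ℓ : ℝ) ^ d :=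
    pow_lt_pow_left₀ h3 (by positivity) hd0
  have h5 : ((d : ℝ) ^ ℓ) ^ d ≤ M * (((ℓ : ℝ) + 1) ^ d) ^ d := by exact_mod_cast hM
  rw [mul_pow, mul_comm] at h4
  exact lt_of_mul_lt_mul_right (h4.trans_le h5) (by positivity)

lemma eventually_pow_le_pow_sub {a M : ℝ} (ha : 0 < a) (h : a < M) (d : ℕ) :
    ∀ᶠ n : ℕ in atTop, a ^ n ≤ M ^ (n - d) := by
  have hM : 0 < M := ha.trans h
  have h1 : 1 < M / a := (one_lt_div ha).2 h
  filter_upwards [(tendsto_pow_atTop_atTop_of_one_lt h1).eventually_ge_atTop (M ^ d),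
    eventually_ge_atTop d] with n hn hdn
  rw [div_pow, le_div_iff₀ (by positivity)] at hn
  refine le_of_mul_le_mul_left ?_ (pow_pos hM d)
  rwa [← pow_add, Nat.add_sub_cancel' hdn]

lemma exists_det_pow_eq_one {k G V : Type*} [Field k] [Group G] [AddCommGroup V] [Module k V]
    (ρ : Representation k G V) (h : (Set.range fun g : G => LinearMap.det (ρ g)).Finite) :
    ∃ m : ℕ, 0 < m ∧ ∀ g, LinearMap.det (ρ g) ^ m = 1 := by
  let φ : G →* kˣ := ((LinearMap.det : (V →ₗ[k] V) →* k).comp ρ).toHomUnits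
  have hφ : ∀ g, ((φ g : kˣ) : k) = LinearMap.det (ρ g) := fun g => rfl
  have hfin : Finite φ.range := by
    refine Set.Finite.to_subtype (Set.Finite.of_finite_image (f := Units.val) (h.subset ?_)
      Units.val_injective.injOn)
    rintro _ ⟨_, ⟨g, rfl⟩, rfl⟩
    exact ⟨g, rfl⟩
  refine ⟨Nat.card φ.range, Nat.card_pos, fun g => ?_⟩
  have h1 : (⟨φ g, g, rfl⟩ : φ.range) ^ Nat.card φ.range = 1 := pow_card_eq_one'
  have h2 := congrArg (fun x : φ.range => ((x : kˣ) : k)) h1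
  simpa [hφ] using h2

variable {k G : Type u} [Field k]

lemma TS_tpow_rpow_inv_le [Monoid G] (V : Rep k G) {C : ℝ} (hC : 0 ≤ C) {n : ℕ} (hn : n ≠ 0)
    (h : (TS (tpow V n) : ℝ) ≤ C ^ n) : (TS (tpow V n) : ℝ) ^ ((n : ℝ)⁻¹) ≤ C :=
  (Real.rpow_le_rpow (Nat.cast_nonneg _) h (by positivity)).trans_eq
    (Real.pow_rpow_inv_natCast hC hn)

lemma dG_le_of_forall_le_pow [Monoid G] (V : Rep k G) {C : ℝ} (hC : 0 ≤ C)
    (h : ∀ n, (TS (tpow V n) : ℝ) ≤ C ^ n) : dG V ≤ C := by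
  refine limsup_le_of_le ?_ ?_
  · exact isCoboundedUnder_le_of_le atTop (x := 0) fun n => by positivity
  · filter_upwards [eventually_ne_atTop 0] with n hn
    exact TS_tpow_rpow_inv_le V hC hn (h n)

lemma dG_le_finrank [Monoid G] (V : Rep k G) [FiniteDimensional k V] : dG V ≤ finrank k V :=
  dG_le_of_forall_le_pow V (Nat.cast_nonneg _) fun n => by exact_mod_cast TS_tpow_le_pow V n

lemma le_dG_of_frequently [Monoid G] (V : Rep k G) [FiniteDimensional k V] {c : ℝ} (hc : 0 ≤ c)
    (h : ∃ᶠ n in atTop, c ^ n ≤ (TS (tpow V n) : ℝ)) : c ≤ dG V := by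
  refine le_limsup_of_frequently_le ?_ ?_
  · refine (h.and_eventually (eventually_ne_atTop 0)).mono fun n hn => ?_
    rw [← Real.pow_rpow_inv_natCast hc hn.2]
    exact Real.rpow_le_rpow (by positivity) hn.1 (by positivity)
  · refine isBoundedUnder_of_eventually_le (a := (finrank k V : ℝ)) ?_
    filter_upwards [eventually_ne_atTop 0] with n hn
    exact TS_tpow_rpow_inv_le V (Nat.cast_nonneg _) hn (by exact_mod_cast TS_tpow_le_pow V n)

lemma frequently_pow_le_TS_tpow [CharZero k] [Monoid G] (V : Rep k G) [FiniteDimensional k V]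
    {m : ℕ} (hm : 0 < m) (hdet : ∀ g, LinearMap.det (V.ρ g) ^ m = 1) {c : ℝ} (hc : 0 < c)
    (hcd : c < finrank k V) : ∃ᶠ n in atTop, c ^ n ≤ (TS (tpow V n) : ℝ) := by
  have hd : 0 < finrank k V := by exact_mod_cast hc.trans hcd
  have : NeZero (finrank k V) := ⟨hd.ne'⟩
  obtain ⟨ℓ, hℓ, hM⟩ := exists_pow_lt_of_lt hc hcd
  obtain ⟨I, _, π, hπ, hI⟩ := exists_balanced (finrank k V) ℓ
  have hcI := hM _ hI
  have hpos : 0 < Fintype.card I := by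
    have : (0 : ℝ) < Fintype.card I := lt_trans (by positivity) hcI
    exact_mod_cast this
  obtain ⟨s₀⟩ := Fintype.card_pos_iff.1 hpos
  rw [frequently_atTop]
  intro N
  obtain ⟨a, ha, hNa⟩ := (((tendsto_id.const_mul_atTop' hm).eventually
    (eventually_pow_le_pow_sub (by positivity) hcI (finrank k V))).and
      (eventually_ge_atTop N)).exists
  refine ⟨m * a * ℓ * finrank k V, ?_, ?_⟩
  · calc N ≤ a := hNa
      _ ≤ a * (m * ℓ * finrank k V) := Nat.le_mul_of_pos_right _ (by positivity)
      _ = m * a * ℓ * finrank k V := by ring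
  · have h1 := pow_le_TS_tpow V (finBasis k V) π hπ s₀ (m * a)
      fun g => by rw [pow_mul, hdet, one_pow]
    calc c ^ (m * a * ℓ * finrank k V) = ((c ^ ℓ) ^ finrank k V) ^ (m * a) := by ring
      _ ≤ (Fintype.card I : ℝ) ^ (m * a - finrank k V) := ha
      _ ≤ _ := by exact_mod_cast h1

end Growth

/-- **Theorem (characteristic zero case).** For a finite-dimensional representation
`ρ : G → GL(V)` of a group `G` over an algebraically closed field `k` of characteristic `0`,
`d(G, V) = dim V` if and only if the determinant takes finitely many values on `ρ(G)`. -/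
theorem dG_eq_dim_iff_det_finite_charZero {k G V : Type u} [Field k] [IsAlgClosed k]
    [CharZero k] [Group G] [AddCommGroup V] [Module k V] [FiniteDimensional k V]
    (ρ : Representation k G V) :
    dG (Rep.of ρ) = (Module.finrank k V : ℝ) ↔
      (Set.range fun g : G => LinearMap.det (ρ g)).Finite := by
  constructor
  · intro h
    by_contra hinf
    obtain ⟨C, hC, hlt, hle⟩ := exists_lt_TS_tpow_le_pow ρ hinf
    exact absurd (dG_le_of_forall_le_pow (Rep.of ρ) hC hle) (by rw [h]; exact not_le.2 hlt)
  · intro h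
    obtain ⟨m, hm, hdet⟩ := exists_det_pow_eq_one ρ h
    have : FiniteDimensional k (Rep.of ρ) := ‹FiniteDimensional k V›
    refine le_antisymm (dG_le_finrank (Rep.of ρ)) (le_of_forall_lt fun c hc => ?_)
    obtain ⟨c', hcc', hc'⟩ := exists_between hc
    rcases le_or_gt c' 0 with h0 | h0
    · exact hcc'.trans_le (h0.trans (le_dG_of_frequently _ le_rfl
        ((Filter.eventually_ne_atTop 0).mono fun n hn => by simp [hn]).frequently))
    · exact hcc'.trans_le (le_dG_of_frequently _ h0.le
        (frequently_pow_le_TS_tpow (Rep.of ρ) hm hdet h0 hc'))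
end
end

section
/- Let K be an algebraically closed field of positive characteristic p, let G be a group, and let ρ: G → GL(V) be a finite-dimensional representation of G over K. Then d(G, V) = dim V if and only if the determinant map takes only finitely many distinct values on ρ(G) and the only unipotent element of the Zariski closure of ρ(G) in GL(V) is the identity. -/
open CategoryTheory MonoidalCategory Limits

noncomputable section

universe u

/-- The representation on `k^m` induced by a group homomorphism to `GL_m(k)`. -/
def matRep {k G : Type u} [Field k] [Monoid G] {m : ℕ}
    (ρ : G →* Matrix.GeneralLinearGroup (Fin m) k) : Representation k G (Fin m → k) :=
  (Matrix.toLinAlgEquiv'.toRingEquiv.toRingHom.toMonoidHom).comp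
    ((Units.coeHom (Matrix (Fin m) (Fin m) k)).comp ρ)

/-- A subset of `GL_m(k)` is Zariski closed if it is the intersection of `GL_m(k)` with the
zero locus of a set of polynomials in the matrix entries. -/
def IsZariskiClosedGL {k : Type u} [Field k] {m : ℕ}
    (Z : Set (Matrix.GeneralLinearGroup (Fin m) k)) : Prop :=
  ∃ S : Set (MvPolynomial (Fin m × Fin m) k),
    Z = {g : Matrix.GeneralLinearGroup (Fin m) k | ∀ f ∈ S,
      MvPolynomial.eval (fun q : Fin m × Fin m => (g.val : Matrix (Fin m) (Fin m) k) q.1 q.2) f = 0}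

/-- The Zariski closure of a subset of `GL_m(k)`: the smallest Zariski-closed subset
containing it. -/
def zariskiClosure {k : Type u} [Field k] {m : ℕ}
    (X : Set (Matrix.GeneralLinearGroup (Fin m) k)) :
    Set (Matrix.GeneralLinearGroup (Fin m) k) :=
  ⋂₀ {Z | IsZariskiClosedGL Z ∧ X ⊆ Z}

/-- An element of `GL_m(k)` is unipotent if `(g - 1) ^ m = 0`. -/
def IsUnipotentGL {k : Type u} [Field k] {m : ℕ} (g : Matrix.GeneralLinearGroup (Fin m) k) :
    Prop :=
  ((g.val : Matrix (Fin m) (Fin m) k) - 1) ^ m = 0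

theorem IsIntegral.finite_setOf_ringHom_apply {R A k : Type*} [CommRing R] [CommRing A] [Field k]
    [Algebra R A] {a : A} (ha : IsIntegral R a) (φ : R →+* k) :
    {z : k | ∃ ψ : A →+* k, ψ.comp (algebraMap R A) = φ ∧ ψ a = z}.Finite := by
  obtain ⟨P, hP, hPa⟩ := ha
  refine (Polynomial.finite_setOfPred_isRoot (hP.map φ).ne_zero).subset ?_
  rintro z ⟨ψ, rfl, rfl⟩
  have := congrArg ψ hPa
  rw [map_zero, Polynomial.hom_eval₂] at this
  simpa [Polynomial.IsRoot, Polynomial.eval_map] using this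

/-- If a point of an affine variety is alone in its fibre for a morphism to affine space, then on
some neighbourhood of it all fibres are finite. -/
theorem exists_eval_ne_zero_finite_fibers {k σ τ : Type*} [Field k] [IsAlgClosed k] [Finite σ]
    (I : Ideal (MvPolynomial σ k)) (c : τ → MvPolynomial σ k) (x₀ : σ → k)
    (hx₀ : x₀ ∈ MvPolynomial.zeroLocus k I)
    (h : ∀ y ∈ MvPolynomial.zeroLocus k I,
      (∀ i, MvPolynomial.eval y (c i) = MvPolynomial.eval x₀ (c i)) → y = x₀) :
    ∃ f : MvPolynomial σ k, MvPolynomial.eval x₀ f ≠ 0 ∧ ∀ x : σ → k,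
      {y ∈ MvPolynomial.zeroLocus k I | MvPolynomial.eval y f ≠ 0 ∧
        ∀ i, MvPolynomial.eval y (c i) = MvPolynomial.eval x (c i)}.Finite := by
  classical
  let A := MvPolynomial σ k ⧸ I
  let R := MvPolynomial τ k
  let q : MvPolynomial σ k →+* A := Ideal.Quotient.mk I
  let alg : Algebra R A := (q.comp (MvPolynomial.aeval c).toRingHom).toAlgebra
  have halg : algebraMap R A = q.comp (MvPolynomial.aeval c).toRingHom := rfl
  have : IsScalarTower k R A := IsScalarTower.of_algebraMap_eq fun x => by
    simp only [halg, RingHom.comp_apply]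
    change _ = q (MvPolynomial.aeval c (algebraMap k R x))
    rw [AlgHom.commutes]
    rfl
  have : Algebra.FiniteType R A := Algebra.FiniteType.of_restrictScalars_finiteType k R A
  let p₀ : PrimeSpectrum A := ⟨(MvPolynomial.vanishingIdeal k {x₀}).map q, by
    apply Ideal.map_isPrime_of_surjective Ideal.Quotient.mk_surjective
    rw [Ideal.mk_ker]
    intro f hf
    simpa using hx₀ f hf⟩
  have hcomap : p₀.asIdeal.comap q = MvPolynomial.vanishingIdeal k {x₀} := by
    refine (Ideal.comap_map_of_surjective q Ideal.Quotient.mk_surjective _).trans ?_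
    rw [sup_eq_left]
    intro f hf
    have : f ∈ I := Ideal.Quotient.eq_zero_iff_mem.1 hf
    simpa using hx₀ f this
  have hmem : ∀ f, q f ∈ p₀.asIdeal ↔ MvPolynomial.eval x₀ f = 0 := fun f => by
    rw [← Ideal.mem_comap, hcomap]; simp
  have hfib : ∀ P : PrimeSpectrum A, P.comap (algebraMap R A) = p₀.comap (algebraMap R A) →
      P = p₀ := by
    intro P hP
    have h1 : ∀ i, c i - MvPolynomial.C (MvPolynomial.eval x₀ (c i)) ∈ P.asIdeal.comap q := by
      intro i
      have : (MvPolynomial.X i - MvPolynomial.C (MvPolynomial.eval x₀ (c i)) : R) ∈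
          (P.comap (algebraMap R A)).asIdeal := by
        rw [hP]
        change q (MvPolynomial.aeval c _) ∈ p₀.asIdeal
        rw [hmem]
        simp
      have h2 : q (MvPolynomial.aeval c
        (MvPolynomial.X i - MvPolynomial.C (MvPolynomial.eval x₀ (c i)) : R)) ∈ P.asIdeal := this
      simpa using h2
    have h2 : I ≤ P.asIdeal.comap q := fun f hf => by
      have : q f = 0 := Ideal.Quotient.eq_zero_iff_mem.2 hf
      simp [this]
    have h3 : MvPolynomial.zeroLocus k (P.asIdeal.comap q) ⊆ {x₀} := by
      intro y hy
      refine h y (MvPolynomial.zeroLocus_anti_mono h2 hy) fun i => ?_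
      have := hy _ (h1 i)
      simpa [MvPolynomial.coe_aeval_eq_eval, sub_eq_zero] using this
    have h4 : P.asIdeal.comap q = MvPolynomial.vanishingIdeal k {x₀} := by
      rw [← MvPolynomial.IsPrime.vanishingIdeal_zeroLocus (K := k) (P.asIdeal.comap q)]
      rcases Set.subset_singleton_iff_eq.1 h3 with h5 | h5
      · exfalso
        have h6 := MvPolynomial.IsPrime.vanishingIdeal_zeroLocus (K := k) (P.asIdeal.comap q)
        rw [h5, MvPolynomial.vanishingIdeal_empty] at h6
        exact (Ideal.IsPrime.comap q (hK := P.2)).ne_top h6.symm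
      · rw [h5]
    ext1
    have h5 := Ideal.map_comap_of_surjective q Ideal.Quotient.mk_surjective
    rw [← h5 P.asIdeal, h4, ← hcomap, h5]
  have := p₀.2
  have hqf : Algebra.QuasiFiniteAt R p₀.asIdeal := by
    apply Algebra.QuasiFiniteAt.of_isOpen_singleton_fiber p₀
    convert isOpen_univ
    ext ⟨P, hP⟩
    simpa using Subtype.ext (hfib P hP)
  obtain ⟨r, hr, hrint, hx⟩ := Algebra.zariskisMainProperty_iff.1
    (Algebra.ZariskisMainProperty.of_finiteType (R := R) p₀.asIdeal)
  obtain ⟨f, rfl⟩ := Ideal.Quotient.mk_surjective r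
  choose e he using hx
  refine ⟨f, fun h0 => hr ((hmem f).2 h0), fun x => ?_⟩
  let φ : R →+* k := (MvPolynomial.eval x).comp (MvPolynomial.aeval c).toRingHom
  let S : σ → Set k := fun i => Set.image2 (fun a b => b / a ^ e (q (MvPolynomial.X i)))
    {z : k | ∃ ψ : A →+* k, ψ.comp (algebraMap R A) = φ ∧ ψ (q f) = z}
    {z : k | ∃ ψ : A →+* k, ψ.comp (algebraMap R A) = φ ∧
      ψ (q f ^ e (q (MvPolynomial.X i)) * q (MvPolynomial.X i)) = z}
  refine (Set.Finite.pi' (t := S) fun i => Set.Finite.image2 _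
    (hrint.finite_setOf_ringHom_apply φ) ((he _).finite_setOf_ringHom_apply φ)).subset ?_
  rintro y ⟨hy, hfy, hcy⟩ i
  let ψ : A →+* k := Ideal.Quotient.lift I (MvPolynomial.eval y) fun a ha => by
    simpa [MvPolynomial.coe_aeval_eq_eval] using hy a ha
  have hψ : ∀ a, ψ (q a) = MvPolynomial.eval y a := fun a => Ideal.Quotient.lift_mk _ _ _
  have hψφ : ψ.comp (algebraMap R A) = φ := by
    rw [halg]
    apply MvPolynomial.ringHom_ext
    · intro a
      simp [φ, hψ]
    · intro i
      simp [φ, hψ, hcy i]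
  refine ⟨_, ⟨ψ, hψφ, rfl⟩, _, ⟨ψ, hψφ, rfl⟩, ?_⟩
  simp only [map_mul, map_pow, hψ, MvPolynomial.eval_X]
  field_simp

theorem exists_normal_finiteIndex_isIrreducible (Γ : Type*) [Group Γ] [TopologicalSpace Γ]
    [TopologicalSpace.NoetherianSpace Γ] [SeparatelyContinuousMul Γ] :
    ∃ N : Subgroup Γ, N.Normal ∧ N.FiniteIndex ∧ IsIrreducible (N : Set Γ) ∧
      IsClosed (N : Set Γ) := by
  have fin : (irreducibleComponents Γ).Finite :=
    TopologicalSpace.NoetherianSpace.finite_irreducibleComponents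
  have homeo : ∀ (e : Γ ≃ₜ Γ) (Z : Set Γ), Z ∈ irreducibleComponents Γ →
      e ⁻¹' Z ∈ irreducibleComponents Γ := fun e Z hZ =>
    preimage_mem_irreducibleComponents hZ e.isOpenEmbedding
      (by rw [e.surjective.range_eq, Set.inter_univ]; exact hZ.1.nonempty)
  have key : ∀ (x : Γ) (Z₁ Z₂ : Set Γ), Z₁ ∈ irreducibleComponents Γ →
      Z₂ ∈ irreducibleComponents Γ → x ∈ Z₁ → x ∈ Z₂ → Z₁ = Z₂ := by
    let Z := irreducibleComponent (1 : Γ)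
    have hZ : Z ∈ irreducibleComponents Γ := irreducibleComponent_mem_irreducibleComponents 1
    obtain ⟨y, hyZ, hy⟩ : ∃ y ∈ Z, ∀ W ∈ irreducibleComponents Γ, y ∈ W → W = Z := by
      by_contra! hc
      have := mem_of_subset_sUnion_irreducibleComponents Z hZ (irreducibleComponents Γ \ {Z})
        fin.sdiff Set.sdiff_subset (fun y hy => by
          obtain ⟨W, hW, hyW, hne⟩ := hc y hy
          exact ⟨W, ⟨hW, hne⟩, hyW⟩)
      exact this.2 rfl
    intro x Z₁ Z₂ h₁ h₂ hx₁ hx₂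
    let e := Homeomorph.mulLeft (x * y⁻¹)
    have h : e ⁻¹' Z₁ = e ⁻¹' Z₂ :=
      (hy _ (homeo e _ h₁) (by simpa [e] using hx₁)).trans
        (hy _ (homeo e _ h₂) (by simpa [e] using hx₂)).symm
    exact e.surjective.preimage_injective h
  let Z := irreducibleComponent (1 : Γ)
  have hZ : Z ∈ irreducibleComponents Γ := irreducibleComponent_mem_irreducibleComponents 1
  have h1 : (1 : Γ) ∈ Z := mem_irreducibleComponent
  have trans : ∀ a ∈ Z, ∀ x, a * x ∈ Z ↔ x ∈ Z := fun a ha x => by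
    have := key 1 _ _ (homeo (Homeomorph.mulLeft a) Z hZ) hZ (by simpa using ha) h1
    exact Set.ext_iff.1 this x
  let N : Subgroup Γ :=
    { carrier := Z
      one_mem' := h1
      mul_mem' := fun {a b} ha hb => (trans a ha b).2 hb
      inv_mem' := fun {a} ha => (trans a ha _).1 (by simpa using h1) }
  refine ⟨N, ⟨fun n hn g => ?_⟩, ?_, isIrreducible_irreducibleComponent,
    isClosed_irreducibleComponent⟩
  · have := key 1 _ _ (homeo ((Homeomorph.mulLeft g).trans (Homeomorph.mulRight g⁻¹)) Z hZ) hZ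
      (by simpa using h1) h1
    exact (Set.ext_iff.1 this n).2 hn
  · have : Finite (irreducibleComponents Γ) := fin
    have : Finite (Γ ⧸ N) := by
      refine Finite.of_injective (β := irreducibleComponents Γ)
        (fun q => ⟨Homeomorph.mulLeft q.out⁻¹ ⁻¹' Z, homeo _ Z hZ⟩) fun a b hab => ?_
      have hab := Set.ext_iff.1 (Subtype.ext_iff.1 hab) b.out
      rw [← a.out_eq, ← b.out_eq]
      refine QuotientGroup.eq.2 (hab.2 ?_)
      simpa using h1
    exact Subgroup.finiteIndex_of_finite_quotient

theorem Subgroup.exists_coe_eq_closure {Γ : Type*} [Group Γ] [TopologicalSpace Γ]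
    [SeparatelyContinuousMul Γ] [ContinuousInv Γ] (K : Subgroup Γ) :
    ∃ H : Subgroup Γ, (H : Set Γ) = _root_.closure (K : Set Γ) := by
  have left : ∀ a ∈ K, ∀ b ∈ _root_.closure (K : Set Γ), a * b ∈ _root_.closure (K : Set Γ) :=
    fun a ha b hb =>
    map_mem_closure (continuous_const_mul a) hb fun x hx => K.mul_mem ha hx
  exact ⟨{
    carrier := _root_.closure (K : Set Γ)
    one_mem' := _root_.subset_closure K.one_mem
    mul_mem' := fun {a b} ha hb => by
      have := map_mem_closure (continuous_mul_const b) ha fun x hx => left x hx b hb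
      rwa [isClosed_closure.closure_eq] at this
    inv_mem' := fun {a} ha => map_mem_closure continuous_inv ha fun x hx => K.inv_mem hx }, rfl⟩

section ZariskiTopology

variable {k : Type u} [Field k] {m : ℕ}

/-- The matrix entries of an element of `GL_m(k)`, as a point of affine space. -/
def entries (g : Matrix.GeneralLinearGroup (Fin m) k) : Fin m × Fin m → k :=
  fun q => (g.val : Matrix (Fin m) (Fin m) k) q.1 q.2

theorem mapMatrix_eval_entries_mvPolynomialX (g : Matrix.GeneralLinearGroup (Fin m) k) :
    (MvPolynomial.eval (entries g)).mapMatrix (Matrix.mvPolynomialX (Fin m) (Fin m) k) = g.val :=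
  Matrix.mvPolynomialX_mapMatrix_eval g.val

theorem entries_injective :
    Function.Injective (entries : Matrix.GeneralLinearGroup (Fin m) k → _) := fun _ _ hgh =>
  Units.ext (Matrix.ext fun i j => congrFun hgh (i, j))

/-- The Zariski topology on `GL_m(k)`. -/
@[reducible] def zariskiTopologyGL : TopologicalSpace (Matrix.GeneralLinearGroup (Fin m) k) :=
  TopologicalSpace.induced
    (fun g => MvPolynomial.pointToPoint (k := k) (entries g)) inferInstance

attribute [local instance] zariskiTopologyGL

theorem isClosed_iff_isZariskiClosedGL {Z : Set (Matrix.GeneralLinearGroup (Fin m) k)} :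
    IsClosed Z ↔ IsZariskiClosedGL Z := by
  have h : ∀ S : Set (MvPolynomial (Fin m × Fin m) k),
      (fun g : Matrix.GeneralLinearGroup (Fin m) k =>
        MvPolynomial.pointToPoint (k := k) (entries g)) ⁻¹' PrimeSpectrum.zeroLocus S =
      {g | ∀ f ∈ S, MvPolynomial.eval (entries g) f = 0} := by
    intro S
    ext g
    simp only [Set.mem_preimage, PrimeSpectrum.mem_zeroLocus, Set.mem_ofPred_eq]
    refine forall₂_congr fun f _ => ?_
    simp [MvPolynomial.pointToPoint, MvPolynomial.aeval_eq_eval]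
  rw [isClosed_induced_iff]
  constructor
  · rintro ⟨t, ht, rfl⟩
    obtain ⟨S, rfl⟩ := (PrimeSpectrum.isClosed_iff_zeroLocus t).1 ht
    exact ⟨S, h S⟩
  · rintro ⟨S, rfl⟩
    exact ⟨_, PrimeSpectrum.isClosed_zeroLocus S, h S⟩

theorem isClosed_setOf_eval_entries_eq_zero (f : MvPolynomial (Fin m × Fin m) k) :
    IsClosed {g : Matrix.GeneralLinearGroup (Fin m) k | MvPolynomial.eval (entries g) f = 0} :=
  isClosed_iff_isZariskiClosedGL.2 ⟨{f}, by simp only [Set.mem_singleton_iff, forall_eq]; rfl⟩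

theorem zariskiClosure_eq_closure (X : Set (Matrix.GeneralLinearGroup (Fin m) k)) :
    zariskiClosure X = closure X := by
  simp only [zariskiClosure, closure, isClosed_iff_isZariskiClosedGL]

instance noetherianSpace_zariskiTopologyGL :
    TopologicalSpace.NoetherianSpace (Matrix.GeneralLinearGroup (Fin m) k) :=
  (Topology.IsInducing.induced
    (fun g : Matrix.GeneralLinearGroup (Fin m) k =>
      MvPolynomial.pointToPoint (k := k) (entries g))).noetherianSpace

theorem continuous_iff_of_zariski {X : Type*} [TopologicalSpace X]
    {φ : X → Matrix.GeneralLinearGroup (Fin m) k} :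
    Continuous φ ↔ ∀ f : MvPolynomial (Fin m × Fin m) k,
      IsClosed {x | MvPolynomial.eval (entries (φ x)) f = 0} := by
  rw [continuous_iff_isClosed]
  constructor
  · exact fun h f => h _ (isClosed_setOf_eval_entries_eq_zero f)
  · intro h s hs
    obtain ⟨S, rfl⟩ := isClosed_iff_isZariskiClosedGL.1 hs
    have : φ ⁻¹' {g | ∀ f ∈ S, MvPolynomial.eval (entries g) f = 0} =
        ⋂ f ∈ S, {x | MvPolynomial.eval (entries (φ x)) f = 0} := by
      ext; simp
    exact this ▸ isClosed_biInter fun f _ => h f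

/-- A self-map of `GL_m(k)` is continuous if its entries, multiplied by the determinant, are
polynomial functions. -/
theorem continuous_of_det_smul_eq
    {φ : Matrix.GeneralLinearGroup (Fin m) k → Matrix.GeneralLinearGroup (Fin m) k}
    (P : Matrix (Fin m) (Fin m) (MvPolynomial (Fin m × Fin m) k))
    (hP : ∀ g, (MvPolynomial.eval (entries g)).mapMatrix P = g.val.det • (φ g).val) :
    Continuous φ := by
  have hD : ∀ g : Matrix.GeneralLinearGroup (Fin m) k, MvPolynomial.eval (entries g)
      (Matrix.mvPolynomialX (Fin m) (Fin m) k).det = g.val.det := fun g => by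
    rw [RingHom.map_det, mapMatrix_eval_entries_mvPolynomialX]
  have key : ∀ f : MvPolynomial (Fin m × Fin m) k, ∃ (F : MvPolynomial (Fin m × Fin m) k) (d : ℕ),
      ∀ g, MvPolynomial.eval (entries g) F =
        g.val.det ^ d * MvPolynomial.eval (entries (φ g)) f := by
    intro f
    induction f using MvPolynomial.induction_on with
    | C a => exact ⟨MvPolynomial.C a, 0, by simp⟩
    | add f₁ f₂ h₁ h₂ =>
      obtain ⟨F₁, d₁, h₁⟩ := h₁
      obtain ⟨F₂, d₂, h₂⟩ := h₂
      refine ⟨(Matrix.mvPolynomialX (Fin m) (Fin m) k).det ^ d₂ * F₁ +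
        (Matrix.mvPolynomialX (Fin m) (Fin m) k).det ^ d₁ * F₂, d₁ + d₂, fun g => ?_⟩
      simp only [map_add, map_mul, map_pow, hD, h₁, h₂]
      ring
    | mul_X f q h =>
      obtain ⟨F, d, h⟩ := h
      refine ⟨F * P q.1 q.2, d + 1, fun g => ?_⟩
      have := congrFun (congrFun (hP g) q.1) q.2
      simp only [RingHom.mapMatrix_apply, Matrix.map_apply, Matrix.smul_apply, smul_eq_mul] at this
      rw [map_mul, h, this, map_mul, MvPolynomial.eval_X]
      simp only [entries]
      ring
  refine continuous_iff_of_zariski.2 fun f => ?_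
  obtain ⟨F, d, hF⟩ := key f
  convert isClosed_setOf_eval_entries_eq_zero F using 3 with g
  have : g.val.det ≠ 0 := (Matrix.isUnit_iff_isUnit_det _).1 g.isUnit |>.ne_zero
  simp [hF, this]

theorem continuous_of_eval_entries_eq
    {φ : Matrix.GeneralLinearGroup (Fin m) k → Matrix.GeneralLinearGroup (Fin m) k}
    (P : Matrix (Fin m) (Fin m) (MvPolynomial (Fin m × Fin m) k))
    (hP : ∀ g, (MvPolynomial.eval (entries g)).mapMatrix P = (φ g).val) :
    Continuous φ := by
  refine continuous_of_det_smul_eq ((Matrix.mvPolynomialX (Fin m) (Fin m) k).det • P) fun g => ?_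
  rw [← hP, ← mapMatrix_eval_entries_mvPolynomialX g, ← RingHom.map_det]
  ext i j
  simp

theorem mapMatrix_eval_map_C (x : Fin m × Fin m → k) (A : Matrix (Fin m) (Fin m) k) :
    (MvPolynomial.eval x).mapMatrix (MvPolynomial.C.mapMatrix A) = A := by
  ext; simp

instance separatelyContinuousMul_zariskiTopologyGL :
    SeparatelyContinuousMul (Matrix.GeneralLinearGroup (Fin m) k) where
  continuous_const_mul {a} :=
    continuous_of_eval_entries_eq (MvPolynomial.C.mapMatrix a.val * Matrix.mvPolynomialX _ _ k)
      fun g => by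
        rw [map_mul, mapMatrix_eval_map_C, mapMatrix_eval_entries_mvPolynomialX, Units.val_mul]
  continuous_mul_const {a} :=
    continuous_of_eval_entries_eq (Matrix.mvPolynomialX _ _ k * MvPolynomial.C.mapMatrix a.val)
      fun g => by
        rw [map_mul, mapMatrix_eval_map_C, mapMatrix_eval_entries_mvPolynomialX, Units.val_mul]

theorem det_smul_inv_val (g : Matrix.GeneralLinearGroup (Fin m) k) :
    g.val.det • (g⁻¹).val = g.val.adjugate := by
  rw [Matrix.coe_units_inv, Matrix.inv_def, smul_smul, Ring.mul_inverse_cancel, one_smul]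
  exact (Matrix.isUnit_iff_isUnit_det _).1 g.isUnit

instance continuousInv_zariskiTopologyGL :
    ContinuousInv (Matrix.GeneralLinearGroup (Fin m) k) where
  continuous_inv := continuous_of_det_smul_eq (Matrix.mvPolynomialX _ _ k).adjugate fun g => by
    rw [det_smul_inv_val, RingHom.map_adjugate, mapMatrix_eval_entries_mvPolynomialX]

theorem continuous_conj_const (g : Matrix.GeneralLinearGroup (Fin m) k) :
    Continuous fun h : Matrix.GeneralLinearGroup (Fin m) k => h * g * h⁻¹ :=
  continuous_of_det_smul_eq (Matrix.mvPolynomialX _ _ k * MvPolynomial.C.mapMatrix g.val *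
    (Matrix.mvPolynomialX _ _ k).adjugate) fun h => by
    rw [map_mul, map_mul, mapMatrix_eval_map_C, RingHom.map_adjugate,
      mapMatrix_eval_entries_mvPolynomialX, ← det_smul_inv_val, Matrix.mul_smul, Units.val_mul,
      Units.val_mul]

theorem isClosed_setOf_mul_eq_mul (a b : Matrix (Fin m) (Fin m) k) :
    IsClosed {h : Matrix.GeneralLinearGroup (Fin m) k | h.val * a = b * h.val} := by
  let P := Matrix.mvPolynomialX _ _ k * MvPolynomial.C.mapMatrix a -
    MvPolynomial.C.mapMatrix b * Matrix.mvPolynomialX (Fin m) (Fin m) k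
  have : {h : Matrix.GeneralLinearGroup (Fin m) k | h.val * a = b * h.val} =
      ⋂ (i) (j), {h | MvPolynomial.eval (entries h) (P i j) = 0} := by
    ext h
    have : (MvPolynomial.eval (entries h)).mapMatrix P = h.val * a - b * h.val := by
      rw [map_sub, map_mul, map_mul, mapMatrix_eval_map_C, mapMatrix_eval_map_C,
        mapMatrix_eval_entries_mvPolynomialX]
    simp only [Set.mem_ofPred_eq, Set.mem_iInter]
    rw [← sub_eq_zero, ← this, ← Matrix.ext_iff]
    rfl
  exact this ▸ isClosed_iInter fun i => isClosed_iInter fun j =>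
    isClosed_setOf_eval_entries_eq_zero _

end ZariskiTopology

section Structure

variable {k : Type u} [Field k] {m : ℕ}

attribute [local instance] zariskiTopologyGL

theorem Matrix.charpoly_one_sub_pow_eq_zero {g : Matrix (Fin m) (Fin m) k}
    (hg : g.charpoly = (1 : Matrix (Fin m) (Fin m) k).charpoly) : (g - 1) ^ m = 0 := by
  have := Matrix.aeval_self_charpoly g
  simpa [hg, Matrix.charpoly_one] using this

theorem Matrix.pow_eq_zero_of_isNilpotent {N : Matrix (Fin m) (Fin m) k} (hN : IsNilpotent N) :
    N ^ m = 0 := by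
  have h := (Matrix.isNilpotent_charpoly_sub_pow_of_isNilpotent hN).eq_zero
  have := Matrix.aeval_self_charpoly N
  rw [sub_eq_zero.1 h] at this
  simpa using this

theorem Matrix.sub_one_pow_char_pow (p : ℕ) [Fact p.Prime] [CharP k p]
    (g : Matrix (Fin m) (Fin m) k) (e : ℕ) : (g - 1) ^ p ^ e = g ^ p ^ e - 1 := by
  rcases Nat.eq_zero_or_pos m with rfl | hm
  · exact Subsingleton.elim _ _
  · have : Nonempty (Fin m) := ⟨⟨0, hm⟩⟩
    have : ExpChar (Matrix (Fin m) (Fin m) k) p := inferInstance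
    rw [sub_pow_expChar_pow_of_commute _ _ (Commute.one_right g), one_pow]

theorem isUnipotentGL_of_pow_eq_one (p : ℕ) [Fact p.Prime] [CharP k p]
    {g : Matrix.GeneralLinearGroup (Fin m) k} {e : ℕ} (hg : g ^ p ^ e = 1) :
    IsUnipotentGL g :=
  Matrix.pow_eq_zero_of_isNilpotent ⟨p ^ e, by
    rw [Matrix.sub_one_pow_char_pow, ← Units.val_pow_eq_pow_val, hg, Units.val_one, sub_self]⟩

theorem isClosed_setOf_entries_eq (y : Fin m × Fin m → k) :
    IsClosed {g : Matrix.GeneralLinearGroup (Fin m) k | entries g = y} := by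
  have : {g : Matrix.GeneralLinearGroup (Fin m) k | entries g = y} =
      ⋂ q, {g | MvPolynomial.eval (entries g) (MvPolynomial.X q - MvPolynomial.C (y q)) = 0} := by
    ext g
    simp [funext_iff, sub_eq_zero]
  exact this ▸ isClosed_iInter fun q => isClosed_setOf_eval_entries_eq_zero _

theorem eval_entries_charpoly_coeff (x : Fin m × Fin m → k) (i : ℕ) :
    MvPolynomial.eval x ((Matrix.mvPolynomialX (Fin m) (Fin m) k).charpoly.coeff i) =
      (Matrix.of fun i j => x (i, j)).charpoly.coeff i := by
  rw [← Polynomial.coeff_map, ← Matrix.charpoly_map]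
  congr 2
  ext i j
  simp [Matrix.mvPolynomialX]

theorem exists_entries_eq_of_charpoly_eq_charpoly_one
    {T : Set (Matrix.GeneralLinearGroup (Fin m) k)}
    (hT : IsClosed T) {y : Fin m × Fin m → k}
    (hy : y ∈ MvPolynomial.zeroLocus k (MvPolynomial.vanishingIdeal k (entries '' T)))
    (hy1 : (Matrix.of fun i j => y (i, j)).charpoly = (1 : Matrix (Fin m) (Fin m) k).charpoly) :
    ∃ g ∈ T, IsUnipotentGL g ∧ entries g = y := by
  obtain ⟨S, rfl⟩ := isClosed_iff_isZariskiClosedGL.1 hT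
  have hdet : (Matrix.of fun i j => y (i, j)).det = 1 := by
    rw [Matrix.det_eq_sign_charpoly_coeff, hy1, ← Matrix.det_eq_sign_charpoly_coeff, Matrix.det_one]
  let g : Matrix.GeneralLinearGroup (Fin m) k :=
    Matrix.GeneralLinearGroup.mkOfDetNeZero (Matrix.of fun i j => y (i, j)) (by simp [hdet])
  have hg : entries g = y := rfl
  refine ⟨g, fun f hf => ?_, Matrix.charpoly_one_sub_pow_eq_zero hy1, hg⟩
  refine hy f ?_
  rintro _ ⟨h, hh, rfl⟩
  exact hh f hf

/-- A connected linear group without nontrivial unipotent elements is commutative. -/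
theorem commute_of_isIrreducible_of_no_unipotent [IsAlgClosed k]
    (T : Subgroup (Matrix.GeneralLinearGroup (Fin m) k))
    (hirr : IsIrreducible (T : Set (Matrix.GeneralLinearGroup (Fin m) k)))
    (hcl : IsClosed (T : Set (Matrix.GeneralLinearGroup (Fin m) k)))
    (huni : ∀ g ∈ T, IsUnipotentGL g → g = 1) {g h : Matrix.GeneralLinearGroup (Fin m) k}
    (hg : g ∈ T) (hh : h ∈ T) : g * h = h * g := by
  classical
  have hmem : ∀ t ∈ T, entries t ∈ MvPolynomial.zeroLocus k
      (MvPolynomial.vanishingIdeal k (entries '' (T : Set (Matrix.GeneralLinearGroup (Fin m) k)))) :=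
    fun t ht f hf =>
    hf _ ⟨t, ht, rfl⟩
  obtain ⟨f, hf1, hfin⟩ := exists_eval_ne_zero_finite_fibers
    (MvPolynomial.vanishingIdeal k (entries '' (T : Set (Matrix.GeneralLinearGroup (Fin m) k))))
    (fun i : ℕ => (Matrix.mvPolynomialX (Fin m) (Fin m) k).charpoly.coeff i)
    (entries (1 : Matrix.GeneralLinearGroup (Fin m) k)) (hmem 1 T.one_mem) (by
      intro y hy hc
      simp only [eval_entries_charpoly_coeff] at hc
      obtain ⟨t, ht, htu, rfl⟩ := exists_entries_eq_of_charpoly_eq_charpoly_one hcl hy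
        (Polynomial.ext hc)
      rw [huni t ht htu])
  have central : ∀ t ∈ T, MvPolynomial.eval (entries t) f ≠ 0 → ∀ h ∈ T, t * h = h * t := by
    intro t ht hft
    have hF := hfin (entries t)
    set F := {y ∈ MvPolynomial.zeroLocus k
      (MvPolynomial.vanishingIdeal k (entries '' (T : Set (Matrix.GeneralLinearGroup (Fin m) k)))) |
      MvPolynomial.eval y f ≠ 0 ∧
        ∀ i, MvPolynomial.eval y ((Matrix.mvPolynomialX (Fin m) (Fin m) k).charpoly.coeff i) =
        MvPolynomial.eval (entries t)
          ((Matrix.mvPolynomialX (Fin m) (Fin m) k).charpoly.coeff i)} with hFdef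
    let c : Matrix.GeneralLinearGroup (Fin m) k → Matrix.GeneralLinearGroup (Fin m) k :=
      fun h => h * t * h⁻¹
    have hc : Continuous c := continuous_conj_const t
    let Z : Finset (Set (Matrix.GeneralLinearGroup (Fin m) k)) :=
      insert (c ⁻¹' {g | MvPolynomial.eval (entries g) f = 0})
        (hF.toFinset.image fun y => c ⁻¹' {g | entries g = y})
    obtain ⟨z, hz, hTz⟩ := isIrreducible_iff_sUnion_isClosed.1 hirr Z (by
      intro z hz
      simp only [Z, Finset.mem_insert, Finset.mem_image] at hz
      rcases hz with rfl | ⟨y, -, rfl⟩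
      · exact (isClosed_setOf_eval_entries_eq_zero f).preimage hc
      · exact (isClosed_setOf_entries_eq y).preimage hc) (by
      intro h hh
      simp only [Z, Finset.coe_insert, Finset.coe_image, Set.sUnion_insert, Set.mem_union,
        Set.mem_sUnion, Set.mem_image]
      by_cases h0 : MvPolynomial.eval (entries (c h)) f = 0
      · exact Or.inl h0
      · refine Or.inr ⟨_, ⟨entries (c h), ?_, rfl⟩, rfl⟩
        rw [Finset.mem_coe, Set.Finite.mem_toFinset]
        refine ⟨hmem _ (T.mul_mem (T.mul_mem hh ht) (T.inv_mem hh)), h0, fun i => ?_⟩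
        rw [eval_entries_charpoly_coeff, eval_entries_charpoly_coeff]
        congr 1
        refine Eq.trans ?_ (Matrix.charpoly_units_conj h t.val)
        rw [← Matrix.coe_units_inv]
        rfl)
    simp only [Z, Finset.mem_insert, Finset.mem_image] at hz
    have hc1 : c 1 = t := by simp [c]
    rcases hz with rfl | ⟨y, -, rfl⟩
    · exact absurd (by simpa [hc1] using hTz T.one_mem) hft
    · have hy : entries t = y := by simpa [hc1] using hTz T.one_mem
      intro h hh
      have := entries_injective ((show entries (c h) = y from hTz hh).trans hy.symm)
      exact (mul_inv_eq_iff_eq_mul.1 this).symm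
  rcases isPreirreducible_iff_isClosed_union_isClosed.1 hirr.isPreirreducible
    {t | MvPolynomial.eval (entries t) f = 0} {t | t.val * h.val = h.val * t.val}
    (isClosed_setOf_eval_entries_eq_zero f) (isClosed_setOf_mul_eq_mul _ _) (by
      intro t ht
      by_cases h0 : MvPolynomial.eval (entries t) f = 0
      · exact Or.inl h0
      · exact Or.inr (congrArg Units.val (central t ht h0 h hh))) with h1 | h1
  · exact absurd (h1 T.one_mem) hf1
  · exact Units.ext (h1 hg)

end Structure

section Diagonalization

variable {k : Type u} [Field k] {m : ℕ}

attribute [local instance] zariskiTopologyGL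

theorem Module.End.span_common_eigenvectors_pow_eq_top {ι V : Type*} [AddCommGroup V] [Module k V]
    [FiniteDimensional k V] [IsAlgClosed k] (p : ℕ) [Fact p.Prime] [CharP k p] (e : ℕ)
    (he : Module.finrank k V ≤ p ^ e) (f : ι → Module.End k V) (hf : ∀ i j, Commute (f i) (f j)) :
    Submodule.span k {v : V | ∀ i, ∃ c : k, (f i ^ p ^ e) v = c • v} = ⊤ := by
  rw [eq_top_iff, ←
    Module.End.iSup_iInf_maxGenEigenspace_eq_top_of_iSup_maxGenEigenspace_eq_top_of_commute
      f (fun i j _ => hf i j) (fun i => Module.End.iSup_maxGenEigenspace_eq_top (f i))]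
  refine iSup_le fun χ v hv => Submodule.subset_span fun i => ⟨χ i ^ p ^ e, ?_⟩
  have hvi := (Submodule.mem_iInf _).1 hv i
  rw [Module.End.maxGenEigenspace_eq_genEigenspace_finrank, Module.End.mem_genEigenspace_nat,
    LinearMap.mem_ker] at hvi
  rcases subsingleton_or_nontrivial V with h | h
  · exact Subsingleton.elim _ _
  have : CharP (Module.End k V) p := charP_of_injective_algebraMap' k p
  have hexp : ExpChar (Module.End k V) p := inferInstance
  have hzero : ((f i - algebraMap k (Module.End k V) (χ i)) ^ p ^ e) v = 0 := by
    obtain ⟨d, hd⟩ := Nat.exists_eq_add_of_le he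
    rw [hd, add_comm, pow_add, Module.End.mul_apply]
    simp only [Algebra.algebraMap_eq_smul_one]
    rw [hvi, map_zero]
  rw [sub_pow_expChar_pow_of_commute _ _ (Algebra.commutes _ _).symm,
    LinearMap.sub_apply, sub_eq_zero] at hzero
  rw [hzero, ← map_pow, Module.algebraMap_end_apply]

theorem Matrix.exists_conj_pow_isDiag [IsAlgClosed k] (p : ℕ) [Fact p.Prime] [CharP k p] (e : ℕ)
    (he : m ≤ p ^ e) (T : Set (Matrix.GeneralLinearGroup (Fin m) k))
    (hT : ∀ g ∈ T, ∀ h ∈ T, g * h = h * g) :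
    ∃ P : Matrix.GeneralLinearGroup (Fin m) k, ∀ g ∈ T, (P⁻¹ * g ^ p ^ e * P).val.IsDiag := by
  let f : T → Module.End k (Fin m → k) := fun g => Matrix.toLin' g.1.val
  have hf : ∀ i j, Commute (f i) (f j) := fun i j => by
    change f i * f j = f j * f i
    simp only [f, Module.End.mul_eq_comp, ← Matrix.toLin'_mul, ← Units.val_mul, hT i i.2 j j.2]
  have hspan := Module.End.span_common_eigenvectors_pow_eq_top p e (by simpa using he) f hf
  set S := {v : Fin m → k | ∀ i, ∃ c : k, (f i ^ p ^ e) v = c • v} with hS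
  let b₀ := Module.Basis.ofSpan hspan.ge
  let ix := (Module.Basis.indexEquiv (Pi.basisFun k (Fin m)) b₀)
  let b : Module.Basis (Fin m) k (Fin m → k) := b₀.reindex ix.symm
  have hb : ∀ i, b i ∈ S := fun i => by
    have : b i = b₀ (ix i) := by simp [b]
    rw [this]
    exact Module.Basis.ofSpan_subset hspan.ge ⟨_, rfl⟩
  let M := (Pi.basisFun k (Fin m)).toMatrix b
  let P : Matrix.GeneralLinearGroup (Fin m) k := ⟨M, b.toMatrix (Pi.basisFun k (Fin m)),
    by simp [M], by simp [M]⟩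
  refine ⟨P, fun g hg => ?_⟩
  choose c hc using fun i => hb i ⟨g, hg⟩
  have hmul : g.val ^ p ^ e * M = M * Matrix.diagonal c := by
    ext i j
    rw [Matrix.mul_diagonal]
    have := congrFun (hc j) i
    simp only [f, ← Matrix.toLin'_pow, Matrix.toLin'_apply, Pi.smul_apply, smul_eq_mul] at this
    rw [mul_comm, show M i j = b j i by simp [M, Module.Basis.toMatrix_apply], ← this,
      Matrix.mul_apply]
    refine Finset.sum_congr rfl fun l _ => ?_
    simp [M, Module.Basis.toMatrix_apply]
  have : (P⁻¹ * g ^ p ^ e * P).val = Matrix.diagonal c := by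
    rw [mul_assoc, Units.val_mul, Units.val_mul, Units.val_pow_eq_pow_val]
    change P⁻¹.val * (g.val ^ p ^ e * M) = _
    rw [hmul, ← mul_assoc, show P⁻¹.val * M = 1 from P.inv_mul, one_mul]
  rw [this]
  exact Matrix.isDiag_diagonal c

theorem isClosed_setOf_isDiag :
    IsClosed {g : Matrix.GeneralLinearGroup (Fin m) k | g.val.IsDiag} := by
  refine isClosed_iff_isZariskiClosedGL.2
    ⟨{f | ∃ i j : Fin m, i ≠ j ∧ f = MvPolynomial.X (i, j)}, ?_⟩
  ext g
  simp only [Set.mem_ofPred_eq]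
  constructor
  · rintro h _ ⟨i, j, hij, rfl⟩
    simpa using h hij
  · intro h i j hij
    simpa using h _ ⟨i, j, hij, rfl⟩

theorem isClosed_image_frobenius [IsAlgClosed k] (p : ℕ) [Fact p.Prime] [CharP k p]
    {Z : Set (Matrix.GeneralLinearGroup (Fin m) k)} (hZ : IsClosed Z) :
    IsClosed (Matrix.GeneralLinearGroup.map (frobenius k p) '' Z) := by
  obtain ⟨S, rfl⟩ := isClosed_iff_isZariskiClosedGL.1 hZ
  refine isClosed_iff_isZariskiClosedGL.2 ⟨MvPolynomial.map (frobenius k p) '' S, ?_⟩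
  have key : ∀ (g : Matrix.GeneralLinearGroup (Fin m) k) (f : MvPolynomial (Fin m × Fin m) k),
      MvPolynomial.eval (entries (Matrix.GeneralLinearGroup.map (frobenius k p) g))
        (MvPolynomial.map (frobenius k p) f) = 0 ↔ MvPolynomial.eval (entries g) f = 0 := by
    intro g f
    have : entries (Matrix.GeneralLinearGroup.map (frobenius k p) g) =
        fun q => frobenius k p (entries g q) := rfl
    rw [this, ← Function.comp_def, MvPolynomial.eval_map, ← MvPolynomial.eval₂_comp, map_eq_zero]
  ext g
  constructor
  · rintro ⟨h, hh, rfl⟩ _ ⟨f, hf, rfl⟩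
    exact (key h f).2 (hh f hf)
  · intro hg
    let h := Matrix.GeneralLinearGroup.map (frobeniusEquiv k p).symm.toRingHom g
    have hgh : Matrix.GeneralLinearGroup.map (frobenius k p) h = g := by
      ext i j
      exact frobenius_apply_frobeniusEquiv_symm k p (g.val i j)
    refine ⟨h, fun f hf => (key h f).1 ?_, hgh⟩
    rw [hgh]
    exact hg _ ⟨f, hf, rfl⟩

theorem Matrix.GeneralLinearGroup.map_frobenius_eq_pow (p : ℕ) [Fact p.Prime] [CharP k p]
    {g : Matrix.GeneralLinearGroup (Fin m) k} (hg : g.val.IsDiag) :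
    Matrix.GeneralLinearGroup.map (frobenius k p) g = g ^ p := by
  refine Units.ext ?_
  rw [Units.val_pow_eq_pow_val]
  rw [← hg.diagonal_diag, Matrix.diagonal_pow]
  ext i j
  change frobenius k p (g.val i j) = _
  rw [Matrix.diagonal_apply]
  split_ifs with h
  · simp [h, frobenius_def]
  · rw [hg h, map_zero]

theorem eq_of_pow_char_pow_eq (p : ℕ) [Fact p.Prime] [CharP k p]
    (T : Subgroup (Matrix.GeneralLinearGroup (Fin m) k))
    (huni : ∀ g ∈ T, IsUnipotentGL g → g = 1) {g h : Matrix.GeneralLinearGroup (Fin m) k}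
    (hg : g ∈ T) (hh : h ∈ T) (hcomm : g * h = h * g) {e : ℕ} (hgh : g ^ p ^ e = h ^ p ^ e) :
    g = h := by
  have : Commute g h⁻¹ := Commute.inv_right hcomm
  have h1 : (g * h⁻¹) ^ p ^ e = 1 := by
    rw [this.mul_pow, hgh, inv_pow, mul_inv_cancel]
  exact mul_inv_eq_one.1
    (huni _ (T.mul_mem hg (T.inv_mem hh)) (isUnipotentGL_of_pow_eq_one p h1))

/-- A closed commutative linear group without nontrivial unipotent elements is diagonalizable and
`p`-divisible. -/
theorem exists_isDiag_conj_and_pow_surjective [IsAlgClosed k] (p : ℕ) [Fact p.Prime] [CharP k p]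
    (T : Subgroup (Matrix.GeneralLinearGroup (Fin m) k))
    (hcl : IsClosed (T : Set (Matrix.GeneralLinearGroup (Fin m) k)))
    (huni : ∀ g ∈ T, IsUnipotentGL g → g = 1) (hcomm : ∀ g ∈ T, ∀ h ∈ T, g * h = h * g) :
    (∃ P : Matrix.GeneralLinearGroup (Fin m) k, ∀ g ∈ T, (P⁻¹ * g * P).val.IsDiag) ∧
      ∀ t ∈ T, ∃ s ∈ T, s ^ p = t := by
  have hp1 : 1 < p := (Fact.out : p.Prime).one_lt
  have inj : ∀ g ∈ T, ∀ h ∈ T, ∀ e, g ^ p ^ e = h ^ p ^ e → g = h := fun g hg h hh e =>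
    eq_of_pow_char_pow_eq p T huni hg hh (hcomm g hg h hh)
  have hm : m ≤ p ^ m := (Nat.lt_pow_self hp1).le
  obtain ⟨P, hP⟩ := Matrix.exists_conj_pow_isDiag p m hm
    (T : Set (Matrix.GeneralLinearGroup (Fin m) k)) hcomm
  have conj_pow : ∀ (d : Matrix.GeneralLinearGroup (Fin m) k) (n : ℕ),
      P * d ^ n * P⁻¹ = (P * d * P⁻¹) ^ n := fun d n => (conj_pow).symm
  let D : ℕ → TopologicalSpace.Closeds (Matrix.GeneralLinearGroup (Fin m) k) := fun i =>
    ⟨(Matrix.GeneralLinearGroup.map (frobenius k p) '' ·)^[i]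
      {d | d.val.IsDiag ∧ P * d * P⁻¹ ∈ T}, by
        induction i with
        | zero =>
          refine isClosed_setOf_isDiag.inter (hcl.preimage (f := fun d => P * d * P⁻¹) ?_)
          exact (continuous_mul_const P⁻¹).comp (continuous_const_mul P)
        | succ i ih =>
          rw [Function.iterate_succ_apply']
          exact isClosed_image_frobenius p ih⟩
  have hD : ∀ i, (D i : Set (Matrix.GeneralLinearGroup (Fin m) k)) =
      (· ^ p ^ i) '' {d | d.val.IsDiag ∧ P * d * P⁻¹ ∈ T} := by
    intro i
    induction i with
    | zero => simp [D]
    | succ i ih =>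
      have : (D (i + 1) : Set (Matrix.GeneralLinearGroup (Fin m) k)) =
          Matrix.GeneralLinearGroup.map (frobenius k p) '' D i :=
        Function.iterate_succ_apply' _ _ _
      rw [this, ih, Set.image_image]
      refine Set.image_congr fun d hd => ?_
      rw [Matrix.GeneralLinearGroup.map_frobenius_eq_pow, ← pow_mul, pow_succ]
      rw [Units.val_pow_eq_pow_val, ← hd.1.diagonal_diag, Matrix.diagonal_pow]
      exact Matrix.isDiag_diagonal _
  have diag_pow : ∀ (d : Matrix.GeneralLinearGroup (Fin m) k) (n : ℕ), d.val.IsDiag →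
      (d ^ n).val.IsDiag := fun d n hd => by
    rw [Units.val_pow_eq_pow_val, ← hd.diagonal_diag, Matrix.diagonal_pow]
    exact Matrix.isDiag_diagonal _
  have hanti : Antitone D := antitone_nat_of_succ_le fun i => by
    change (D (i + 1) : Set (Matrix.GeneralLinearGroup (Fin m) k)) ⊆ D i
    rw [hD, hD]
    rintro _ ⟨d, hd, rfl⟩
    refine ⟨d ^ p, ⟨diag_pow d p hd.1, ?_⟩, ?_⟩
    · rw [conj_pow]
      exact T.pow_mem hd.2 p
    · simp only [← pow_mul, pow_succ']
  have hstab : ∃ i, D i = D (i + 1) := by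
    obtain ⟨i, hi⟩ := WellFoundedLT.antitone_chain_condition hanti
    exact ⟨i, hi _ (Nat.le_succ i)⟩
  have hroot : ∀ d : Matrix.GeneralLinearGroup (Fin m) k, d.val.IsDiag → P * d * P⁻¹ ∈ T →
      ∃ c : Matrix.GeneralLinearGroup (Fin m) k, c.val.IsDiag ∧ P * c * P⁻¹ ∈ T ∧ c ^ p = d := by
    intro d hd hdT
    obtain ⟨i, hi⟩ := hstab
    have : d ^ p ^ i ∈ (D (i + 1) : Set (Matrix.GeneralLinearGroup (Fin m) k)) := by
      rw [← hi, hD]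
      exact ⟨d, ⟨hd, hdT⟩, rfl⟩
    rw [hD] at this
    obtain ⟨c, ⟨hc, hcT⟩, hcd⟩ := this
    refine ⟨c, hc, hcT, ?_⟩
    have := inj (P * c ^ p * P⁻¹) (by rw [conj_pow]; exact T.pow_mem hcT p) (P * d * P⁻¹) hdT i
      (by rw [← conj_pow, ← conj_pow, ← hcd, ← pow_mul, ← pow_succ'])
    simpa using this
  have hroots : ∀ (e : ℕ) (d : Matrix.GeneralLinearGroup (Fin m) k), d.val.IsDiag →
      P * d * P⁻¹ ∈ T → ∃ c : Matrix.GeneralLinearGroup (Fin m) k,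
        c.val.IsDiag ∧ P * c * P⁻¹ ∈ T ∧ c ^ p ^ e = d := by
    intro e
    induction e with
    | zero => exact fun d hd hdT => ⟨d, hd, hdT, by simp⟩
    | succ e ih =>
      intro d hd hdT
      obtain ⟨c, hc, hcT, rfl⟩ := hroot d hd hdT
      obtain ⟨b, hb, hbT, rfl⟩ := ih c hc hcT
      exact ⟨b, hb, hbT, by rw [pow_succ, pow_mul]⟩
  have hdiag : ∀ g ∈ T, (P⁻¹ * g * P).val.IsDiag := by
    intro g hg
    obtain ⟨c, hc, hcT, hcg⟩ := hroots m _ (hP g hg) (by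
      simpa [mul_assoc] using T.pow_mem hg (p ^ m))
    have : P * c * P⁻¹ = g := inj _ hcT _ hg m (by rw [← conj_pow, hcg]; simp [mul_assoc])
    rw [← this]
    simpa [mul_assoc] using hc
  refine ⟨⟨P, hdiag⟩, fun t ht => ?_⟩
  obtain ⟨c, hc, hcT, hct⟩ := hroot _ (hdiag t ht) (by simpa [mul_assoc] using ht)
  refine ⟨_, hcT, ?_⟩
  rw [← conj_pow, hct]
  simp [mul_assoc]

/-- If the Zariski closure of a linear group in characteristic `p` has no nontrivial unipotent
element, the group has a diagonalizable normal subgroup of finite index prime to `p`. -/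
theorem exists_normal_diagonalizable_subgroup [IsAlgClosed k] (p : ℕ) [Fact p.Prime] [CharP k p]
    {G : Type*} [Group G] (ρ : G →* Matrix.GeneralLinearGroup (Fin m) k)
    (huni : ∀ g ∈ zariskiClosure (Set.range fun g : G => ρ g), IsUnipotentGL g → g = 1) :
    ∃ (N : Subgroup G) (P : Matrix.GeneralLinearGroup (Fin m) k), N.Normal ∧ N.FiniteIndex ∧
      ¬ p ∣ N.index ∧ ∀ g ∈ N, (P⁻¹ * ρ g * P).val.IsDiag := by
  obtain ⟨H, hH⟩ := Subgroup.exists_coe_eq_closure ρ.range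
  rw [MonoidHom.coe_range] at hH
  replace huni : ∀ g ∈ H, IsUnipotentGL g → g = 1 := fun g hg => huni g (by
    rw [zariskiClosure_eq_closure]
    exact hH ▸ hg)
  have hρ : ∀ g, ρ g ∈ H := fun g => by
    rw [← SetLike.mem_coe, hH]
    exact subset_closure ⟨g, rfl⟩
  have hind : Topology.IsInducing (H.subtype : H → Matrix.GeneralLinearGroup (Fin m) k) :=
    Topology.IsInducing.subtypeVal
  have : TopologicalSpace.NoetherianSpace H := hind.noetherianSpace
  have : SeparatelyContinuousMul H := hind.separatelyContinuousMul H.subtype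
  obtain ⟨N, hNn, hNf, hNi, hNc⟩ := exists_normal_finiteIndex_isIrreducible H
  let T := N.map H.subtype
  have hTH : T ≤ H := by
    rintro _ ⟨x, -, rfl⟩
    exact x.2
  have hTi : IsIrreducible (T : Set (Matrix.GeneralLinearGroup (Fin m) k)) :=
    hNi.image _ hind.continuous.continuousOn
  have hTc : IsClosed (T : Set (Matrix.GeneralLinearGroup (Fin m) k)) := by
    have : IsClosed (H : Set (Matrix.GeneralLinearGroup (Fin m) k)) := hH ▸ isClosed_closure
    exact this.isClosedMap_subtype_val _ hNc
  have hTu : ∀ g ∈ T, IsUnipotentGL g → g = 1 := fun g hg => huni g (hTH hg)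
  have hTcomm : ∀ g ∈ T, ∀ h ∈ T, g * h = h * g := fun g hg h hh =>
    commute_of_isIrreducible_of_no_unipotent T hTi hTc hTu hg hh
  obtain ⟨⟨P, hP⟩, hroot⟩ := exists_isDiag_conj_and_pow_surjective p T hTc hTu hTcomm
  let ρ' : G →* H := ρ.codRestrict H hρ
  have hmem : ∀ g, g ∈ N.comap ρ' ↔ ρ g ∈ T := fun g =>
    ⟨fun h => ⟨ρ' g, h, rfl⟩, fun ⟨x, hx, hxg⟩ => by
      have : x = ρ' g := Subtype.ext hxg
      rw [Subgroup.mem_comap, ← this]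
      exact hx⟩
  have hfin : (N.comap ρ').FiniteIndex := ⟨by
    rw [Subgroup.index_comap]
    exact (inferInstance : (N.subgroupOf ρ'.range).FiniteIndex).index_ne_zero⟩
  refine ⟨N.comap ρ', P, inferInstance, hfin, fun hdvd => ?_, fun g hg => hP _ ((hmem g).1 hg)⟩
  obtain ⟨x, hx⟩ := exists_prime_orderOf_dvd_card' (G := G ⧸ N.comap ρ') p hdvd
  obtain ⟨g, rfl⟩ := QuotientGroup.mk_surjective x
  have hgp : g ^ p ∈ N.comap ρ' := by
    rw [← QuotientGroup.eq_one_iff, QuotientGroup.mk_pow, ← hx, pow_orderOf_eq_one]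
  have hg : g ∉ N.comap ρ' := fun hg => by
    rw [(QuotientGroup.eq_one_iff g).2 hg, orderOf_one] at hx
    exact (Fact.out : p.Prime).one_lt.ne hx
  obtain ⟨s, hs, hsp⟩ := hroot _ ((hmem _).1 hgp)
  rw [map_pow] at hsp
  have hconj : ρ g * s * (ρ g)⁻¹ ∈ T := by
    obtain ⟨x, hx, rfl⟩ := hs
    exact ⟨ρ' g * x * (ρ' g)⁻¹, hNn.conj_mem x hx _, rfl⟩
  have hcs : ρ g * s = s * ρ g := by
    rw [← mul_inv_eq_iff_eq_mul]
    refine eq_of_pow_char_pow_eq p T hTu hconj hs (hTcomm _ hconj _ hs) (e := 1) ?_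
    rw [pow_one, conj_pow, hsp, ← pow_succ', pow_succ, mul_inv_cancel_right]
  have : ρ g = s := eq_of_pow_char_pow_eq p H huni (hρ g) (hTH hs) hcs (e := 1)
    (by rw [pow_one, hsp])
  exact hg ((hmem g).2 (this ▸ hs))

end Diagonalization

section KroneckerFamilies

variable {R ι α β γ : Type*} [CommRing R] [Fintype ι]

/-- The Kronecker product of a finite family of matrices. -/
def Matrix.piKronecker (B : ι → Matrix α β R) : Matrix (ι → α) (ι → β) R :=
  Matrix.of fun s t => ∏ i, B i (s i) (t i)

theorem Matrix.piKronecker_apply (B : ι → Matrix α β R) (s : ι → α) (t : ι → β) :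
    Matrix.piKronecker B s t = ∏ i, B i (s i) (t i) := rfl

theorem Matrix.piKronecker_mul [DecidableEq ι] [Fintype β] (B : ι → Matrix α β R)
    (C : ι → Matrix β γ R) :
    Matrix.piKronecker B * Matrix.piKronecker C = Matrix.piKronecker fun i => B i * C i := by
  ext s t
  simp only [Matrix.piKronecker_apply, Matrix.mul_apply, Finset.prod_univ_sum,
    Fintype.piFinset_univ, Finset.prod_mul_distrib]

theorem Matrix.piKronecker_one [DecidableEq α] :
    Matrix.piKronecker (fun _ : ι => (1 : Matrix α α R)) = 1 := by
  ext s t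
  simp only [Matrix.piKronecker_apply, Matrix.one_apply, Finset.prod_ite_zero, funext_iff,
    Finset.mem_univ, true_imp_iff, Finset.prod_const_one]

end KroneckerFamilies

section TrivialSummands

/-- The family of matrices `A` has a trivial direct summand of dimension `a`. -/
def HasTrivialSummand {k X I : Type*} [Field k] [Fintype I] (A : X → Matrix I I k) (a : ℕ) : Prop :=
  ∃ (i : Matrix I (Fin a) k) (r : Matrix (Fin a) I k), r * i = 1 ∧ ∀ x, A x * i = i ∧ r * A x = r

theorem HasTrivialSummand.le_card {k X I : Type*} [Field k] [Fintype I] {A : X → Matrix I I k}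
    {a : ℕ} (h : HasTrivialSummand A a) : a ≤ Fintype.card I := by
  obtain ⟨i, r, hri, -⟩ := h
  calc a = (1 : Matrix (Fin a) (Fin a) k).rank := by rw [Matrix.rank_one, Fintype.card_fin]
    _ = (r * i).rank := by rw [hri]
    _ ≤ i.rank := Matrix.rank_mul_le_right _ _
    _ ≤ Fintype.card I := Matrix.rank_le_card_height _

theorem hasTrivialSummand_zero {k X I : Type*} [Field k] [Fintype I] (A : X → Matrix I I k) :
    HasTrivialSummand A 0 :=
  ⟨0, 0, Subsingleton.elim _ _, fun _ => ⟨Matrix.ext fun _ j => j.elim0,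
    Matrix.ext fun j => j.elim0⟩⟩

variable {k G : Type u} [Field k] [Monoid G]

theorem nonempty_iso_trivial_biprod_iff (V : Rep.{u} k G) {I : Type*} [Fintype I] [DecidableEq I]
    (b : Module.Basis I k V.V) (a : ℕ) :
    (∃ W : Rep k G, Nonempty (V ≅ Rep.trivial k G (Fin a → k) ⊞ W)) ↔
      HasTrivialSummand (fun g => LinearMap.toMatrix b b (V.ρ g)) a := by
  let c := Pi.basisFun k (Fin a)
  constructor
  · rintro ⟨W, ⟨e⟩⟩
    let i : Rep.trivial k G (Fin a → k) ⟶ V := biprod.inl ≫ e.inv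
    let r : V ⟶ Rep.trivial k G (Fin a → k) := e.hom ≫ biprod.fst
    have hir : i ≫ r = 𝟙 _ := by simp [i, r]
    refine ⟨LinearMap.toMatrix c b i.hom.toLinearMap, LinearMap.toMatrix b c r.hom.toLinearMap,
      ?_, fun g => ⟨?_, ?_⟩⟩
    · have := Rep.hom_comp_toLinearMap i r
      rw [← LinearMap.toMatrix_comp, ← this, hir]
      exact LinearMap.toMatrix_id c
    · rw [← LinearMap.toMatrix_comp]
      congr 1
      exact LinearMap.ext fun x => (Rep.hom_comm_apply i g x).symm
    · rw [← LinearMap.toMatrix_comp]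
      congr 1
      exact LinearMap.ext fun x => Rep.hom_comm_apply r g x
  · rintro ⟨i, r, hri, h⟩
    let i' : Rep.trivial k G (Fin a → k) ⟶ V := Rep.ofHom ⟨Matrix.toLin c b i, fun g => by
      have := congrArg (Matrix.toLin c b) (h g).1
      rw [Matrix.toLin_mul c b b, Matrix.toLin_toMatrix] at this
      rw [this]
      rfl⟩
    let r' : V ⟶ Rep.trivial k G (Fin a → k) := Rep.ofHom ⟨Matrix.toLin b c r, fun g => by
      have := congrArg (Matrix.toLin b c) (h g).2
      rw [Matrix.toLin_mul b b c, Matrix.toLin_toMatrix] at this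
      rw [this]
      rfl⟩
    have hir : i' ≫ r' = 𝟙 _ := by
      ext1
      refine Representation.IntertwiningMap.toLinearMap_injective _ _ ?_
      change Matrix.toLin b c r ∘ₗ Matrix.toLin c b i = LinearMap.id
      rw [← Matrix.toLin_mul, hri, Matrix.toLin_one]
    have : IsSplitMono i' := ⟨⟨⟨r', hir⟩⟩⟩
    exact ⟨cokernel i', ⟨biprod.uniqueUpToIso _ _
      (isBilimitBinaryBiconeOfIsSplitMonoOfCokernel (cokernelIsCokernel i'))⟩⟩

theorem exists_basis_tpow {m : ℕ} (ρ : G →* Matrix.GeneralLinearGroup (Fin m) k) (n : ℕ) :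
    ∃ b : Module.Basis (Fin n → Fin m) k (tpow (Rep.of (matRep ρ)) n).V, ∀ g,
      LinearMap.toMatrix b b ((tpow (Rep.of (matRep ρ)) n).ρ g) =
        Matrix.piKronecker fun _ : Fin n => (ρ g).val := by
  induction n with
  | zero =>
    refine ⟨Module.Basis.singleton (Fin 0 → Fin m) k, fun g => ?_⟩
    ext s t
    refine (LinearMap.toMatrix_apply _ _ _ _ _).trans ?_
    rw [Matrix.piKronecker_apply]
    change (Module.Basis.singleton (Fin 0 → Fin m) k).repr
      ((Module.Basis.singleton (Fin 0 → Fin m) k) t) s = _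
    simp [Subsingleton.elim s t]
  | succ n ih =>
    obtain ⟨b, hb⟩ := ih
    let c := Pi.basisFun k (Fin m)
    let e : (Fin n → Fin m) × Fin m ≃ (Fin (n + 1) → Fin m) :=
      (Equiv.prodComm _ _).trans (Fin.snocEquiv fun _ => Fin m)
    refine ⟨(b.tensorProduct c).reindex e, fun g => ?_⟩
    ext s t
    refine (LinearMap.toMatrix_apply _ _ _ _ _).trans ?_
    change ((b.tensorProduct c).reindex e).repr (TensorProduct.map
      ((tpow (Rep.of (matRep ρ)) n).ρ g) (matRep ρ g) (((b.tensorProduct c).reindex e) t)) s = _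
    have h1 : ∀ s, e.symm s = (Fin.init s, s (Fin.last n)) := fun _ => rfl
    rw [Matrix.piKronecker_apply, Fin.prod_univ_castSucc,
      Module.Basis.repr_reindex_apply, Module.Basis.reindex_apply, h1, h1,
      Module.Basis.tensorProduct_apply, TensorProduct.map_tmul,
      Module.Basis.tensorProduct_repr_tmul_apply, smul_eq_mul, mul_comm,
      ← LinearMap.toMatrix_apply, hb, Matrix.piKronecker_apply]
    congr 1
    simp [c, matRep, Matrix.mulVec_single]

variable {m : ℕ} (ρ : G →* Matrix.GeneralLinearGroup (Fin m) k) (n : ℕ)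

theorem TS_tpow_matRep : TS (tpow (Rep.of (matRep ρ)) n) =
    sSup {a | HasTrivialSummand (fun g => Matrix.piKronecker fun _ : Fin n => (ρ g).val) a} := by
  obtain ⟨b, hb⟩ := exists_basis_tpow ρ n
  simp only [TS, nonempty_iso_trivial_biprod_iff _ b, hb]

theorem HasTrivialSummand.le_TS {a : ℕ}
    (h : HasTrivialSummand (fun g => Matrix.piKronecker fun _ : Fin n => (ρ g).val) a) :
    a ≤ TS (tpow (Rep.of (matRep ρ)) n) := by
  rw [TS_tpow_matRep]
  exact le_csSup ⟨_, fun _ hb => HasTrivialSummand.le_card hb⟩ h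

theorem hasTrivialSummand_TS :
    HasTrivialSummand (fun g => Matrix.piKronecker fun _ : Fin n => (ρ g).val)
      (TS (tpow (Rep.of (matRep ρ)) n)) := by
  rw [TS_tpow_matRep]
  exact Nat.sSup_mem
    (s := {a | HasTrivialSummand (fun g => Matrix.piKronecker fun _ : Fin n => (ρ g).val) a})
    ⟨0, hasTrivialSummand_zero _⟩ ⟨_, fun _ hb => HasTrivialSummand.le_card hb⟩

theorem TS_tpow_le : TS (tpow (Rep.of (matRep ρ)) n) ≤ m ^ n := by
  simpa using (hasTrivialSummand_TS ρ n).le_card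

end TrivialSummands

section PowerSums

theorem sum_range_natCast_pow_eq {k : Type*} [Field k] (p : ℕ) [Fact p.Prime] [CharP k p] (j : ℕ) :
    ∑ i ∈ Finset.range p, (i : k) ^ j = ZMod.castHom dvd_rfl k (∑ x : ZMod p, x ^ j) := by
  rw [map_sum]
  refine Finset.sum_nbij (fun i => (i : ZMod p)) (fun _ _ => Finset.mem_univ _) ?_ ?_ ?_
  · intro a ha b hb hab
    exact CharP.natCast_injOn_Iio (ZMod p) p (by simpa using ha) (by simpa using hb) hab
  · intro x _
    exact ⟨x.val, by simpa using ZMod.val_lt x, ZMod.natCast_zmod_val x⟩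
  · intro i _
    simp

theorem sum_range_add_natCast_mul_pow {k : Type*} [Field k] (p : ℕ) [Fact p.Prime] [CharP k p]
    (a b : k) : ∑ i ∈ Finset.range p, (a + i * b) ^ (p - 1) = - b ^ (p - 1) := by
  have hp := (Fact.out : p.Prime).one_lt
  simp_rw [fun i : ℕ => add_comm a (i * b), add_pow, mul_pow]
  rw [Finset.sum_comm, Finset.sum_range_succ, Finset.sum_eq_zero]
  · simp only [Nat.sub_self, pow_zero, mul_one, Nat.choose_self, Nat.cast_one, zero_add,
      ← Finset.sum_mul, sum_range_natCast_pow_eq p]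
    have : ∑ x : ZMod p, x ^ (p - 1) = -1 := by
      have h := FiniteField.sum_pow_units (ZMod p) (p - 1)
      rw [ZMod.card, if_pos dvd_rfl] at h
      rw [← h, ← Finset.sum_erase (f := fun x : ZMod p => x ^ (p - 1)) _
        (zero_pow (Nat.sub_ne_zero_of_lt hp))]
      refine (Finset.sum_nbij (fun x : (ZMod p)ˣ => (x : ZMod p)) ?_ ?_ ?_ ?_).symm
      · simp
      · exact fun x _ y _ h => Units.ext h
      · exact fun x hx => ⟨Units.mk0 x (by simpa using hx), by simp⟩
      · simp
    rw [this]; simp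
  · intro j hj
    have h0 : ∑ x : ZMod p, x ^ j = 0 :=
      FiniteField.sum_pow_lt_card_sub_one (ZMod p) j (by simpa [ZMod.card] using hj)
    simp only [← Finset.sum_mul, sum_range_natCast_pow_eq p, h0, map_zero, zero_mul]

end PowerSums

section KroneckerUpdate

variable {k J J' : Type*} [Field k] {n : ℕ}

theorem Matrix.piKronecker_update (Z : Fin n → Matrix J J' k) (j : Fin n) (A : Matrix J J' k)
    (s : Fin n → J) (t : Fin n → J') :
    Matrix.piKronecker (Function.update Z j A) s t =
      A (s j) (t j) * ∏ i ∈ Finset.univ.erase j, Z i (s i) (t i) := by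
  rw [Matrix.piKronecker_apply, ← Finset.mul_prod_erase _ _ (Finset.mem_univ j),
    Function.update_self]
  congr 1
  exact Finset.prod_congr rfl fun i hi => by
    rw [Function.update_of_ne (Finset.ne_of_mem_erase hi)]

theorem Matrix.piKronecker_update_sub (Z : Fin n → Matrix J J' k) (j : Fin n)
    (A B : Matrix J J' k) :
    Matrix.piKronecker (Function.update Z j (A - B)) =
      Matrix.piKronecker (Function.update Z j A) - Matrix.piKronecker (Function.update Z j B) := by
  ext s t
  simp only [Matrix.sub_apply, Matrix.piKronecker_update, sub_mul]

theorem Matrix.piKronecker_update_sum (Z : Fin n → Matrix J J' k) (j : Fin n) {ι : Type*}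
    (S : Finset ι) (A : ι → Matrix J J' k) :
    Matrix.piKronecker (Function.update Z j (∑ i ∈ S, A i)) =
      ∑ i ∈ S, Matrix.piKronecker (Function.update Z j (A i)) := by
  ext s t
  simp only [Matrix.sum_apply, Matrix.piKronecker_update, Finset.sum_mul]

end KroneckerUpdate

section TraceIdempotent

variable {k : Type*} [Field k] {J : Type*} [Fintype J] [DecidableEq J]

/-- A singular matrix factors through a space of smaller dimension. -/
theorem Matrix.exists_eq_mul_of_mulVec_eq_zero {A : Matrix J J k} {y : J → k} {c : J}
    (hy : y c = 1) (hA : A.mulVec y = 0) :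
    ∃ (B : Matrix J {j // j ≠ c} k) (C : Matrix {j // j ≠ c} J k), A = B * C := by
  refine ⟨A.submatrix id Subtype.val, Matrix.of fun s t => (1 : Matrix J J k) s t -
    if t = c then y s else 0, ?_⟩
  ext a t
  rw [Matrix.mul_apply]
  simp only [Matrix.submatrix_apply, id, Matrix.of_apply]
  have key : ∑ s, A a s * ((1 : Matrix J J k) s t - if t = c then y s else 0) = A a t := by
    simp only [mul_sub, Finset.sum_sub_distrib, ← Matrix.mul_apply, Matrix.mul_one]
    split_ifs
    · have := congrFun hA a
      rw [Matrix.mulVec, dotProduct] at this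
      simp [this]
    · simp
  rw [← key, ← Fintype.sum_subtype_add_sum_subtype (fun s => s ≠ c)]
  refine add_eq_left.2 (Finset.sum_eq_zero fun s _ => ?_)
  rw [of_not_not s.2, hy, Matrix.one_apply]
  simp [eq_comm]

variable (p : ℕ) (X θ : Matrix J J k)

/-- The trace of `θ` under conjugation by a matrix `X` of order `p`. -/
def Matrix.conjTrace : Matrix J J k := ∑ i ∈ Finset.range p, X ^ i * θ * X ^ (p - i)

variable {p X}

theorem Matrix.commute_conjTrace (hX : X ^ p = 1) : Commute X (Matrix.conjTrace p X θ) := by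
  have h1 : X * Matrix.conjTrace p X θ =
      ∑ i ∈ Finset.range p, X ^ (i + 1) * θ * X ^ (p + 1 - (i + 1)) := by
    rw [Matrix.conjTrace, Finset.mul_sum]
    refine Finset.sum_congr rfl fun i _ => ?_
    rw [Nat.add_sub_add_right, pow_succ' X i]
    simp only [Matrix.mul_assoc]
  have h2 : Matrix.conjTrace p X θ * X =
      ∑ i ∈ Finset.range p, X ^ i * θ * X ^ (p + 1 - i) := by
    rw [Matrix.conjTrace, Finset.sum_mul]
    refine Finset.sum_congr rfl fun i hi => ?_
    rw [Nat.sub_add_comm (Finset.mem_range.1 hi).le, pow_succ X (p - i)]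
    simp only [Matrix.mul_assoc]
  have h3 := (Finset.sum_range_succ (fun i => X ^ i * θ * X ^ (p + 1 - i)) p).symm.trans
    (Finset.sum_range_succ' (fun i => X ^ i * θ * X ^ (p + 1 - i)) p)
  rw [← h1, ← h2] at h3
  rw [Nat.add_sub_cancel_left, Nat.sub_zero, pow_zero, pow_succ X p, hX] at h3
  simpa only [Matrix.one_mul, Matrix.mul_one, add_left_inj, commute_iff_eq,
    pow_one] using h3.symm

variable {n : ℕ} {D L : Type*} [Fintype D] [DecidableEq D] [Fintype L]

theorem Matrix.piKronecker_const_pow (A : Matrix J J k) (i : ℕ) :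
    Matrix.piKronecker (fun _ : Fin n => A ^ i) = Matrix.piKronecker (fun _ : Fin n => A) ^ i := by
  induction i with
  | zero => simp only [pow_zero, Matrix.piKronecker_one]
  | succ i ih => simp only [pow_succ, ← ih, Matrix.piKronecker_mul]

/-- If `1 - E` factors through `k^L`, where `E` is a trace for the action of a matrix `X` with
`X ^ p = 1`, then the fixed summands of `X^{⊗ n}` have dimension at most `|L| ^ n`. -/
theorem Matrix.card_le_of_one_sub_conjTrace_eq [CharP k p] (hX : X ^ p = 1) {θ : Matrix J J k}
    {B : Matrix J L k} {C : Matrix L J k} (hBC : 1 - Matrix.conjTrace p X θ = B * C)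
    {i : Matrix (Fin n → J) D k} {r : Matrix D (Fin n → J) k} (hri : r * i = 1)
    (hi : Matrix.piKronecker (fun _ : Fin n => X) * i = i)
    (hr : r * Matrix.piKronecker (fun _ : Fin n => X) = r) :
    Fintype.card D ≤ Fintype.card L ^ n := by
  set E := Matrix.conjTrace p X θ with hE
  have hi' : ∀ a, Matrix.piKronecker (fun _ : Fin n => X ^ a) * i = i := fun a => by
    rw [Matrix.piKronecker_const_pow]
    induction a with
    | zero => rw [pow_zero, Matrix.one_mul]
    | succ a ih => rw [pow_succ, Matrix.mul_assoc, hi, ih]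
  have hr' : ∀ a, r * Matrix.piKronecker (fun _ : Fin n => X ^ a) = r := fun a => by
    rw [Matrix.piKronecker_const_pow]
    induction a with
    | zero => rw [pow_zero, Matrix.mul_one]
    | succ a ih => rw [pow_succ', ← Matrix.mul_assoc, hr, ih]
  have hzero : ∀ (Z : Fin n → Matrix J J k) (j : Fin n), (∀ l, Commute X (Z l)) →
      r * Matrix.piKronecker (Function.update Z j E) * i = 0 := by
    intro Z j hZ
    have hterm : ∀ a ∈ Finset.range p,
        r * Matrix.piKronecker (Function.update Z j (X ^ a * θ * X ^ (p - a))) * i =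
          r * Matrix.piKronecker (Function.update Z j θ) * i := by
      intro a ha
      have hprod : Matrix.piKronecker (Function.update Z j (X ^ a * θ * X ^ (p - a))) =
          Matrix.piKronecker (fun _ : Fin n => X ^ a) * Matrix.piKronecker (Function.update Z j θ) *
            Matrix.piKronecker (fun _ : Fin n => X ^ (p - a)) := by
        rw [Matrix.piKronecker_mul, Matrix.piKronecker_mul]
        congr 1
        funext l
        rcases eq_or_ne l j with rfl | hl
        · simp
        · rw [Function.update_of_ne hl, Function.update_of_ne hl, ((hZ l).pow_left a).eq,
            Matrix.mul_assoc, ← pow_add, Nat.add_sub_cancel' (Finset.mem_range.1 ha).le, hX,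
            Matrix.mul_one]
      rw [hprod, ← Matrix.mul_assoc, ← Matrix.mul_assoc, hr', Matrix.mul_assoc, hi']
    rw [hE, Matrix.conjTrace, Matrix.piKronecker_update_sum, Matrix.mul_sum, Matrix.sum_mul,
      Finset.sum_congr rfl hterm, Finset.sum_const, Finset.card_range, ← Nat.cast_smul_eq_nsmul k,
      CharP.cast_eq_zero, zero_smul]
  have hone : ∀ S : Finset (Fin n),
      r * Matrix.piKronecker (fun j => if j ∈ S then 1 - E else 1) * i = 1 := by
    intro S
    induction S using Finset.induction_on with
    | empty => simp [Matrix.piKronecker_one, hri]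
    | insert j S hj ih =>
      let Z : Fin n → Matrix J J k := fun j => if j ∈ S then 1 - E else 1
      have h1 : (fun l => if l ∈ insert j S then 1 - E else 1) = Function.update Z j (1 - E) := by
        funext l
        rcases eq_or_ne l j with rfl | hl
        · simp
        · simp [hl, Z]
      have h2 : Z = Function.update Z j 1 := (Function.update_eq_self_iff.2 (by simp [Z, hj])).symm
      have h3 : ∀ l, Commute X (Z l) := fun l => by
        simp only [Z]
        split_ifs
        · exact (Commute.one_right X).sub_right (Matrix.commute_conjTrace θ hX)
        · exact Commute.one_right X
      rw [h1, Matrix.piKronecker_update_sub, Matrix.mul_sub, Matrix.sub_mul, ← h2, hzero Z j h3,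
        sub_zero, ih]
  have key := hone Finset.univ
  simp only [Finset.mem_univ, if_true, hBC] at key
  rw [← Matrix.piKronecker_mul (fun _ : Fin n => B) fun _ : Fin n => C,
    ← Matrix.mul_assoc, Matrix.mul_assoc] at key
  calc Fintype.card D = (1 : Matrix D D k).rank := Matrix.rank_one.symm
    _ = _ := by rw [key]
    _ ≤ _ := Matrix.rank_mul_le_left _ _
    _ ≤ _ := Matrix.rank_le_card_width _
    _ = _ := by simp

end TraceIdempotent

section OrderP

variable {k : Type*} [Field k] {m : ℕ}

theorem Matrix.piKronecker_mulVec_prod {ι α β : Type*} [Fintype ι] [DecidableEq ι] [Fintype β]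
    (B : ι → Matrix α β k) (v : ι → β → k) :
    (Matrix.piKronecker B).mulVec (fun t => ∏ i, v i (t i)) =
      fun s => ∏ i, (B i).mulVec (v i) (s i) := by
  ext s
  simp only [Matrix.mulVec, dotProduct, Matrix.piKronecker_apply, ← Finset.prod_mul_distrib,
    Finset.prod_univ_sum, Fintype.piFinset_univ]

/-- For a matrix `u` of order `p`, the trace of a rank one operator under conjugation by
`u^{⊗ (p - 1)}` can be chosen to fix a nonzero vector. -/
theorem Matrix.exists_conjTrace_piKronecker (p : ℕ) [Fact p.Prime] [CharP k p]
    {u : Matrix (Fin m) (Fin m) k} (hu : u ^ p = 1) (hu1 : u ≠ 1) :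
    ∃ (θ : Matrix (Fin (p - 1) → Fin m) (Fin (p - 1) → Fin m) k) (y : (Fin (p - 1) → Fin m) → k)
      (c : Fin (p - 1) → Fin m), y c = 1 ∧
      (1 - Matrix.conjTrace p (Matrix.piKronecker fun _ : Fin (p - 1) => u) θ).mulVec y = 0 := by
  have hp : p.Prime := Fact.out
  -- a Jordan chain of length two
  obtain ⟨v, w, hw, huv, huw⟩ : ∃ v w : Fin m → k, w ≠ 0 ∧ u.mulVec v = v + w ∧ u.mulVec w = w := by
    have hnil : (u - 1) ^ p = 0 := by
      have := Matrix.sub_one_pow_char_pow p u 1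
      rwa [pow_one, hu, sub_self] at this
    have hex : ∃ j, (u - 1) ^ j = 0 := ⟨p, hnil⟩
    classical
    let j := Nat.find hex
    have hj : (u - 1) ^ j = 0 := Nat.find_spec hex
    have hmin : ∀ i < j, (u - 1) ^ i ≠ 0 := fun i hi => Nat.find_min hex hi
    have hu0 : u - 1 ≠ 0 := sub_ne_zero.2 hu1
    have hj0 : j ≠ 0 := fun h => by
      rw [h, pow_zero] at hj
      exact hu0 (by rw [← Matrix.mul_one (u - 1), hj, Matrix.mul_zero])
    have hj1 : j ≠ 1 := fun h => by
      rw [h, pow_one] at hj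
      exact hu0 hj
    obtain ⟨i, hi⟩ : ∃ i, j = i + 2 := ⟨j - 2, by omega⟩
    have h1 : (u - 1) ^ (i + 1) ≠ 0 := hmin _ (by omega)
    obtain ⟨z, hz⟩ : ∃ z, ((u - 1) ^ (i + 1)).mulVec z ≠ 0 := by
      by_contra! h
      exact h1 (Matrix.ext_of_mulVec_single fun a => by rw [h, Matrix.zero_mulVec])
    refine ⟨((u - 1) ^ i).mulVec z, ((u - 1) ^ (i + 1)).mulVec z, hz, ?_, ?_⟩
    · rw [pow_succ', ← Matrix.mulVec_mulVec, Matrix.sub_mulVec, Matrix.one_mulVec]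
      abel
    · have h2 : (u - 1).mulVec (((u - 1) ^ (i + 1)).mulVec z) = 0 := by
        rw [Matrix.mulVec_mulVec, ← pow_succ', ← hi, hj, Matrix.zero_mulVec]
      rwa [Matrix.sub_mulVec, Matrix.one_mulVec, sub_eq_zero] at h2
  have hupow : ∀ i : ℕ, (u ^ i).mulVec v = v + (i : k) • w := by
    intro i
    induction i with
    | zero => simp
    | succ i ih =>
      rw [pow_succ', ← Matrix.mulVec_mulVec, ih, Matrix.mulVec_add, Matrix.mulVec_smul, huv, huw,
        Nat.cast_succ, add_smul, one_smul]
      abel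
  obtain ⟨a, ha⟩ : ∃ a, w a ≠ 0 := Function.ne_iff.1 hw
  set X := Matrix.piKronecker fun _ : Fin (p - 1) => u with hX
  have hXp : X ^ p = 1 := by
    rw [hX, ← Matrix.piKronecker_const_pow, hu, Matrix.piKronecker_one]
  let x : (Fin (p - 1) → Fin m) → k := fun t => ∏ i, v (t i)
  let y : (Fin (p - 1) → Fin m) → k := ∑ i ∈ Finset.range p, (X ^ i).mulVec x
  let c : Fin (p - 1) → Fin m := fun _ => a
  have hXy : ∀ i, (X ^ i).mulVec y = y := by
    have h1 : X.mulVec y = y := by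
      have := (Finset.sum_range_succ (fun i => (X ^ i).mulVec x) p).symm.trans
        (Finset.sum_range_succ' (fun i => (X ^ i).mulVec x) p)
      rw [hXp, pow_zero] at this
      simp only [y, Matrix.mulVec_sum, Matrix.mulVec_mulVec, ← pow_succ']
      exact (add_right_cancel this).symm
    intro i
    induction i with
    | zero => simp
    | succ i ih => rw [pow_succ, ← Matrix.mulVec_mulVec, h1, ih]
  have hyc : y c ≠ 0 := by
    have : y c = - w a ^ (p - 1) := by
      rw [← sum_range_add_natCast_mul_pow p (v a) (w a)]
      simp only [y, Finset.sum_apply]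
      refine Finset.sum_congr rfl fun i _ => ?_
      rw [hX, ← Matrix.piKronecker_const_pow, Matrix.piKronecker_mulVec_prod _ fun _ => v]
      simp [hupow, c]
    rw [this]
    exact neg_ne_zero.2 (pow_ne_zero _ ha)
  refine ⟨Matrix.vecMulVec x (Pi.single c (y c)⁻¹), (y c)⁻¹ • y, c, by simp [hyc], ?_⟩
  rw [Matrix.mulVec_smul, Matrix.sub_mulVec, Matrix.one_mulVec, Matrix.conjTrace, Matrix.sum_mulVec]
  have : ∀ i ∈ Finset.range p,
      (X ^ i * Matrix.vecMulVec x (Pi.single c (y c)⁻¹) * X ^ (p - i)).mulVec y =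
      (X ^ i).mulVec x := by
    intro i _
    rw [← Matrix.mulVec_mulVec, hXy, ← Matrix.mulVec_mulVec, Matrix.vecMulVec_mulVec]
    simp [hyc]
  rw [Finset.sum_congr rfl this, sub_self, smul_zero]

/-- Trivial summands of tensor powers of an element of order `p` have exponentially small
dimension compared to the whole space. -/
theorem HasTrivialSummand.pow_le (p : ℕ) [Fact p.Prime] [CharP k p]
    {u : Matrix (Fin m) (Fin m) k} (hu : u ^ p = 1) (hu1 : u ≠ 1) {n a : ℕ}
    (h : HasTrivialSummand (fun _ : Unit => Matrix.piKronecker fun _ : Fin n => u) a) :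
    a ^ (p - 1) ≤ (m ^ (p - 1) - 1) ^ n := by
  obtain ⟨θ, y, c, hy, hθ⟩ := Matrix.exists_conjTrace_piKronecker p hu hu1
  obtain ⟨B, C, hBC⟩ := Matrix.exists_eq_mul_of_mulVec_eq_zero hy hθ
  obtain ⟨i, r, hri, hir⟩ := h
  obtain ⟨hi, hr⟩ := hir ()
  let e : (Fin n → Fin (p - 1) → Fin m) ≃ (Fin (p - 1) → Fin n → Fin m) := Equiv.piComm _
  let X := Matrix.piKronecker fun _ : Fin (p - 1) => u
  have hX : X ^ p = 1 := by
    simp only [X]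
    rw [← Matrix.piKronecker_const_pow, hu, Matrix.piKronecker_one]
  have hswap : Matrix.piKronecker (fun _ : Fin n => X) =
      (Matrix.piKronecker fun _ : Fin (p - 1) => Matrix.piKronecker fun _ : Fin n => u).submatrix
        e e := by
    ext s t
    simp only [X, Matrix.piKronecker_apply, Matrix.submatrix_apply]
    exact Finset.prod_comm
  have key := Matrix.card_le_of_one_sub_conjTrace_eq (n := n) hX hBC
    (i := (Matrix.piKronecker fun _ : Fin (p - 1) => i).submatrix e id)
    (r := (Matrix.piKronecker fun _ : Fin (p - 1) => r).submatrix id e) ?_ ?_ ?_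
  · simpa [Fintype.card_subtype_compl] using key
  · rw [Matrix.submatrix_mul_equiv, Matrix.piKronecker_mul, hri, Matrix.piKronecker_one,
      Matrix.submatrix_id_id]
  · rw [hswap, Matrix.submatrix_mul_equiv, Matrix.piKronecker_mul, hi]
  · rw [hswap, Matrix.submatrix_mul_equiv, Matrix.piKronecker_mul, hr]

end OrderP

section UnipotentBound

variable {k : Type u} [Field k] {m : ℕ}

attribute [local instance] zariskiTopologyGL

theorem HasTrivialSummand.zariskiClosure {X : Set (Matrix.GeneralLinearGroup (Fin m) k)} {n a : ℕ}
    (h : HasTrivialSummand (fun g : X => Matrix.piKronecker fun _ : Fin n => g.1.val) a) :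
    HasTrivialSummand
      (fun g : zariskiClosure X => Matrix.piKronecker fun _ : Fin n => g.1.val) a := by
  obtain ⟨i, r, hri, hir⟩ := h
  refine ⟨i, r, hri, fun g => ?_⟩
  let P : Matrix (Fin n → Fin m) (Fin n → Fin m) (MvPolynomial (Fin m × Fin m) k) :=
    Matrix.piKronecker fun _ => Matrix.mvPolynomialX (Fin m) (Fin m) k
  have hP : ∀ h : Matrix.GeneralLinearGroup (Fin m) k, (MvPolynomial.eval (entries h)).mapMatrix P =
      Matrix.piKronecker fun _ : Fin n => h.val := fun h => by
    ext s t
    simp [P, Matrix.piKronecker_apply, entries]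
  let i' : Matrix (Fin n → Fin m) (Fin a) (MvPolynomial (Fin m × Fin m) k) := i.map MvPolynomial.C
  let r' : Matrix (Fin a) (Fin n → Fin m) (MvPolynomial (Fin m × Fin m) k) := r.map MvPolynomial.C
  let Q : Matrix (Fin n → Fin m) (Fin a) (MvPolynomial (Fin m × Fin m) k) :=
    P * i' - i'
  let R : Matrix (Fin a) (Fin n → Fin m) (MvPolynomial (Fin m × Fin m) k) :=
    r' * P - r'
  have hQ : ∀ (h : Matrix.GeneralLinearGroup (Fin m) k) (s t),
      MvPolynomial.eval (entries h) (Q s t) =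
      ((Matrix.piKronecker fun _ : Fin n => h.val) * i - i) s t := fun h s t => by
    rw [← hP]
    simp [Q, i', Matrix.mul_apply]
  have hR : ∀ (h : Matrix.GeneralLinearGroup (Fin m) k) (s t),
      MvPolynomial.eval (entries h) (R s t) =
      (r * (Matrix.piKronecker fun _ : Fin n => h.val) - r) s t := fun h s t => by
    rw [← hP]
    simp [R, r', Matrix.mul_apply]
  have hg : g.1 ∈ closure X := zariskiClosure_eq_closure X ▸ g.2
  have aux : ∀ f : MvPolynomial (Fin m × Fin m) k, (∀ h ∈ X, MvPolynomial.eval (entries h) f = 0) →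
      MvPolynomial.eval (entries g.1) f = 0 := fun f hf =>
    closure_minimal hf (isClosed_setOf_eval_entries_eq_zero f) hg
  constructor
  · refine sub_eq_zero.1 (Matrix.ext fun s t => ?_)
    rw [← hQ]
    exact aux _ fun h hh => by rw [hQ, (hir ⟨h, hh⟩).1, sub_self, Matrix.zero_apply]
  · refine sub_eq_zero.1 (Matrix.ext fun s t => ?_)
    rw [← hR]
    exact aux _ fun h hh => by rw [hR, (hir ⟨h, hh⟩).2, sub_self, Matrix.zero_apply]

theorem exists_mem_zariskiClosure_pow_char_eq_one (p : ℕ) [Fact p.Prime] [CharP k p]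
    (K : Subgroup (Matrix.GeneralLinearGroup (Fin m) k)) {u : Matrix.GeneralLinearGroup (Fin m) k}
    (hu : u ∈ zariskiClosure (K : Set (Matrix.GeneralLinearGroup (Fin m) k)))
    (huni : IsUnipotentGL u) (hu1 : u ≠ 1) :
    ∃ v ∈ zariskiClosure (K : Set (Matrix.GeneralLinearGroup (Fin m) k)), v ^ p = 1 ∧ v ≠ 1 := by
  obtain ⟨H, hH⟩ := Subgroup.exists_coe_eq_closure K
  rw [zariskiClosure_eq_closure, ← hH] at hu ⊢
  have hp : p.Prime := Fact.out
  have hex : ∃ e, u ^ p ^ e = 1 := by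
    refine ⟨m, Units.ext ?_⟩
    rw [Units.val_pow_eq_pow_val, Units.val_one, ← sub_eq_zero, ← Matrix.sub_one_pow_char_pow p]
    exact pow_eq_zero_of_le (Nat.lt_pow_self hp.one_lt).le huni
  classical
  have hspec := Nat.find_spec hex
  have h0 : Nat.find hex ≠ 0 := fun h => hu1 (by rwa [h, pow_zero, pow_one] at hspec)
  obtain ⟨e, he⟩ := Nat.exists_eq_succ_of_ne_zero h0
  refine ⟨u ^ p ^ e, H.pow_mem hu _, ?_, Nat.find_min hex (by omega)⟩
  rw [← pow_mul, ← pow_succ, ← Nat.succ_eq_add_one, ← he, hspec]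

variable {G : Type u} [Group G]

theorem dG_le_of_TS_le_pow (V : Rep.{u} k G) {c : ℝ} (hc : 0 ≤ c)
    (h : ∀ n, (TS (tpow V n) : ℝ) ≤ c ^ n) : dG V ≤ c := by
  refine Filter.limsup_le_of_le ?_ ?_
  · exact Filter.IsCoboundedUnder.of_frequently_ge (a := 0)
      (Filter.Frequently.of_forall fun n => Real.rpow_nonneg (Nat.cast_nonneg _) _)
  · filter_upwards [Filter.eventually_ge_atTop 1] with n hn
    calc (TS (tpow V n) : ℝ) ^ ((n : ℝ)⁻¹) ≤ (c ^ n) ^ ((n : ℝ)⁻¹) :=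
          Real.rpow_le_rpow (Nat.cast_nonneg _) (h n) (by positivity)
      _ = c := Real.pow_rpow_inv_natCast hc (by omega)

theorem dG_lt_of_isUnipotentGL (p : ℕ) [Fact p.Prime] [CharP k p]
    (ρ : G →* Matrix.GeneralLinearGroup (Fin m) k) {u : Matrix.GeneralLinearGroup (Fin m) k}
    (hu : u ∈ zariskiClosure (Set.range fun g : G => ρ g)) (huni : IsUnipotentGL u) (hu1 : u ≠ 1) :
    dG (Rep.of (matRep ρ)) < m := by
  have hp : p.Prime := Fact.out
  have hp1 : p - 1 ≠ 0 := Nat.sub_ne_zero_of_lt hp.one_lt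
  have hm : m ≠ 0 := by
    rintro rfl
    exact hu1 (Units.ext (Subsingleton.elim _ _))
  have hrange : (Set.range fun g : G => ρ g) = ρ.range := rfl
  rw [hrange] at hu
  obtain ⟨v, hv, hvp, hv1⟩ := exists_mem_zariskiClosure_pow_char_eq_one p ρ.range hu huni hu1
  set M : ℕ := m ^ (p - 1) - 1 with hM
  have hle : ∀ n, TS (tpow (Rep.of (matRep ρ)) n) ^ (p - 1) ≤ M ^ n := fun n => by
    obtain ⟨i, r, hri, hir⟩ := hasTrivialSummand_TS ρ n
    have h1 : HasTrivialSummand (fun g : (ρ.range : Set (Matrix.GeneralLinearGroup (Fin m) k)) =>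
        Matrix.piKronecker fun _ : Fin n => g.1.val) (TS (tpow (Rep.of (matRep ρ)) n)) :=
      ⟨i, r, hri, by rintro ⟨_, g, rfl⟩; exact hir g⟩
    obtain ⟨i, r, hri, hir⟩ := h1.zariskiClosure
    refine HasTrivialSummand.pow_le p (u := v.val) ?_ ?_ ⟨i, r, hri, fun _ => hir ⟨v, hv⟩⟩
    · rw [← Units.val_pow_eq_pow_val, hvp, Units.val_one]
    · exact fun h => hv1 (Units.ext h)
  have hMlt : (M : ℝ) < (m : ℝ) ^ (p - 1) := by
    have : 0 < m ^ (p - 1) := by positivity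
    exact_mod_cast (by omega : M < m ^ (p - 1))
  calc dG (Rep.of (matRep ρ)) ≤ (M : ℝ) ^ (((p - 1 : ℕ) : ℝ)⁻¹) := by
        refine dG_le_of_TS_le_pow _ (by positivity) fun n => ?_
        refine le_of_pow_le_pow_left₀ hp1 (by positivity) ?_
        rw [pow_right_comm, Real.rpow_inv_natCast_pow (by positivity) hp1]
        exact_mod_cast hle n
    _ < ((m : ℝ) ^ (p - 1)) ^ (((p - 1 : ℕ) : ℝ)⁻¹) :=
        Real.rpow_lt_rpow (by positivity) hMlt (by positivity)
    _ = m := Real.pow_rpow_inv_natCast (by positivity) hp1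

end UnipotentBound

section CountingRelations

theorem exists_addMonoidHom_rat_apply_ne_zero {A : Type*} [AddCommGroup A] {a : A}
    (ha : ∀ n : ℕ, 0 < n → n • a ≠ 0) : ∃ φ : A →+ ℚ, φ a ≠ 0 := by
  have hinj : Function.Injective (zmultiplesHom A a) := by
    rw [injective_iff_map_eq_zero]
    intro z hz
    rw [zmultiplesHom_apply] at hz
    by_contra h0
    refine ha z.natAbs (Int.natAbs_pos.2 h0) ?_
    rcases Int.natAbs_eq z with h | h
    · rw [h, natCast_zsmul] at hz
      exact hz
    · rw [h, neg_smul, natCast_zsmul, neg_eq_zero] at hz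
      exact hz
  obtain ⟨φ, hφ⟩ := (Module.Baer.of_divisible ℚ).extension_property_addMonoidHom _ hinj
    (Int.castAddHom ℚ)
  refine ⟨φ, ?_⟩
  have := DFunLike.congr_fun hφ 1
  simp only [AddMonoidHom.comp_apply, zmultiplesHom_apply, one_zsmul] at this
  simp [this]

theorem exists_sum_exp_lt_card {ι : Type*} [Fintype ι] {φ : ι → ℝ} (hφ : ∑ i, φ i ≠ 0) :
    ∃ x : ℝ, ∑ i, Real.exp (x * φ i) < Fintype.card ι := by
  by_contra! h
  have hmin : IsLocalMin (fun x : ℝ => ∑ i, Real.exp (x * φ i)) 0 :=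
    Filter.Eventually.of_forall fun x => by simpa using h x
  have hderiv : HasDerivAt (fun x : ℝ => ∑ i, Real.exp (x * φ i)) (∑ i, φ i) 0 := by
    refine HasDerivAt.fun_sum fun i _ => ?_
    simpa using ((hasDerivAt_id (0 : ℝ)).mul_const (φ i)).exp
  exact hφ (hmin.hasDerivAt_eq_zero hderiv)

/-- If a product of elements of a commutative group has infinite order, then the words in these
elements which evaluate to `1` are exponentially rare. -/
theorem exists_ncard_prod_eq_one_le_pow {A ι : Type*} [CommGroup A] [Fintype ι] (χ : ι → A)
    (hχ : ∀ n : ℕ, 0 < n → (∏ i, χ i) ^ n ≠ 1) :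
    ∃ c : ℝ, 0 ≤ c ∧ c < Fintype.card ι ∧
      ∀ n : ℕ, ({s : Fin n → ι | ∏ i, χ (s i) = 1}.ncard : ℝ) ≤ c ^ n := by
  obtain ⟨φ, hφ⟩ := exists_addMonoidHom_rat_apply_ne_zero (a := Additive.ofMul (∏ i, χ i)) hχ
  let ψ : ι → ℝ := fun i => ((φ (Additive.ofMul (χ i)) : ℚ) : ℝ)
  have hψ : ∑ i, ψ i ≠ 0 := by
    simp only [ψ]
    rw [ofMul_prod, map_sum] at hφ
    exact_mod_cast hφ
  obtain ⟨x, hx⟩ := exists_sum_exp_lt_card hψ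
  refine ⟨_, Finset.sum_nonneg fun i _ => (Real.exp_pos _).le, hx, fun n => ?_⟩
  classical
  have hexp : ∀ s : Fin n → ι, ∏ i, χ (s i) = 1 → ∏ i, Real.exp (x * ψ (s i)) = 1 := by
    intro s hs
    have h1 : ∑ i, ψ (s i) = 0 := by
      have := congrArg (fun a => φ (Additive.ofMul a)) hs
      simp only [ofMul_prod, map_sum, ofMul_one, map_zero] at this
      simp only [ψ]
      exact_mod_cast this
    rw [← Real.exp_sum, ← Finset.mul_sum, h1, mul_zero, Real.exp_zero]
  rw [Fintype.sum_pow, Set.ncard_eq_toFinset_card', Finset.cast_card]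
  calc ∑ s ∈ {s : Fin n → ι | ∏ i, χ (s i) = 1}.toFinset, (1 : ℝ)
      = ∑ s ∈ {s : Fin n → ι | ∏ i, χ (s i) = 1}.toFinset, ∏ i, Real.exp (x * ψ (s i)) :=
        Finset.sum_congr rfl fun s hs => (hexp s (by simpa using hs)).symm
    _ ≤ ∑ s : Fin n → ι, ∏ i, Real.exp (x * ψ (s i)) :=
        Finset.sum_le_univ_sum_of_nonneg fun s => Finset.prod_nonneg fun i _ => (Real.exp_pos _).le

end CountingRelations

section DiagonalizableBound

variable {k : Type*} [Field k] {m : ℕ}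

theorem Matrix.piKronecker_diagonal {n : ℕ} (d : Fin m → k) :
    Matrix.piKronecker (fun _ : Fin n => Matrix.diagonal d) =
      Matrix.diagonal fun s : Fin n → Fin m => ∏ i, d (s i) := by
  ext s t
  simp only [Matrix.piKronecker_apply, Matrix.diagonal_apply, Finset.prod_ite_zero, funext_iff,
    Finset.mem_univ, true_imp_iff]

theorem Matrix.exists_eq_diagonal_units {g : Matrix.GeneralLinearGroup (Fin m) k}
    (hg : g.val.IsDiag) : ∃ d : Fin m → kˣ, g.val = Matrix.diagonal fun i => (d i : k) := by
  have h0 : ∏ i, g.val i i ≠ 0 := by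
    have h1 := Matrix.det_diagonal (d := Matrix.diag g.val)
    rw [Matrix.IsDiag.diagonal_diag hg] at h1
    simp only [Matrix.diag_apply] at h1
    rw [← h1]
    exact ((Matrix.isUnit_iff_isUnit_det _).1 g.isUnit).ne_zero
  exact ⟨fun i => Units.mk0 (g.val i i) (Finset.prod_ne_zero_iff.1 h0 i (Finset.mem_univ i)),
    (Matrix.IsDiag.diagonal_diag hg).symm⟩

/-- The fixed summands of the tensor power of a diagonalizable matrix are bounded by the
multiplicity of the eigenvalue `1`. -/
theorem HasTrivialSummand.le_ncard {h P : Matrix.GeneralLinearGroup (Fin m) k} {d : Fin m → kˣ}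
    (hd : (P⁻¹ * h * P).val = Matrix.diagonal fun i => (d i : k)) {n a : ℕ}
    (H : HasTrivialSummand (fun _ : Unit => Matrix.piKronecker fun _ : Fin n => h.val) a) :
    a ≤ {s : Fin n → Fin m | ∏ i, d (s i) = 1}.ncard := by
  obtain ⟨i, r, hri, hir⟩ := H
  classical
  let Q := Matrix.piKronecker fun _ : Fin n => P.val
  let Q' := Matrix.piKronecker fun _ : Fin n => (P⁻¹).val
  have hQQ' : Q * Q' = 1 := by
    simp only [Q, Q', Matrix.piKronecker_mul, ← Units.val_mul, mul_inv_cancel, Units.val_one,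
      Matrix.piKronecker_one]
  have hQQ'' : Q' * Q = 1 := by
    simp only [Q, Q', Matrix.piKronecker_mul, ← Units.val_mul, inv_mul_cancel, Units.val_one,
      Matrix.piKronecker_one]
  let D := Matrix.piKronecker fun _ : Fin n => (P⁻¹ * h * P).val
  have hD : D * Q' = Q' * Matrix.piKronecker fun _ : Fin n => h.val := by
    simp only [D, Q', Matrix.piKronecker_mul, ← Units.val_mul, mul_assoc, mul_inv_cancel, mul_one]
  have hfix : D * (Q' * i) = Q' * i := by
    rw [← Matrix.mul_assoc, hD, Matrix.mul_assoc, (hir ()).1]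
  have hsupp : ∀ s, ∏ j, d (s j) ≠ 1 → ∀ b, (Q' * i) s b = 0 := by
    intro s hs b
    have h1 := congrFun (congrFun hfix s) b
    simp only [D, hd, Matrix.piKronecker_diagonal] at h1
    rw [Matrix.diagonal_mul] at h1
    by_contra h0
    refine hs (Units.ext ?_)
    rw [Units.coe_prod, Units.val_one]
    exact (mul_eq_right₀ h0).1 h1
  let S := {s : Fin n → Fin m // ∏ j, d (s j) = 1}
  have hfac : r * i = (r * Q).submatrix id (Subtype.val : S → _) *
      (Q' * i).submatrix (Subtype.val : S → _) id := by
    have h1 : r * i = r * Q * (Q' * i) := by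
      rw [Matrix.mul_assoc, ← Matrix.mul_assoc Q, hQQ', Matrix.one_mul]
    rw [h1]
    ext b c
    simp only [Matrix.mul_apply (M := r * Q), Matrix.mul_apply (M := (r * Q).submatrix _ _),
      Matrix.submatrix_apply, id]
    rw [← Fintype.sum_subtype_add_sum_subtype (fun s : Fin n → Fin m => ∏ j, d (s j) = 1)]
    exact add_eq_left.2 (Finset.sum_eq_zero fun s _ => by rw [hsupp _ s.2, mul_zero])
  calc a = (1 : Matrix (Fin a) (Fin a) k).rank := by rw [Matrix.rank_one, Fintype.card_fin]
    _ = _ := by rw [← hri, hfac]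
    _ ≤ _ := Matrix.rank_mul_le_left _ _
    _ ≤ Fintype.card S := Matrix.rank_le_card_width _
    _ = _ := by
      rw [← Nat.card_eq_fintype_card]
      exact Nat.card_coe_set_eq _

end DiagonalizableBound

section DeterminantBound

theorem dG_lt_of_infinite_range_det {k G : Type u} [Field k] [IsAlgClosed k] [Group G] (p : ℕ)
    [Fact p.Prime] [CharP k p] {m : ℕ} (ρ : G →* Matrix.GeneralLinearGroup (Fin m) k)
    (hdet : (Set.range fun g : G => Matrix.det (ρ g).val).Infinite) :
    dG (Rep.of (matRep ρ)) < m := by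
  have hp : p.Prime := Fact.out
  let x : ℕ → k := fun j => (hdet.natEmbedding _ j : k)
  have hx : Function.Injective x := Subtype.val_injective.comp (hdet.natEmbedding _).injective
  choose g hg using fun j => (hdet.natEmbedding _ j).2
  have hgx : ∀ j, Matrix.det (ρ (g j)).val = x j := hg
  have hdiag : ∀ j, ∃ (P : Matrix.GeneralLinearGroup (Fin m) k) (d : Fin m → kˣ),
      (P⁻¹ * ρ (g j) ^ p ^ m * P).val = Matrix.diagonal fun i => (d i : k) := by
    intro j
    obtain ⟨P, hP⟩ := Matrix.exists_conj_pow_isDiag p m (Nat.lt_pow_self hp.one_lt).le {ρ (g j)}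
      (by simp)
    obtain ⟨d, hd⟩ := Matrix.exists_eq_diagonal_units (hP _ rfl)
    exact ⟨P, d, hd⟩
  choose P d hd using hdiag
  have hprod : ∀ j, ((∏ i, d j i : kˣ) : k) = x j ^ p ^ m := by
    intro j
    have := congrArg Matrix.det (hd j)
    rw [Matrix.det_diagonal, Units.val_mul, Units.val_mul, Matrix.det_mul, Matrix.det_mul,
      mul_right_comm, ← Matrix.det_mul, ← Units.val_mul, inv_mul_cancel, Units.val_one,
      Matrix.det_one, one_mul, Units.val_pow_eq_pow_val, Matrix.det_pow, hgx] at this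
    rw [this, Units.coe_prod]
  let l : Filter ℕ := Filter.hyperfilter ℕ
  let χ : Fin m → Filter.Germ l kˣ := fun i => ((fun j => d j i : ℕ → kˣ) : Filter.Germ l kˣ)
  have hword : ∀ {ι : Type} (s : Finset ι) (w : ι → Fin m),
      ∏ i ∈ s, χ (w i) = ((fun j => ∏ i ∈ s, d j (w i) : ℕ → kˣ) : Filter.Germ l kˣ) := by
    intro ι s w
    have h1 : (fun j => ∏ i ∈ s, d j (w i) : ℕ → kˣ) = ∏ i ∈ s, fun j => d j (w i) := by
      ext j; simp
    rw [h1]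
    exact (map_prod (Filter.Germ.coeMulHom l : (ℕ → kˣ) →* Filter.Germ l kˣ) _ _).symm
  have hone : ∀ f : ℕ → kˣ, (f : Filter.Germ l kˣ) = 1 ↔ ∀ᶠ j in l, f j = 1 := fun f =>
    Filter.Germ.coe_eq
  obtain ⟨c, hc0, hc, hcount⟩ := exists_ncard_prod_eq_one_le_pow χ (by
    intro n hn h1
    have h2 := hword Finset.univ id
    simp only [id] at h2
    rw [h2, ← Filter.Germ.coe_pow, hone] at h1
    have hinf : {j | (∏ i, d j i) ^ n = 1}.Infinite := fun hfin =>
      Filter.notMem_hyperfilter_of_finite hfin h1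
    refine (hinf.image hx.injOn)
      ((Polynomial.nthRootsFinset (p ^ m * n) (1 : k)).finite_toSet.subset ?_)
    rintro _ ⟨j, hj, rfl⟩
    have hj' := congrArg (fun y : kˣ => (y : k)) (show (∏ i, d j i) ^ n = 1 from hj)
    simp only [Units.val_pow_eq_pow_val, hprod, ← pow_mul, Units.val_one] at hj'
    exact (Polynomial.mem_nthRootsFinset (mul_pos (pow_pos hp.pos m) hn) 1).2 hj')
  rw [Fintype.card_fin] at hc
  refine (dG_le_of_TS_le_pow _ hc0 fun n => ?_).trans_lt hc
  refine le_trans ?_ (hcount n)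
  have hev : ∀ᶠ j in l, ∀ s : Fin n → Fin m, ∏ i, d j (s i) = 1 → ∏ i, χ (s i) = 1 := by
    refine Filter.eventually_all.2 fun s => ?_
    by_cases hs : ∏ i, χ (s i) = 1
    · exact Filter.Eventually.of_forall fun _ _ => hs
    · have h1 := hs
      rw [hword, hone] at h1
      exact (Ultrafilter.eventually_not.2 h1).mono fun j hj hj' => (hj hj').elim
  obtain ⟨j, hj⟩ := hev.exists
  obtain ⟨i, r, hri, hir⟩ := hasTrivialSummand_TS ρ n
  have hTS := HasTrivialSummand.le_ncard (hd j) (n := n) ⟨i, r, hri, fun _ => by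
    rw [← map_pow]
    exact hir (g j ^ p ^ m)⟩
  exact_mod_cast hTS.trans (Set.ncard_le_ncard (fun s hs => hj s hs) (Set.toFinite _))

end DeterminantBound

section Averaging

theorem Subgroup.sum_quotient_out_mul {G A : Type*} [Group G] [AddCommMonoid A] (K : Subgroup G)
    [Fintype (G ⧸ K)] (f : G → A) (hf : ∀ g, ∀ κ ∈ K, f (g * κ) = f g) (h : G) :
    ∑ x : G ⧸ K, f (h * x.out) = ∑ x : G ⧸ K, f x.out := by
  rw [← Equiv.sum_comp (MulAction.toPerm h) fun x : G ⧸ K => f x.out]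
  refine Finset.sum_congr rfl fun x _ => ?_
  have h1 : (((h * x.out : G)) : G ⧸ K) = h • x := by
    conv_rhs => rw [← QuotientGroup.out_eq' x]
    rfl
  have h2 : (h * x.out)⁻¹ * (h • x).out ∈ K := by
    rw [← QuotientGroup.eq, h1, QuotientGroup.out_eq']
  rw [MulAction.toPerm_apply, ← hf (h * x.out) _ h2, mul_inv_cancel_left]

end Averaging

section Invariants

variable {k G : Type*} [Field k] [Group G] {m : ℕ} (ρ : G →* Matrix.GeneralLinearGroup (Fin m) k)

/-- The matrix of `g` acting on the `n`-th tensor power of a matrix representation. -/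
def tensorPowMatrix (n : ℕ) (g : G) : Matrix (Fin n → Fin m) (Fin n → Fin m) k :=
  Matrix.piKronecker fun _ : Fin n => (ρ g).val

theorem tensorPowMatrix_apply (n : ℕ) (g : G) (s t : Fin n → Fin m) :
    tensorPowMatrix ρ n g s t = ∏ i, (ρ g).val (s i) (t i) := rfl

theorem tensorPowMatrix_mul (n : ℕ) (g h : G) :
    tensorPowMatrix ρ n (g * h) = tensorPowMatrix ρ n g * tensorPowMatrix ρ n h := by
  simp only [tensorPowMatrix, Matrix.piKronecker_mul, map_mul, Units.val_mul]

theorem tensorPowMatrix_one (n : ℕ) : tensorPowMatrix ρ n 1 = 1 := by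
  simp only [tensorPowMatrix, map_one, Units.val_one, Matrix.piKronecker_one]

theorem tensorPowMatrix_append {a b : ℕ} (g : G) (s t : Fin a → Fin m) (s' t' : Fin b → Fin m) :
    tensorPowMatrix ρ (a + b) g (Fin.append s s') (Fin.append t t') =
      tensorPowMatrix ρ a g s t * tensorPowMatrix ρ b g s' t' := by
  simp only [tensorPowMatrix_apply, Fin.prod_univ_add, Fin.append_left, Fin.append_right]

/-- The invariant vectors in the `n`-th tensor power. -/
def tensorInvariants (n : ℕ) : Submodule k ((Fin n → Fin m) → k) where
  carrier := {w | ∀ g, (tensorPowMatrix ρ n g).mulVec w = w}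
  add_mem' := fun ha hb g => by rw [Matrix.mulVec_add, ha g, hb g]
  zero_mem' := fun g => Matrix.mulVec_zero _
  smul_mem' := fun c _ hx g => by rw [Matrix.mulVec_smul, hx g]

/-- The invariant linear functionals on the `n`-th tensor power. -/
def tensorCoinvariants (n : ℕ) : Submodule k ((Fin n → Fin m) → k) where
  carrier := {w | ∀ g, Matrix.vecMul w (tensorPowMatrix ρ n g) = w}
  add_mem' := fun ha hb g => by rw [Matrix.add_vecMul, ha g, hb g]
  zero_mem' := fun g => Matrix.zero_vecMul _
  smul_mem' := fun c _ hx g => by rw [Matrix.smul_vecMul, hx g]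

/-- If an invariant functional can be found which is nonzero on any given nonzero invariant, then
all invariants lie in a trivial direct summand. -/
theorem hasTrivialSummand_finrank_tensorInvariants (n : ℕ)
    (h : ∀ w ∈ tensorInvariants ρ n, w ≠ 0 → ∃ l ∈ tensorCoinvariants ρ n, dotProduct l w ≠ 0) :
    HasTrivialSummand (tensorPowMatrix ρ n) (Module.finrank k (tensorInvariants ρ n)) := by
  let W := tensorInvariants ρ n
  let pairing : tensorCoinvariants ρ n →ₗ[k] Module.Dual k W :=
    ((dotProductBilin k k).domRestrict₁₂ (tensorCoinvariants ρ n) W)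
  have hsurj : LinearMap.range pairing = ⊤ := by
    rw [← Subspace.dualCoannihilator_dualAnnihilator_eq (W := LinearMap.range pairing)]
    have : (LinearMap.range pairing).dualCoannihilator = ⊥ := by
      rw [eq_bot_iff]
      intro w hw
      rw [Submodule.mem_dualCoannihilator] at hw
      by_contra h0
      obtain ⟨l, hl, hlw⟩ := h w.1 w.2 fun h1 => h0 (by simpa using h1)
      exact hlw (hw _ ⟨⟨l, hl⟩, rfl⟩)
    rw [this, Submodule.dualAnnihilator_bot]
  let b := Module.finBasis k W
  have hdual : ∀ j, ∃ l : tensorCoinvariants ρ n, pairing l = b.coord j := fun j =>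
    LinearMap.range_eq_top.1 hsurj _
  choose l hl using hdual
  refine ⟨Matrix.of fun s j => (b j).1 s, Matrix.of fun j s => (l j).1 s, ?_, fun g => ⟨?_, ?_⟩⟩
  · ext j j'
    have := DFunLike.congr_fun (hl j) (b j')
    rw [Module.Basis.coord_apply, Module.Basis.repr_self, Finsupp.single_apply] at this
    refine Eq.trans (this : _ = _) ?_
    simp only [Matrix.one_apply, eq_comm]
  · ext s j
    exact congrFun ((b j).2 g) s
  · ext j s
    exact congrFun ((l j).2 g) s

variable (N : Subgroup G)

/-- The words of weight zero for a diagonal subgroup. -/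
def zeroWeightWords (n : ℕ) : Set (Fin n → Fin m) :=
  {t | ∀ g ∈ N, ∏ i, (ρ g).val (t i) (t i) = 1}

variable {ρ N}

theorem tensorPowMatrix_eq_diagonal (hN : ∀ g ∈ N, (ρ g).val.IsDiag) {n : ℕ} {g : G} (hg : g ∈ N) :
    tensorPowMatrix ρ n g = Matrix.diagonal fun t => ∏ i, (ρ g).val (t i) (t i) := by
  ext s t
  rw [tensorPowMatrix_apply, Matrix.diagonal_apply]
  split_ifs with hst
  · rw [hst]
  · obtain ⟨i, hi⟩ := Function.ne_iff.1 hst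
    exact Finset.prod_eq_zero (Finset.mem_univ i) (hN g hg hi)

/-- If a subgroup of finite index prime to the characteristic acts diagonally, then the invariants
form a trivial direct summand. -/
theorem hasTrivialSummand_of_isDiag (p : ℕ) [CharP k p] (hN : ∀ g ∈ N, (ρ g).val.IsDiag)
    [N.FiniteIndex] (hp : ¬ p ∣ N.index) (n : ℕ) :
    HasTrivialSummand (tensorPowMatrix ρ n) (Module.finrank k (tensorInvariants ρ n)) := by
  refine hasTrivialSummand_finrank_tensorInvariants ρ n fun w hw hw0 => ?_
  obtain ⟨s, hs⟩ := Function.ne_iff.1 hw0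
  have hsZ : s ∈ zeroWeightWords ρ N n := by
    intro g hg
    have h1 := congrFun (hw g) s
    rw [tensorPowMatrix_eq_diagonal hN hg, Matrix.mulVec_diagonal] at h1
    exact (mul_eq_right₀ hs).1 h1
  let : Fintype (G ⧸ N) := N.fintypeQuotientOfFiniteIndex
  let f : G → (Fin n → Fin m) → k := fun g => tensorPowMatrix ρ n g⁻¹ s
  have hf : ∀ g, ∀ κ ∈ N, f (g * κ) = f g := by
    intro g κ hκ
    funext t
    simp only [f, mul_inv_rev, tensorPowMatrix_mul]
    rw [tensorPowMatrix_eq_diagonal hN (N.inv_mem hκ), Matrix.diagonal_mul, hsZ _ (N.inv_mem hκ),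
      one_mul]
  have hfg : ∀ g h, Matrix.vecMul (f g) (tensorPowMatrix ρ n h) = f (h⁻¹ * g) := by
    intro g h
    funext t
    simp only [f, mul_inv_rev, inv_inv, tensorPowMatrix_mul]
    rfl
  refine ⟨∑ x : G ⧸ N, f x.out, fun h => ?_, ?_⟩
  · rw [Matrix.sum_vecMul]
    simp only [hfg]
    exact N.sum_quotient_out_mul f hf h⁻¹
  · have h1 : ∀ g, dotProduct (f g) w = w s := fun g => congrFun (hw g⁻¹) s
    rw [sum_dotProduct]
    simp only [h1, Finset.sum_const, Finset.card_univ, nsmul_eq_mul]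
    refine mul_ne_zero ?_ hs
    rw [← Nat.card_eq_fintype_card, Ne, CharP.cast_eq_zero_iff k p]
    exact hp

end Invariants

section MatrixCoefficients

variable {k G : Type*} [Field k] [Group G] {m : ℕ} {ρ : G →* Matrix.GeneralLinearGroup (Fin m) k}
  {N : Subgroup G}

theorem append_mem_zeroWeightWords {a b : ℕ} {t : Fin a → Fin m} {t' : Fin b → Fin m}
    (ht : t ∈ zeroWeightWords ρ N a) (ht' : t' ∈ zeroWeightWords ρ N b) :
    Fin.append t t' ∈ zeroWeightWords ρ N (a + b) := fun g hg => by
  simp only [Fin.prod_univ_add, Fin.append_left, Fin.append_right, ht g hg, ht' g hg, one_mul]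

variable (ρ N) in
/-- The span of the matrix coefficients of degree `n` belonging to columns of weight zero. -/
def zeroWeightCoefficients (n : ℕ) : Submodule k (G → k) :=
  Submodule.span k (Set.range fun (st : (Fin n → Fin m) × zeroWeightWords ρ N n) g =>
    tensorPowMatrix ρ n g st.1 st.2)

theorem coefficient_mem_zeroWeightCoefficients {n : ℕ} (s : Fin n → Fin m) {t : Fin n → Fin m}
    (ht : t ∈ zeroWeightWords ρ N n) :
    (fun g => tensorPowMatrix ρ n g s t) ∈ zeroWeightCoefficients ρ N n :=
  Submodule.subset_span ⟨(s, ⟨t, ht⟩), rfl⟩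

theorem mul_mem_zeroWeightCoefficients {a b : ℕ} {f h : G → k}
    (hf : f ∈ zeroWeightCoefficients ρ N a) (hh : h ∈ zeroWeightCoefficients ρ N b) :
    f * h ∈ zeroWeightCoefficients ρ N (a + b) := by
  have h1 : f * h ∈ zeroWeightCoefficients ρ N a * zeroWeightCoefficients ρ N b :=
    Submodule.mul_mem_mul hf hh
  rw [zeroWeightCoefficients, zeroWeightCoefficients, Submodule.span_mul_span] at h1
  refine Submodule.span_le.2 ?_ h1
  rintro _ ⟨_, ⟨⟨s, t⟩, rfl⟩, _, ⟨⟨s', t'⟩, rfl⟩, rfl⟩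
  have h2 := coefficient_mem_zeroWeightCoefficients (Fin.append s s')
    (append_mem_zeroWeightWords t.2 t'.2)
  simp only [tensorPowMatrix_append] at h2
  exact h2

theorem one_mem_zeroWeightCoefficients_mul {M : ℕ} (h : 1 ∈ zeroWeightCoefficients ρ N M)
    (j : ℕ) : 1 ∈ zeroWeightCoefficients ρ N (M * j) := by
  induction j with
  | zero =>
    exact coefficient_mem_zeroWeightCoefficients (N := N) (ρ := ρ) (n := 0) Fin.elim0
      (t := Fin.elim0) fun _ _ => Fin.prod_univ_zero _
  | succ j ih =>
    rw [mul_add_one, ← one_mul 1]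
    exact mul_mem_zeroWeightCoefficients ih h

/-- A power of the determinant is a combination of coefficients of weight zero as soon as it is
trivial on the diagonal subgroup. -/
theorem det_pow_mem_zeroWeightCoefficients (hN : ∀ g ∈ N, (ρ g).val.IsDiag) (q : ℕ)
    (hdet : ∀ g ∈ N, (ρ g).val.det ^ q = 1) :
    (fun g => (ρ g).val.det ^ q) ∈ zeroWeightCoefficients ρ N (q * m) := by
  let t : Fin (q * m) → Fin m := fun i => (finProdFinEquiv.symm i).2
  have ht : t ∈ zeroWeightWords ρ N (q * m) := by
    intro g hg
    rw [← hdet g hg, ← finProdFinEquiv.prod_comp, Fintype.prod_prod_type]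
    simp only [t, Equiv.symm_apply_apply, Finset.prod_const, Finset.card_univ, Fintype.card_fin]
    rw [← Matrix.det_diagonal]
    congr 2
    exact (hN g hg).diagonal_diag
  have h1 : (fun g => (ρ g).val.det ^ q) = ∑ f : Fin q → Equiv.Perm (Fin m),
      (∏ a, ((Equiv.Perm.sign (f a) : ℤ) : k)) • fun g => tensorPowMatrix ρ (q * m) g
        (fun i => f (finProdFinEquiv.symm i).1 (finProdFinEquiv.symm i).2) t := by
    funext g
    calc (ρ g).val.det ^ q = ∏ _a : Fin q, ∑ σ : Equiv.Perm (Fin m),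
          ((Equiv.Perm.sign σ : ℤ) : k) * ∏ i, (ρ g).val (σ i) i := by
          rw [Finset.prod_const, Finset.card_univ, Fintype.card_fin, Matrix.det_apply']
      _ = _ := by
          rw [Finset.prod_univ_sum, Fintype.piFinset_univ, Finset.sum_apply]
          refine Finset.sum_congr rfl fun f _ => ?_
          rw [Finset.prod_mul_distrib, Pi.smul_apply, smul_eq_mul, tensorPowMatrix_apply,
            ← finProdFinEquiv.prod_comp, Fintype.prod_prod_type]
          simp only [t, Equiv.symm_apply_apply]
  rw [h1]
  exact Submodule.sum_mem _ fun f _ => Submodule.smul_mem _ _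
    (coefficient_mem_zeroWeightCoefficients _ ht)

variable (ρ N) in
/-- The elements fixing all basis tensors of weight zero whose degree is a multiple of `M`. -/
def zeroWeightFixer (M : ℕ) : Subgroup G where
  carrier := {g | ∀ j, ∀ t ∈ zeroWeightWords ρ N (M * j),
    (tensorPowMatrix ρ (M * j) g).col t = Pi.single t 1}
  mul_mem' := fun {a b} ha hb j t ht => by
    rw [← Matrix.mulVec_single_one, tensorPowMatrix_mul, ← Matrix.mulVec_mulVec,
      Matrix.mulVec_single_one, hb j t ht, Matrix.mulVec_single_one, ha j t ht]
  one_mem' := fun j t _ => by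
    rw [← Matrix.mulVec_single_one, tensorPowMatrix_one, Matrix.one_mulVec]
  inv_mem' := fun {a} ha j t ht => by
    have h1 := ha j t ht
    rw [← Matrix.mulVec_single_one] at h1 ⊢
    conv_lhs => rw [← h1]
    rw [Matrix.mulVec_mulVec, ← tensorPowMatrix_mul, inv_mul_cancel, tensorPowMatrix_one,
      Matrix.one_mulVec]

theorem le_zeroWeightFixer (hN : ∀ g ∈ N, (ρ g).val.IsDiag) (M : ℕ) :
    N ≤ zeroWeightFixer ρ N M := fun g hg j t ht => by
  rw [← Matrix.mulVec_single_one, tensorPowMatrix_eq_diagonal hN hg]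
  ext s
  rw [Matrix.mulVec_diagonal]
  rcases eq_or_ne s t with rfl | hst
  · rw [ht g hg, one_mul]
  · rw [Pi.single_eq_of_ne hst, mul_zero]

theorem tensorPowMatrix_mul_fixer {M j : ℕ} {κ : G} (hκ : κ ∈ zeroWeightFixer ρ N M)
    (s : Fin (M * j) → Fin m) {t : Fin (M * j) → Fin m} (ht : t ∈ zeroWeightWords ρ N (M * j))
    (g : G) : tensorPowMatrix ρ (M * j) (g * κ) s t = tensorPowMatrix ρ (M * j) g s t := by
  have h1 := hκ j t ht
  rw [← Matrix.mulVec_single_one] at h1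
  change (tensorPowMatrix ρ (M * j) (g * κ)).col t s = (tensorPowMatrix ρ (M * j) g).col t s
  rw [← Matrix.mulVec_single_one, tensorPowMatrix_mul, ← Matrix.mulVec_mulVec, h1,
    Matrix.mulVec_single_one]

theorem apply_mul_fixer {M j : ℕ} {f : G → k} (hf : f ∈ zeroWeightCoefficients ρ N (M * j)) {κ : G}
    (hκ : κ ∈ zeroWeightFixer ρ N M) (g : G) : f (g * κ) = f g := by
  induction hf using Submodule.span_induction with
  | mem f hf =>
    obtain ⟨⟨s, t⟩, rfl⟩ := hf
    exact tensorPowMatrix_mul_fixer hκ s t.2 g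
  | zero => rfl
  | add f h _ _ hf hh => rw [Pi.add_apply, Pi.add_apply, hf, hh]
  | smul c f _ hf => rw [Pi.smul_apply, Pi.smul_apply, hf]

/-- Coefficients of weight zero separate the identity from finitely many cosets of the fixer. -/
theorem exists_coefficient_separating {M : ℕ} (h1 : 1 ∈ zeroWeightCoefficients ρ N M)
    (S : Finset (G ⧸ zeroWeightFixer ρ N M)) (hS : ((1 : G) : G ⧸ zeroWeightFixer ρ N M) ∉ S) :
    ∃ j, ∃ f ∈ zeroWeightCoefficients ρ N (M * j), f 1 = 1 ∧ ∀ x ∈ S, f x.out = 0 := by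
  classical
  induction S using Finset.induction_on with
  | empty => exact ⟨0, 1, one_mem_zeroWeightCoefficients_mul h1 0, rfl, by simp⟩
  | insert x S _ ih =>
    rw [Finset.mem_insert, not_or] at hS
    obtain ⟨j, f, hf, hf1, hfS⟩ := ih hS.2
    have hx : x.out ∉ zeroWeightFixer ρ N M := fun h => hS.1 <| by
      rw [← QuotientGroup.out_eq' x, QuotientGroup.eq, inv_one, one_mul]
      exact h
    obtain ⟨i, t, ht, s, hs⟩ : ∃ i, ∃ t ∈ zeroWeightWords ρ N (M * i), ∃ s,
        tensorPowMatrix ρ (M * i) x.out s t ≠ tensorPowMatrix ρ (M * i) 1 s t := by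
      by_contra! hcon
      refine hx fun i t ht => ?_
      rw [← Matrix.one_mulVec (Pi.single t 1), ← tensorPowMatrix_one ρ (M * i),
        Matrix.mulVec_single_one]
      exact funext fun s => hcon i t ht s
    let μ : G → k := fun g => tensorPowMatrix ρ (M * i) g s t
    have hμ : μ 1 - μ x.out ≠ 0 := sub_ne_zero.2 hs.symm
    refine ⟨j + i, f * ((μ 1 - μ x.out)⁻¹ • (μ - μ x.out • 1)), ?_, ?_, ?_⟩
    · rw [mul_add]
      exact mul_mem_zeroWeightCoefficients hf <| Submodule.smul_mem _ _ <|
        Submodule.sub_mem _ (coefficient_mem_zeroWeightCoefficients s ht) <|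
          Submodule.smul_mem _ _ (one_mem_zeroWeightCoefficients_mul h1 i)
    · simp [hf1, hμ]
    · intro y hy
      rcases Finset.mem_insert.1 hy with rfl | hy
      · simp
      · simp [hfS y hy]

/-- Up to a shift of the degree and a constant factor, there are at least as many invariants as
words of weight zero. -/
theorem exists_card_zeroWeightWords_le (hN : ∀ g ∈ N, (ρ g).val.IsDiag) [N.FiniteIndex] {M : ℕ}
    (h1 : 1 ∈ zeroWeightCoefficients ρ N M) :
    ∃ n₀, ∀ l, Nat.card (zeroWeightWords ρ N (M * l)) ≤
      m ^ n₀ * Module.finrank k (tensorInvariants ρ (M * l + n₀)) := by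
  classical
  have : (zeroWeightFixer ρ N M).FiniteIndex := Subgroup.finiteIndex_of_le (le_zeroWeightFixer hN M)
  let : Fintype (G ⧸ zeroWeightFixer ρ N M) := Subgroup.fintypeQuotientOfFiniteIndex
  obtain ⟨j, δ, hδ, hδ1, hδS⟩ := exists_coefficient_separating h1
    (Finset.univ.erase ((1 : G) : G ⧸ zeroWeightFixer ρ N M)) (Finset.notMem_erase _ _)
  let x₀ : G ⧸ zeroWeightFixer ρ N M := ((1 : G) : G ⧸ zeroWeightFixer ρ N M)
  have hx₀ : x₀.out ∈ zeroWeightFixer ρ N M := by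
    have h2 : ((1 : G) : G ⧸ zeroWeightFixer ρ N M) = (x₀.out : G) :=
      (QuotientGroup.out_eq' x₀).symm
    rw [QuotientGroup.eq, inv_one, one_mul] at h2
    exact h2
  obtain ⟨d, hd⟩ := (Submodule.mem_span_range_iff_exists_fun k).1 hδ
  refine ⟨M * j, fun l => ?_⟩
  let W := tensorInvariants ρ (M * l + M * j)
  let average (t : Fin (M * l) → Fin m) (t' : Fin (M * j) → Fin m) :
      (Fin (M * l + M * j) → Fin m) → k :=
    ∑ x : G ⧸ zeroWeightFixer ρ N M,
      (tensorPowMatrix ρ (M * l + M * j) x.out).col (Fin.append t t')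
  have haverage : ∀ t ∈ zeroWeightWords ρ N (M * l), ∀ t' ∈ zeroWeightWords ρ N (M * j),
      average t t' ∈ W := by
    intro t ht t' ht' h
    have h2 : ∀ g, (tensorPowMatrix ρ (M * l + M * j) h).mulVec
        ((tensorPowMatrix ρ (M * l + M * j) g).col (Fin.append t t')) =
        (tensorPowMatrix ρ (M * l + M * j) (h * g)).col (Fin.append t t') := by
      intro g
      rw [← Matrix.mulVec_single_one, Matrix.mulVec_mulVec, ← tensorPowMatrix_mul,
        Matrix.mulVec_single_one]
    simp only [average]
    rw [Matrix.mulVec_sum]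
    simp only [h2]
    refine Subgroup.sum_quotient_out_mul _
      (fun g => (tensorPowMatrix ρ (M * l + M * j) g).col (Fin.append t t')) (fun g κ hκ => ?_) h
    funext w
    rw [← Fin.append_castAdd_natAdd (f := w)]
    simp only [Matrix.col_apply, tensorPowMatrix_append, tensorPowMatrix_mul_fixer hκ _ ht,
      tensorPowMatrix_mul_fixer hκ _ ht']
  let Φ : ((Fin (M * j) → Fin m) → W) →ₗ[k] ((Fin (M * l) → Fin m) → k) :=
    LinearMap.pi fun s => ∑ s', (LinearMap.proj (Fin.append s s')).comp
      (W.subtype.comp (LinearMap.proj s'))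
  have hΦ : ∀ t ∈ zeroWeightWords ρ N (M * l), Pi.single t 1 ∈ LinearMap.range Φ := by
    intro t ht
    refine ⟨fun s' => ∑ t', d (s', t') • ⟨average t t'.1, haverage t ht t'.1 t'.2⟩, ?_⟩
    funext s
    have h2 : ∀ x : G ⧸ zeroWeightFixer ρ N M, δ x.out = if x = x₀ then 1 else 0 := by
      intro x
      split_ifs with hx
      · rw [hx, ← one_mul x₀.out, apply_mul_fixer hδ hx₀, hδ1]
      · exact hδS x (Finset.mem_erase.2 ⟨hx, Finset.mem_univ _⟩)
    have h3 : ∀ g, δ g = ∑ s', ∑ t', d (s', t') * tensorPowMatrix ρ (M * j) g s' t'.1 := by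
      intro g
      rw [← hd, Finset.sum_apply, Fintype.sum_prod_type]
      rfl
    calc Φ _ s = ∑ s', ∑ t', d (s', t') * average t t'.1 (Fin.append s s') := by
          simp [Φ, Finset.sum_apply]
      _ = ∑ x : G ⧸ zeroWeightFixer ρ N M, tensorPowMatrix ρ (M * l) x.out s t * δ x.out := by
          simp only [h3, average, Finset.sum_apply, Matrix.col_apply, tensorPowMatrix_append,
            Finset.mul_sum]
          symm
          rw [Finset.sum_comm]
          refine Finset.sum_congr rfl fun s' _ => ?_
          rw [Finset.sum_comm]
          exact Finset.sum_congr rfl fun t' _ => Finset.sum_congr rfl fun x _ =>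
            mul_left_comm _ _ _
      _ = tensorPowMatrix ρ (M * l) 1 s t := by
          simp only [h2, mul_ite, mul_one, mul_zero, Finset.sum_ite_eq', Finset.mem_univ, if_true]
          rw [← one_mul x₀.out, tensorPowMatrix_mul_fixer hx₀ s ht]
      _ = (Pi.single t 1 : (Fin (M * l) → Fin m) → k) s := by
          rw [tensorPowMatrix_one, Matrix.one_apply, Pi.single_apply]
  have hli : LinearIndependent k fun t : zeroWeightWords ρ N (M * l) =>
      (⟨Pi.single t.1 1, hΦ t.1 t.2⟩ : LinearMap.range Φ) := by
    refine LinearIndependent.of_comp (LinearMap.range Φ).subtype ?_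
    convert (Pi.basisFun k (Fin (M * l) → Fin m)).linearIndependent.comp _
      Subtype.val_injective using 1
    funext t
    simp
  calc Nat.card (zeroWeightWords ρ N (M * l)) = Fintype.card (zeroWeightWords ρ N (M * l)) :=
        Nat.card_eq_fintype_card
    _ ≤ Module.finrank k (LinearMap.range Φ) := hli.fintype_card_le_finrank
    _ ≤ Module.finrank k ((Fin (M * j) → Fin m) → W) := LinearMap.finrank_range_le Φ
    _ = m ^ (M * j) * Module.finrank k W := by
        rw [Module.finrank_pi_fintype]
        simp

end MatrixCoefficients

section Counting

open scoped Finset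

theorem Fintype.prod_comp_eq_of_card_fiber_eq {ι κ A : Type*} [Fintype ι] [Fintype κ]
    [DecidableEq κ] [CommMonoid A] {v w : ι → κ} (h : ∀ c, #{i | v i = c} = #{i | w i = c})
    (f : κ → A) : ∏ i, f (v i) = ∏ i, f (w i) := by
  rw [← Finset.prod_fiberwise' _ v, ← Finset.prod_fiberwise' _ w]
  simp only [Finset.prod_const, h]

/-- Some multiplicity vector is shared by a large set of words. -/
theorem exists_pow_le_mul_card_fiber (m q : ℕ) : ∃ c : Fin m → Fin (q + 1),
    m ^ q ≤ (q + 1) ^ m * Nat.card {w : Fin q → Fin m // ∀ b, #{i | w i = b} = (c b : ℕ)} := by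
  classical
  let count (w : Fin q → Fin m) (b : Fin m) : Fin (q + 1) :=
    ⟨#{i | w i = b}, Nat.lt_succ_of_le ((Finset.card_le_univ _).trans (Fintype.card_fin q).le)⟩
  obtain ⟨c, hc⟩ := Finite.exists_max fun c : Fin m → Fin (q + 1) => #{w | count w = c}
  refine ⟨c, ?_⟩
  calc m ^ q = ∑ c, #{w | count w = c} := by
        rw [← Finset.card_eq_sum_card_fiberwise fun _ _ => Finset.mem_coe.2 (Finset.mem_univ _)]
        simp
    _ ≤ ∑ _c : Fin m → Fin (q + 1), #{w | count w = c} := Finset.sum_le_sum fun c' _ => hc c'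
    _ = (q + 1) ^ m * #{w | count w = c} := by simp
    _ = _ := by
        rw [Nat.card_eq_fintype_card, Fintype.card_subtype]
        congr 2
        ext w
        simp [count, funext_iff, Fin.ext_iff]

variable {k G : Type*} [Field k] [Group G] {m : ℕ} {ρ : G →* Matrix.GeneralLinearGroup (Fin m) k}
  {N : Subgroup G}

/-- A diagonal subgroup with determinants killed by `q` has many words of weight zero. -/
theorem pow_le_mul_card_zeroWeightWords [NeZero m] (hN : ∀ g ∈ N, (ρ g).val.IsDiag) {q : ℕ}
    (hdet : ∀ g ∈ N, (ρ g).val.det ^ q = 1) :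
    m ^ (q * m) ≤ (q + 1) ^ (m * m) * Nat.card (zeroWeightWords ρ N (q * m)) := by
  obtain ⟨c, hc⟩ := exists_pow_le_mul_card_fiber m q
  let F := {w : Fin q → Fin m // ∀ b, #{i | w i = b} = (c b : ℕ)}
  let shuffle (w : Fin m → F) (i : Fin (q * m)) : Fin m :=
    (w (finProdFinEquiv.symm i).2).1 (finProdFinEquiv.symm i).1 + (finProdFinEquiv.symm i).2
  have hmem : ∀ w, shuffle w ∈ zeroWeightWords ρ N (q * m) := by
    intro w g hg
    let χ (b : Fin m) : k := (ρ g).val b b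
    have hχ : ∏ b, χ b = (ρ g).val.det := by
      rw [← Matrix.det_diagonal]
      congr 1
      exact (hN g hg).diagonal_diag
    calc ∏ i, χ (shuffle w i) = ∏ a, ∏ i, χ ((w a).1 i + a) := by
          rw [← finProdFinEquiv.prod_comp, Fintype.prod_prod_type, Finset.prod_comm]
          simp only [shuffle, Equiv.symm_apply_apply]
      _ = ∏ a, ∏ i, χ ((w 0).1 i + a) := Finset.prod_congr rfl fun a _ =>
          Fintype.prod_comp_eq_of_card_fiber_eq
            (fun b => ((w a).2 b).trans ((w 0).2 b).symm) fun b => χ (b + a)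
      _ = ∏ _i : Fin q, (ρ g).val.det := by
          rw [Finset.prod_comm]
          refine Finset.prod_congr rfl fun i _ => ?_
          rw [← hχ]
          exact Equiv.prod_comp (Equiv.addLeft ((w 0).1 i)) χ
      _ = 1 := by rw [Finset.prod_const, Finset.card_univ, Fintype.card_fin, hdet g hg]
  have hinj : Function.Injective fun w : Fin m → F =>
      (⟨shuffle w, hmem w⟩ : zeroWeightWords ρ N (q * m)) := by
    intro w w' h
    funext a
    refine Subtype.ext (funext fun i => ?_)
    have h1 := congrFun (congrArg Subtype.val h) (finProdFinEquiv (i, a))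
    simp only [shuffle, Equiv.symm_apply_apply] at h1
    exact add_right_cancel h1
  calc m ^ (q * m) = (m ^ q) ^ m := pow_mul _ _ _
    _ ≤ ((q + 1) ^ m * Nat.card F) ^ m := Nat.pow_le_pow_left hc m
    _ = (q + 1) ^ (m * m) * Nat.card (Fin m → F) := by
        rw [mul_pow, ← pow_mul, Nat.card_fun, Nat.card_fin]
    _ ≤ _ := Nat.mul_le_mul_left _ (Nat.card_le_card_of_injective _ hinj)

end Counting

section LowerBound

variable {k G : Type u} [Field k] [Group G] {m : ℕ}

theorem TS_tpow_conj_le (ρ : G →* Matrix.GeneralLinearGroup (Fin m) k)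
    (P : Matrix.GeneralLinearGroup (Fin m) k) (n : ℕ) :
    TS (tpow (Rep.of (matRep ((MulAut.conj P⁻¹).toMonoidHom.comp ρ))) n) ≤
      TS (tpow (Rep.of (matRep ρ)) n) := by
  obtain ⟨i, r, hri, h⟩ := hasTrivialSummand_TS ((MulAut.conj P⁻¹).toMonoidHom.comp ρ) n
  let A (Q : Matrix.GeneralLinearGroup (Fin m) k) : Matrix (Fin n → Fin m) (Fin n → Fin m) k :=
    Matrix.piKronecker fun _ : Fin n => Q.val
  have hA : ∀ Q Q', A Q * A Q' = A (Q * Q') := fun Q Q' => by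
    simp only [A, Matrix.piKronecker_mul, Units.val_mul]
  have hA1 : A 1 = 1 := by simp only [A, Units.val_one, Matrix.piKronecker_one]
  have hconj : ∀ g, A (P⁻¹ * ρ g * P) * i = i ∧ r * A (P⁻¹ * ρ g * P) = r := fun g => by
    have h1 := h g
    simp only [MonoidHom.comp_apply, MulEquiv.toMonoidHom_eq_coe, MonoidHom.coe_coe,
      MulAut.conj_apply, inv_inv] at h1
    exact h1
  refine HasTrivialSummand.le_TS ρ n ⟨A P * i, r * A P⁻¹, ?_, fun g => ⟨?_, ?_⟩⟩
  · rw [Matrix.mul_assoc, ← Matrix.mul_assoc (A P⁻¹), hA, inv_mul_cancel, hA1, Matrix.one_mul, hri]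
  · change A (ρ g) * (A P * i) = A P * i
    conv_rhs => rw [← (hconj g).1]
    rw [← Matrix.mul_assoc, ← Matrix.mul_assoc, hA, hA]
    congr 2
    group
  · change r * A P⁻¹ * A (ρ g) = r * A P⁻¹
    conv_rhs => rw [← (hconj g).2]
    rw [Matrix.mul_assoc, Matrix.mul_assoc, hA, hA]
    congr 2
    group

/-- If `ρ` is diagonal on a normal subgroup of finite index prime to the characteristic, and the
determinant has finite order, then there are many trivial summands. -/
theorem exists_pow_le_mul_TS [NeZero m] (p : ℕ) [CharP k p]
    {ρ : G →* Matrix.GeneralLinearGroup (Fin m) k} {N : Subgroup G}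
    (hN : ∀ g ∈ N, (ρ g).val.IsDiag) [N.FiniteIndex] (hp : ¬ p ∣ N.index) {q : ℕ}
    (hdet : ∀ g, (ρ g).val.det ^ q = 1) :
    ∃ n₀, ∀ l, m ^ (q * m * l) ≤
      (q * l + 1) ^ (m * m) * (m ^ n₀ * TS (tpow (Rep.of (matRep ρ)) (q * m * l + n₀))) := by
  have h1 : 1 ∈ zeroWeightCoefficients ρ N (q * m) := by
    have := det_pow_mem_zeroWeightCoefficients hN q fun g _ => hdet g
    simp only [hdet] at this
    exact this
  obtain ⟨n₀, hn₀⟩ := exists_card_zeroWeightWords_le hN h1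
  refine ⟨n₀, fun l => ?_⟩
  have h2 := pow_le_mul_card_zeroWeightWords (q := q * l) hN fun g _ => by
    rw [pow_mul, hdet, one_pow]
  rw [mul_right_comm q l m] at h2
  exact h2.trans <| Nat.mul_le_mul_left _ <| (hn₀ l).trans <| Nat.mul_le_mul_left _ <|
    (hasTrivialSummand_of_isDiag p hN hp _).le_TS ρ _

theorem isBoundedUnder_TS_rpow (V : Rep.{u} k G) (hV : ∀ n, TS (tpow V n) ≤ m ^ n) :
    Filter.atTop.IsBoundedUnder (· ≤ ·) fun n : ℕ => (TS (tpow V n) : ℝ) ^ ((n : ℝ)⁻¹) := by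
  refine Filter.isBoundedUnder_of_eventually_le (a := (m : ℝ)) ?_
  filter_upwards [Filter.eventually_ge_atTop 1] with n hn
  calc (TS (tpow V n) : ℝ) ^ ((n : ℝ)⁻¹) ≤ ((m : ℝ) ^ n) ^ ((n : ℝ)⁻¹) :=
        Real.rpow_le_rpow (Nat.cast_nonneg _) (by exact_mod_cast hV n) (by positivity)
    _ = m := Real.pow_rpow_inv_natCast (Nat.cast_nonneg m) (by omega)

theorem le_dG_of_frequently_s1 (V : Rep.{u} k G) (hV : ∀ n, TS (tpow V n) ≤ m ^ n) (hm : m ≠ 0)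
    (a : ℕ) {b : ℝ} (hb : 0 ≤ b)
    (h : ∃ᶠ n : ℕ in Filter.atTop, (m : ℝ) ^ n ≤ n ^ a * b * TS (tpow V n)) : m ≤ dG V := by
  have hm0 : (0 : ℝ) < m := by positivity
  refine le_of_forall_lt_imp_le_of_dense fun c hc => ?_
  let c' := max c 0
  have hc0 : 0 ≤ c' := le_max_right _ _
  have hcm : c' < m := max_lt hc hm0
  refine (le_max_left c 0).trans (Filter.le_limsup_of_frequently_le ?_ ?_)
  · have h1 : Filter.Tendsto (fun n : ℕ => b * ((n : ℝ) ^ a * (c' / m) ^ n)) Filter.atTop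
        (nhds (b * 0)) := (tendsto_pow_const_mul_const_pow_of_abs_lt_one a (by
          rw [abs_of_nonneg (by positivity)]
          exact (div_lt_one hm0).2 hcm)).const_mul b
    rw [mul_zero] at h1
    refine (h.and_eventually ((h1.eventually_lt_const one_pos).and
      (Filter.eventually_ge_atTop 1))).mono ?_
    rintro n ⟨hn, hlt, hn1⟩
    have h2 : c' ^ n ≤ TS (tpow V n) := by
      by_contra! hcon
      refine lt_irrefl ((m : ℝ) ^ n) ?_
      calc (m : ℝ) ^ n ≤ n ^ a * b * TS (tpow V n) := hn
        _ ≤ n ^ a * b * c' ^ n := by gcongr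
        _ = b * ((n : ℝ) ^ a * (c' / m) ^ n) * m ^ n := by
          rw [div_pow]
          field_simp
        _ < 1 * m ^ n := by gcongr
        _ = m ^ n := one_mul _
    calc c' = (c' ^ n) ^ ((n : ℝ)⁻¹) := (Real.pow_rpow_inv_natCast hc0 (by omega)).symm
      _ ≤ (TS (tpow V n) : ℝ) ^ ((n : ℝ)⁻¹) := Real.rpow_le_rpow (by positivity) h2 (by positivity)
  · exact isBoundedUnder_TS_rpow V hV

theorem le_dG_of_isDiag (p : ℕ) [CharP k p] (ρ : G →* Matrix.GeneralLinearGroup (Fin m) k)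
    (P : Matrix.GeneralLinearGroup (Fin m) k) (hm : m ≠ 0) {N : Subgroup G}
    (hN : ∀ g ∈ N, (P⁻¹ * ρ g * P).val.IsDiag) [N.FiniteIndex] (hp : ¬ p ∣ N.index) {q : ℕ}
    (hq : q ≠ 0) (hdet : ∀ g, (ρ g).val.det ^ q = 1) : m ≤ dG (Rep.of (matRep ρ)) := by
  have : NeZero m := ⟨hm⟩
  let ρ' := (MulAut.conj P⁻¹).toMonoidHom.comp ρ
  have hρ' : ∀ g, ρ' g = P⁻¹ * ρ g * P := fun g => by simp [ρ']
  obtain ⟨n₀, hn₀⟩ := exists_pow_le_mul_TS (ρ := ρ') (q := q) p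
    (fun g hg => by rw [hρ']; exact hN g hg) hp fun g => by
      rw [hρ', Units.val_mul, Units.val_mul, Matrix.det_units_conj', hdet]
  refine le_dG_of_frequently_s1 _ (TS_tpow_le ρ) hm (m * m) (b := 2 ^ (m * m) * m ^ (2 * n₀))
    (by positivity) ?_
  rw [Filter.frequently_atTop]
  intro l₀
  let l := l₀ + 1
  have hl : 0 < l := Nat.succ_pos _
  have hqm : q * l ≤ q * m * l := Nat.mul_le_mul_right _ (Nat.le_mul_of_pos_right q hm.bot_lt)
  have hql : l ≤ q * l := Nat.le_mul_of_pos_left l hq.bot_lt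
  refine ⟨q * m * l + n₀, by omega, ?_⟩
  set n := q * m * l + n₀ with hn
  have h1 : m ^ n ≤ n ^ (m * m) * (2 ^ (m * m) * m ^ (2 * n₀)) *
      TS (tpow (Rep.of (matRep ρ)) n) := by
    calc m ^ n = m ^ (q * m * l) * m ^ n₀ := by rw [hn, pow_add]
      _ ≤ (q * l + 1) ^ (m * m) * (m ^ n₀ * TS (tpow (Rep.of (matRep ρ')) n)) * m ^ n₀ :=
        Nat.mul_le_mul_right _ (hn₀ l)
      _ ≤ (2 * n) ^ (m * m) * (m ^ n₀ * TS (tpow (Rep.of (matRep ρ)) n)) * m ^ n₀ := by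
        gcongr
        · omega
        · exact TS_tpow_conj_le ρ P n
      _ = _ := by
        generalize TS (tpow (Rep.of (matRep ρ)) n) = x
        rw [mul_pow, two_mul n₀, pow_add]
        ring
  exact_mod_cast h1

end LowerBound

section Main

theorem dG_matRep_le {k G : Type u} [Field k] [Group G] {m : ℕ}
    (ρ : G →* Matrix.GeneralLinearGroup (Fin m) k) : dG (Rep.of (matRep ρ)) ≤ m :=
  dG_le_of_TS_le_pow _ (Nat.cast_nonneg m) fun n => by exact_mod_cast TS_tpow_le ρ n

theorem dG_matRep_nonneg {k G : Type u} [Field k] [Group G] {m : ℕ}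
    (ρ : G →* Matrix.GeneralLinearGroup (Fin m) k) : 0 ≤ dG (Rep.of (matRep ρ)) :=
  Filter.le_limsup_of_frequently_le
    (Filter.Frequently.of_forall fun _ => Real.rpow_nonneg (Nat.cast_nonneg _) _)
    (isBoundedUnder_TS_rpow _ (TS_tpow_le ρ))

/-- A homomorphism to a group with finite range is killed by a positive power. -/
theorem MonoidHom.exists_pow_eq_one_of_finite_range {G H : Type*} [Group G] [Group H] (φ : G →* H)
    (h : (Set.range φ).Finite) : ∃ q ≠ 0, ∀ g, φ g ^ q = 1 := by
  have : Finite φ.range := h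
  refine ⟨Nat.card φ.range, Nat.card_pos.ne', fun g => ?_⟩
  exact congrArg Subtype.val (pow_card_eq_one' (x := (⟨φ g, g, rfl⟩ : φ.range)))

end Main

/-- **Theorem (characteristic `p` case).** For a finite-dimensional representation
`ρ : G → GL_m(k)` of a group `G` over an algebraically closed field `k` of positive
characteristic `p`, `d(G, V) = dim V` iff the determinant takes finitely many values on
`ρ(G)` and the only unipotent element of the Zariski closure of `ρ(G)` is the identity. -/
theorem dG_eq_dim_iff_det_finite_and_no_unipotent_charP {k G : Type u} [Field k]
    [IsAlgClosed k] [Group G] (p : ℕ) (hp : 0 < p) [CharP k p] {m : ℕ}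
    (ρ : G →* Matrix.GeneralLinearGroup (Fin m) k) :
    dG (Rep.of (matRep ρ)) = (m : ℝ) ↔
      ((Set.range fun g : G => Matrix.det (ρ g).val).Finite ∧
        ∀ g ∈ zariskiClosure (Set.range fun g : G => ρ g), IsUnipotentGL g → g = 1) := by
  have : Fact p.Prime := ⟨(CharP.char_is_prime_or_zero k p).resolve_right hp.ne'⟩
  constructor
  · intro h
    refine ⟨?_, fun u hu huni => ?_⟩
    · by_contra hdet
      exact (dG_lt_of_infinite_range_det p ρ hdet).ne h
    · by_contra hu1
      exact (dG_lt_of_isUnipotentGL p ρ hu huni hu1).ne h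
  · rintro ⟨hdet, huni⟩
    refine le_antisymm (dG_matRep_le ρ) ?_
    rcases eq_or_ne m 0 with rfl | hm
    · exact_mod_cast dG_matRep_nonneg ρ
    obtain ⟨N, P, -, hfin, hindex, hN⟩ := exists_normal_diagonalizable_subgroup p ρ huni
    obtain ⟨q, hq, hpow⟩ := (Matrix.GeneralLinearGroup.det.comp ρ).exists_pow_eq_one_of_finite_range
      (Set.Finite.of_finite_image (f := Units.val) (by rwa [← Set.range_comp])
        Units.val_injective.injOn)
    exact le_dG_of_isDiag p ρ P hm hN hindex hq fun g => by
      simpa using congrArg Units.val (hpow g)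
end
end
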